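/- Let k be a field and X an indecomposable object of S_k(6) with dimension pair (v,u) such that v ≠ 2u. If X is m-stackable for some integer m ≥ 1, then m ≤ 6. -/

import Mathlib

universe u

/-- An object of the category `S_k(n)`: a finite-dimensional `k`-vector space `V`,
a `k`-subspace `U ⊆ V`, and a linear operator `T : V → V` with `T ^ n = 0` and
`T (U) ⊆ U`. -/
structure SObj (k : Type u) [Field k] (n : ℕ) : Type (u + 1) where
  carrier : Type u
  [instAddCommGroup : AddCommGroup carrier]
  [instModule : Module k carrier]
  [instFin : FiniteDimensional k carrier]
  U : Submodule k carrier
  T : carrier →ₗ[k] carrier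
  pow_eq_zero : T ^ n = 0
  maps_U : ∀ x ∈ U, T x ∈ U

namespace SObj

attribute [instance] instAddCommGroup instModule instFin

variable {k : Type u} [Field k] {n : ℕ}

/-- Isomorphism of objects of `S_k(n)`: a linear bijection intertwining the operators
and carrying one invariant subspace onto the other. -/
def Iso (X Y : SObj k n) : Prop :=
  ∃ e : X.carrier ≃ₗ[k] Y.carrier,
    (∀ v, e (X.T v) = Y.T (e v)) ∧ X.U.map e.toLinearMap = Y.U

/-- Indecomposability: the object is nonzero and there is no decomposition
`V = V₁ ⊕ V₂` into two nonzero `T`-invariant subspaces with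
`U = (U ∩ V₁) ⊕ (U ∩ V₂)`. -/
def Indec (X : SObj k n) : Prop :=
  (∃ v : X.carrier, v ≠ 0) ∧
    ¬∃ V₁ V₂ : Submodule k X.carrier,
        V₁ ≠ ⊥ ∧ V₂ ≠ ⊥ ∧ IsCompl V₁ V₂ ∧
          (∀ x ∈ V₁, X.T x ∈ V₁) ∧ (∀ x ∈ V₂, X.T x ∈ V₂) ∧
            X.U = X.U ⊓ V₁ ⊔ X.U ⊓ V₂

/-- The dimension pair `(dim_k V, dim_k U)` of an object of `S_k(n)`. -/
noncomputable def dimPair (X : SObj k n) : ℕ × ℕ :=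
  (Module.finrank k X.carrier, Module.finrank k X.U)

end SObj

/-- `X` is `m`-stackable: there is an indecomposable object `Y` of `S_k(n)` together with a
chain of inflations `0 = W₀ ⊆ W₁ ⊆ ⋯ ⊆ W_m = Y` all of whose `m` subquotients are
isomorphic to `X`.  The `i`-th subquotient being isomorphic to `X` is expressed by a
surjective linear map `q : W_{i+1} → X.carrier` with kernel `W_i`, intertwining the
operators and carrying `(U ∩ W_{i+1} + W_i)/W_i` onto `X.U`. -/
def SObj.Stackable {k : Type u} [Field k] {n : ℕ} (X : SObj k n) (m : ℕ) : Prop :=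
  ∃ Y : SObj k n, Y.Indec ∧
    ∃ W : Fin (m + 1) → Submodule k Y.carrier,
      W 0 = ⊥ ∧ W (Fin.last m) = ⊤ ∧ Monotone W ∧
      ∃ hW : ∀ i : Fin (m + 1), ∀ x ∈ W i, Y.T x ∈ W i,
        ∀ i : Fin m,
          ∃ q : ↥(W i.succ) →ₗ[k] X.carrier,
            Function.Surjective q ∧
            (∀ x : ↥(W i.succ), q x = 0 ↔ (x : Y.carrier) ∈ W i.castSucc) ∧
            (∀ x : ↥(W i.succ), q (Y.T.restrict (hW i.succ) x) = X.T (q x)) ∧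
            Submodule.map q (Submodule.comap (W i.succ).subtype Y.U) = X.U

set_option linter.unusedSectionVars false
namespace St6
open Module Submodule

section Generic
variable {k : Type u} [Field k] {V : Type u} [AddCommGroup V] [Module k V] [FiniteDimensional k V]
  {V' : Type u} [AddCommGroup V'] [Module k V'] [FiniteDimensional k V']

noncomputable def d (W : Submodule k V) : ℤ := (finrank k W : ℤ)

theorem d_nonneg (W : Submodule k V) : 0 ≤ d W := by unfold d; positivity

@[simp] theorem d_bot : d (⊥ : Submodule k V) = 0 := by simp [d]

theorem d_top : d (⊤ : Submodule k V) = finrank k V := by simp [d]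

theorem d_mono {A B : Submodule k V} (h : A ≤ B) : d A ≤ d B := by
  unfold d; exact_mod_cast Submodule.finrank_mono h

theorem eq_of_le_of_d {A B : Submodule k V} (h : A ≤ B) (h' : d B ≤ d A) : A = B := by
  unfold d at h'; exact Submodule.eq_of_le_of_finrank_le h (by exact_mod_cast h')

theorem d_lt {A B : Submodule k V} (h : A < B) : d A < d B := by
  unfold d; exact_mod_cast Submodule.finrank_lt_finrank_of_lt h

theorem d_eq_zero {A : Submodule k V} (h : d A ≤ 0) : A = ⊥ :=
  (eq_of_le_of_d bot_le (by simpa using h)).symm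

theorem d_pos {A : Submodule k V} (h : A ≠ ⊥) : 0 < d A := by
  by_contra h'; exact h (d_eq_zero (by omega))

theorem d_sup_inf (A B : Submodule k V) : d (A ⊔ B) + d (A ⊓ B) = d A + d B := by
  unfold d; exact_mod_cast Submodule.finrank_sup_add_finrank_inf_eq A B

theorem d_map_subtype (W : Submodule k V) (A : Submodule k W) : d (A.map W.subtype) = d A := by
  unfold d; exact_mod_cast Submodule.finrank_map_subtype_eq W A

theorem d_map (g : V →ₗ[k] V') (A : Submodule k V) :
    d (A.map g) = d A - d (A ⊓ LinearMap.ker g) := by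
  have h := LinearMap.finrank_range_add_finrank_ker (g.domRestrict A)
  have h1 : LinearMap.range (g.domRestrict A) = A.map g := by
    rw [LinearMap.range_domRestrict]
  have h2 : (LinearMap.ker (g.domRestrict A)).map A.subtype = A ⊓ LinearMap.ker g := by
    ext x; simp [Submodule.mem_map, and_comm]
  rw [h1] at h
  have h3 := d_map_subtype A (LinearMap.ker (g.domRestrict A))
  rw [h2] at h3
  unfold d at *
  rw [h3]; omega

theorem d_map_le (g : V →ₗ[k] V') (A : Submodule k V) : d (A.map g) ≤ d A := by
  rw [d_map]; have := d_nonneg (A ⊓ LinearMap.ker g); omega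

theorem d_map_inj (g : V →ₗ[k] V') (hg : Function.Injective g) (A : Submodule k V) :
    d (A.map g) = d A := by
  rw [d_map, LinearMap.ker_eq_bot.2 hg]; simp

theorem finrank_quot (W : Submodule k V) : (finrank k (V ⧸ W) : ℤ) = finrank k V - d W := by
  have := Submodule.finrank_quotient_add_finrank W
  unfold d; omega

theorem d_comap_mkQ (W : Submodule k V) (B : Submodule k (V ⧸ W)) :
    d (B.comap W.mkQ) = d B + d W := by
  have h := d_map W.mkQ (B.comap W.mkQ)
  rw [Submodule.map_comap_eq_of_surjective W.mkQ_surjective, Submodule.ker_mkQ] at h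
  have : B.comap W.mkQ ⊓ W = W := inf_eq_right.2 (by
    intro x hx; simp [(Submodule.Quotient.mk_eq_zero W).2 hx])
  rw [this] at h; omega

theorem d_span_singleton {e : V} (he : e ≠ 0) : d (k ∙ e) = 1 := by
  unfold d; rw [finrank_span_singleton he]; rfl

theorem map_inf_comap' (g : V →ₗ[k] V') (A : Submodule k V) (B : Submodule k V') :
    (A ⊓ B.comap g).map g = A.map g ⊓ B := by
  ext x; simp only [mem_map, mem_inf, mem_comap]
  constructor
  · rintro ⟨a, ⟨h1, h2⟩, rfl⟩; exact ⟨⟨a, h1, rfl⟩, h2⟩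
  · rintro ⟨⟨a, h1, rfl⟩, h2⟩; exact ⟨a, ⟨h1, h2⟩, rfl⟩

/-- A maximum exists for bounded integer functions. -/
theorem exists_max {α : Type*} (P : α → Prop) (φ : α → ℤ) (b : ℤ) (hb : ∀ a, P a → φ a ≤ b)
    (hne : ∃ a, P a) : ∃ a, P a ∧ ∀ a', P a' → φ a' ≤ φ a := by
  obtain ⟨a0, ha0⟩ := hne
  obtain ⟨z, ⟨a, ha, hz⟩, hmax⟩ := Int.exists_greatest_of_bdd (P := fun z => ∃ a, P a ∧ φ a = z)
    ⟨b, by rintro z ⟨a, ha, rfl⟩; exact hb a ha⟩ ⟨_, a0, ha0, rfl⟩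
  exact ⟨a, ha, fun a' ha' => by rw [hz]; exact hmax _ ⟨a', ha', rfl⟩⟩

variable {ι : Type} [Fintype ι]

/-- weighted dimension function -/
noncomputable def LL (F : ι → Submodule k V) (c : ι → ℤ) (c0 : ℤ) (W : Submodule k V) : ℤ :=
  ∑ i, c i * d (F i ⊓ W) - c0 * d W

@[simp] theorem LL_bot (F : ι → Submodule k V) (c : ι → ℤ) (c0 : ℤ) : LL F c c0 ⊥ = 0 := by
  simp [LL]

theorem LL_le (F : ι → Submodule k V) (c : ι → ℤ) (hc : ∀ i, 0 ≤ c i) (c0 : ℤ) (W : Submodule k V) :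
    LL F c c0 W ≤ (∑ i, c i + |c0|) * finrank k V := by
  unfold LL
  have h1 : ∑ i, c i * d (F i ⊓ W) ≤ ∑ i, c i * finrank k V :=
    Finset.sum_le_sum fun i _ => mul_le_mul_of_nonneg_left
      (by rw [← d_top (k := k)]; exact d_mono le_top) (hc i)
  rw [← Finset.sum_mul] at h1
  have h2 : - c0 * d W ≤ |c0| * finrank k V := by
    calc - c0 * d W ≤ |c0| * d W := mul_le_mul_of_nonneg_right (neg_le_abs c0) (d_nonneg W)
      _ ≤ _ := mul_le_mul_of_nonneg_left (by rw [← d_top (k := k)]; exact d_mono le_top) (abs_nonneg _)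
  nlinarith

theorem LL_super (F : ι → Submodule k V) (c : ι → ℤ) (hc : ∀ i, 0 ≤ c i) (c0 : ℤ)
    (A B : Submodule k V) : LL F c c0 A + LL F c c0 B ≤ LL F c c0 (A ⊔ B) + LL F c c0 (A ⊓ B) := by
  have key : ∀ i, c i * d (F i ⊓ A) + c i * d (F i ⊓ B) ≤
      c i * d (F i ⊓ (A ⊔ B)) + c i * d (F i ⊓ (A ⊓ B)) := by
    intro i
    have h := d_sup_inf (F i ⊓ A) (F i ⊓ B)
    have h1 : d ((F i ⊓ A) ⊔ (F i ⊓ B)) ≤ d (F i ⊓ (A ⊔ B)) := d_mono le_inf_sup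
    have h2 : (F i ⊓ A) ⊓ (F i ⊓ B) = F i ⊓ (A ⊓ B) := (inf_inf_distrib_left _ _ _).symm
    rw [h2] at h
    nlinarith [hc i]
  have := Finset.sum_le_sum fun i (_ : i ∈ Finset.univ) => key i
  simp only [Finset.sum_add_distrib] at this
  have h := d_sup_inf A B
  unfold LL
  have : c0 * d A + c0 * d B = c0 * d (A ⊔ B) + c0 * d (A ⊓ B) := by rw [← mul_add, ← mul_add, h]
  linarith

theorem LL_sub (F : ι → Submodule k V) (c : ι → ℤ) (c0 : ℤ) (W : Submodule k V)
    (A : Submodule k W) :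
    LL (fun i => (F i).comap W.subtype) c c0 A = LL F c c0 (A.map W.subtype) := by
  unfold LL
  rw [d_map_subtype]
  congr 1
  refine Finset.sum_congr rfl fun i _ => ?_
  rw [← d_map_subtype W]
  congr 2
  ext x
  simp only [mem_map, mem_inf, mem_comap, subtype_apply, Subtype.exists]
  constructor
  · rintro ⟨a, ha, ⟨h1, h2⟩, rfl⟩; exact ⟨h1, a, ha, h2, rfl⟩
  · rintro ⟨h1, a, ha, h2, rfl⟩; exact ⟨a, ha, ⟨h1, h2⟩, rfl⟩

theorem LL_quot (F : ι → Submodule k V) (c : ι → ℤ) (c0 : ℤ) (W : Submodule k V)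
    (B : Submodule k (V ⧸ W)) :
    LL (fun i => (F i).map W.mkQ) c c0 B = LL F c c0 (B.comap W.mkQ) - LL F c c0 W := by
  unfold LL
  rw [d_comap_mkQ]
  have key : ∀ i, d ((F i).map W.mkQ ⊓ B) = d (F i ⊓ B.comap W.mkQ) - d (F i ⊓ W) := by
    intro i
    have h1 : (F i).map W.mkQ ⊓ B = (F i ⊓ B.comap W.mkQ).map W.mkQ := by
      rw [map_inf_comap']
    rw [h1, d_map, Submodule.ker_mkQ]
    congr 2
    rw [inf_assoc]; congr 1
    refine inf_eq_right.2 ?_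
    intro x hx; simp [(Submodule.Quotient.mk_eq_zero W).2 hx]
  simp only [key, mul_sub, Finset.sum_sub_distrib]
  ring

theorem LL_image (F : ι → Submodule k V) (F' : ι → Submodule k V') (c : ι → ℤ) (hc : ∀ i, 0 ≤ c i)
    (c0 : ℤ) (g : V →ₗ[k] V') (hg : ∀ i, ∀ x ∈ F i, g x ∈ F' i) (A : Submodule k V) :
    LL F c c0 A - LL F c c0 (A ⊓ LinearMap.ker g) ≤ LL F' c c0 (A.map g) := by
  unfold LL
  rw [d_map]
  have key : ∀ i, c i * d (F i ⊓ A) - c i * d (F i ⊓ (A ⊓ LinearMap.ker g)) ≤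
      c i * d (F' i ⊓ A.map g) := by
    intro i
    rw [← mul_sub]
    refine mul_le_mul_of_nonneg_left ?_ (hc i)
    rw [← inf_assoc, ← d_map]
    refine d_mono (le_inf ?_ (Submodule.map_mono inf_le_right))
    rintro _ ⟨x, hx, rfl⟩
    exact hg i x hx.1
  have := Finset.sum_le_sum fun i (_ : i ∈ Finset.univ) => key i
  simp only [Finset.sum_sub_distrib] at this
  linarith

/-- maximizer of `LL`, of maximal dimension among those satisfying `P`. -/
theorem LL_max (F : ι → Submodule k V) (c : ι → ℤ) (hc : ∀ i, 0 ≤ c i) (c0 : ℤ)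
    (P : Submodule k V → Prop) (hP : ∃ W, P W) :
    ∃ W, P W ∧ (∀ W', P W' → LL F c c0 W' ≤ LL F c c0 W) ∧
      ∀ W', P W' → W < W' → LL F c c0 W' < LL F c c0 W := by
  have hd : ∀ W : Submodule k V, d W ≤ finrank k V := fun W => by
    rw [← d_top (k := k)]; exact d_mono le_top
  obtain ⟨W, hW, hmax⟩ := exists_max P (fun W => (finrank k V + 1) * LL F c c0 W + d W)
    ((finrank k V + 1) * ((∑ i, c i + |c0|) * finrank k V) + finrank k V) (fun W _ => by
      have h1 := LL_le F c hc c0 W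
      have h2 := hd W
      have : (0:ℤ) ≤ finrank k V + 1 := by positivity
      nlinarith) hP
  refine ⟨W, hW, fun W' h' => ?_, fun W' h' hlt => ?_⟩
  · by_contra hcon
    push Not at hcon
    have h1 := hmax W' h'
    have h2 := hd W
    have h3 := d_nonneg W'
    have : (0:ℤ) ≤ finrank k V := by positivity
    nlinarith
  · by_contra hcon
    push Not at hcon
    have h1 := hmax W' h'
    have h2 := d_lt hlt
    have : (0:ℤ) ≤ finrank k V := by positivity
    nlinarith

theorem LL_max' (F : ι → Submodule k V) (c : ι → ℤ) (hc : ∀ i, 0 ≤ c i) (c0 : ℤ)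
    (P : Submodule k V → Prop) (hP : ∃ W, P W) :
    ∃ W, P W ∧ (∀ W', P W' → LL F c c0 W' ≤ LL F c c0 W) ∧
      ∀ W', P W' → W' < W → LL F c c0 W' < LL F c c0 W := by
  have hd : ∀ W : Submodule k V, d W ≤ finrank k V := fun W => by
    rw [← d_top (k := k)]; exact d_mono le_top
  obtain ⟨W, hW, hmax⟩ := exists_max P (fun W => (finrank k V + 1) * LL F c c0 W - d W)
    ((finrank k V + 1) * ((∑ i, c i + |c0|) * finrank k V)) (fun W _ => by
      have h1 := LL_le F c hc c0 W
      have h2 := d_nonneg W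
      have : (0:ℤ) ≤ finrank k V + 1 := by positivity
      nlinarith) hP
  refine ⟨W, hW, fun W' h' => ?_, fun W' h' hlt => ?_⟩
  · by_contra hcon
    push Not at hcon
    have h1 := hmax W' h'
    have h2 := hd W'
    have h3 := d_nonneg W
    have : (0:ℤ) ≤ finrank k V := by positivity
    nlinarith
  · by_contra hcon
    push Not at hcon
    have h1 := hmax W' h'
    have h2 := d_lt hlt
    have : (0:ℤ) ≤ finrank k V := by positivity
    nlinarith

/-- relative dimension estimate -/
theorem d_rel {M N : Type u} [AddCommGroup M] [Module k M] [FiniteDimensional k M]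
    [AddCommGroup N] [Module k N] [FiniteDimensional k N] (π : M →ₗ[k] V') (φ : M →ₗ[k] N)
    (q : Submodule k M) (p' : Submodule k V') (P Q : Submodule k N) (hPQ : P ≤ Q)
    (hq : ∀ x ∈ q, φ x ∈ Q) (hp : ∀ x ∈ q, φ x ∈ P → π x ∈ p') :
    d (q.map π) + d P ≤ d Q + d p' := by
  set r := q ⊓ P.comap φ with hr
  have h1 := d_map φ q
  have h2 := d_map φ r
  have e1 : r ⊓ LinearMap.ker φ = q ⊓ LinearMap.ker φ := by
    ext x; simp only [hr, mem_inf, mem_comap, LinearMap.mem_ker]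
    constructor
    · rintro ⟨⟨a, b⟩, c⟩; exact ⟨a, c⟩
    · rintro ⟨a, c⟩; exact ⟨⟨a, by rw [c]; exact P.zero_mem⟩, c⟩
  rw [e1] at h2
  have h3 : r.map φ = q.map φ ⊓ P := by rw [hr, map_inf_comap']
  have h4 := d_sup_inf (q.map φ) P
  have h5 : d (q.map φ ⊔ P) ≤ d Q := d_mono (sup_le (by rintro _ ⟨x, hx, rfl⟩; exact hq x hx) hPQ)
  have h6 := d_map π q
  have h7 := d_map π r
  have h8 : d (r ⊓ LinearMap.ker π) ≤ d (q ⊓ LinearMap.ker π) :=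
    d_mono (inf_le_inf_right _ inf_le_left)
  have h9 : d (r.map π) ≤ d p' := d_mono (by rintro _ ⟨x, hx, rfl⟩; exact hp x hx.1 hx.2)
  rw [h3] at h2
  omega

end Generic
end St6

set_option linter.unusedSectionVars false
set_option linter.unusedVariables false
namespace St6
open Module Submodule

variable {k : Type u} [Field k] {V : Type u} [AddCommGroup V] [Module k V]
  {V' : Type u} [AddCommGroup V'] [Module k V']
  {V'' : Type u} [AddCommGroup V''] [Module k V'']

theorem j12 : ∀ j : Fin 3, j + 1 + 2 = j := by decide
theorem j21 : ∀ j : Fin 3, j + 2 + 1 = j := by decide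
theorem j11 : ∀ j : Fin 3, j + 1 + 1 = j + 2 := by decide
theorem j22 : ∀ j : Fin 3, j + 2 + 2 = j + 1 := by decide

theorem jall : ∀ j l : Fin 3, l = j ∨ l = j + 1 ∨ l = j + 2 := by decide

theorem sum3 (j : Fin 3) (f : Fin 3 → ℤ) : ∑ i, f i = f j + f (j+1) + f (j+2) := by
  rw [Fin.sum_univ_three]
  fin_cases j
  · rfl
  · change f 0 + f 1 + f 2 = f 1 + f 2 + f 0; ring
  · change f 0 + f 1 + f 2 = f 2 + f 0 + f 1; ring

/-- three-step filtrations, indexed by `Fin 3`. -/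
structure Tri (k : Type u) [Field k] (V : Type u) [AddCommGroup V] [Module k V] where
  F : Fin 3 → Fin 3 → Submodule k V
  h01 : ∀ j, F 0 j ≤ F 1 j
  h12 : ∀ j, F 1 j ≤ F 2 j
  h02 : ∀ j, F 0 j ≤ F 2 (j + 1)

def cw (la mu : ℤ) : Fin 3 → ℤ := ![mu, la + mu, la]

theorem cw_nonneg {la mu : ℤ} (hla : 1 ≤ la) (hmu : 0 ≤ mu) (s : Fin 3) : 0 ≤ cw la mu s := by
  fin_cases s <;> simp [cw] <;> omega

namespace Tri

noncomputable def L (D : Tri k V) (la mu : ℤ) (W : Submodule k V) : ℤ :=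
  LL (fun p : Fin 3 × Fin 3 => D.F p.1 p.2) (fun p => cw la mu p.1) (3 * (la + mu)) W

theorem L_expand (D : Tri k V) (la mu : ℤ) (W : Submodule k V) :
    D.L la mu W = ∑ j, (mu * d (D.F 0 j ⊓ W) + (la + mu) * d (D.F 1 j ⊓ W) + la * d (D.F 2 j ⊓ W))
      - 3 * (la + mu) * d W := by
  unfold L LL
  rw [Fintype.sum_prod_type]
  simp [Fin.sum_univ_three, cw]
  ring

theorem L_top (D : Tri k V) (la mu : ℤ) [FiniteDimensional k V] :
    D.L la mu ⊤ = ∑ j, (mu * d (D.F 0 j) + (la + mu) * d (D.F 1 j) + la * d (D.F 2 j))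
      - 3 * (la + mu) * finrank k V := by
  rw [L_expand]; simp [d_top]

def rot (D : Tri k V) : Tri k V where
  F s j := D.F s (j + 1)
  h01 j := D.h01 _
  h12 j := D.h12 _
  h02 j := D.h02 _

theorem L_rot (D : Tri k V) (la mu : ℤ) (W : Submodule k V) : D.rot.L la mu W = D.L la mu W := by
  rw [L_expand, L_expand]
  simp only [Fin.sum_univ_three, rot, show (0 : Fin 3) + 1 = 1 from rfl,
    show (1 : Fin 3) + 1 = 2 from rfl, show (2 : Fin 3) + 1 = 0 from rfl]
  ring

def sub (D : Tri k V) (W : Submodule k V) : Tri k W where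
  F s j := (D.F s j).comap W.subtype
  h01 j := Submodule.comap_mono (D.h01 j)
  h12 j := Submodule.comap_mono (D.h12 j)
  h02 j := Submodule.comap_mono (D.h02 j)

def quot (D : Tri k V) (W : Submodule k V) : Tri k (V ⧸ W) where
  F s j := (D.F s j).map W.mkQ
  h01 j := Submodule.map_mono (D.h01 j)
  h12 j := Submodule.map_mono (D.h12 j)
  h02 j := Submodule.map_mono (D.h02 j)

theorem L_sub (D : Tri k V) (la mu : ℤ) [FiniteDimensional k V] (W : Submodule k V) (A : Submodule k W) :
    (D.sub W).L la mu A = D.L la mu (A.map W.subtype) := LL_sub _ _ _ _ _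

theorem L_quot (D : Tri k V) (la mu : ℤ) [FiniteDimensional k V] (W : Submodule k V)
    (B : Submodule k (V ⧸ W)) :
    (D.quot W).L la mu B = D.L la mu (B.comap W.mkQ) - D.L la mu W := LL_quot _ _ _ _ _

@[simp] theorem L_bot (D : Tri k V) (la mu : ℤ) [FiniteDimensional k V] : D.L la mu ⊥ = 0 := LL_bot _ _ _

theorem L_super (D : Tri k V) {la mu : ℤ} (hla : 1 ≤ la) (hmu : 0 ≤ mu) [FiniteDimensional k V]
    (A B : Submodule k V) :
    D.L la mu A + D.L la mu B ≤ D.L la mu (A ⊔ B) + D.L la mu (A ⊓ B) :=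
  LL_super _ _ (fun _ => cw_nonneg hla hmu _) _ _ _

/-- filtered maps -/
def Fil (D : Tri k V) (D' : Tri k V') (g : V →ₗ[k] V') : Prop :=
  ∀ s j, ∀ x ∈ D.F s j, g x ∈ D'.F s j

theorem L_image {D : Tri k V} {D' : Tri k V'} {la mu : ℤ} (hla : 1 ≤ la) (hmu : 0 ≤ mu)
    [FiniteDimensional k V] [FiniteDimensional k V'] {g : V →ₗ[k] V'} (hg : Fil D D' g)
    (A : Submodule k V) :
    D.L la mu A - D.L la mu (A ⊓ LinearMap.ker g) ≤ D'.L la mu (A.map g) :=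
  LL_image _ _ _ (fun _ => cw_nonneg hla hmu _) _ _ (fun _ => hg _ _) _

/-- admissibility -/
def Adm (D : Tri k V) : Prop := ∀ j, D.F 0 j ⊓ D.F 1 (j + 1) = ⊥

theorem Adm.zero {D : Tri k V} (h : D.Adm) {j : Fin 3} {x : V} (h0 : x ∈ D.F 0 j)
    (h1 : x ∈ D.F 1 (j + 1)) : x = 0 := by
  have : x ∈ D.F 0 j ⊓ D.F 1 (j + 1) := ⟨h0, h1⟩
  rw [h j] at this; simpa using this

theorem Adm.sub {D : Tri k V} (h : D.Adm) (W : Submodule k V) : (D.sub W).Adm := by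
  intro j
  rw [eq_bot_iff]
  rintro x ⟨h0, h1⟩
  have := h.zero (j := j) (x := (x : V)) h0 h1
  simpa using this

/-- the bound defining membership of the intersection -/
def LowC (D : Tri k V) (la mu : ℤ) : Prop :=
  ∀ W : Submodule k V, (∀ j, W ≤ D.F 2 j ⊔ D.F 1 (j + 2)) → D.L la mu W ≤ 0

theorem d_inf_span_ge (A : Submodule k V) {e : V} (he : e ∈ A) (h0 : e ≠ 0) : d (A ⊓ (k ∙ e)) = 1 := by
  rw [inf_eq_right.2 ((Submodule.span_singleton_le_iff_mem _ _).2 he), ]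
  unfold d; rw [finrank_span_singleton h0]; rfl

theorem d_nn (W : Submodule k V) : 0 ≤ d W := by unfold d; positivity

theorem LowC.adm [FiniteDimensional k V] {D : Tri k V} {la mu : ℤ} (hla : 1 ≤ la) (hmu : 0 ≤ mu) (h : D.LowC la mu) :
    D.Adm := by
  intro j
  rw [eq_bot_iff]
  rintro e ⟨h0, h1⟩
  by_contra hne
  have hne : e ≠ 0 := by simpa using hne
  have hW := h (k ∙ e) (by
    intro l
    rw [Submodule.span_singleton_le_iff_mem]
    have : l = j ∨ l = j + 1 ∨ l = j + 2 := jall j l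
    rcases this with rfl | rfl | rfl
    · exact Submodule.mem_sup_left (D.h12 _ (D.h01 _ h0))
    · exact Submodule.mem_sup_left (D.h12 _ h1)
    · rw [j22]; exact Submodule.mem_sup_right h1)
  rw [L_expand] at hW
  rw [sum3 j, d_inf_span_ge _ h0 hne, d_inf_span_ge _ (D.h01 _ h0) hne,
    d_inf_span_ge _ (D.h12 _ (D.h01 _ h0)) hne, d_inf_span_ge _ h1 hne,
    d_inf_span_ge _ (D.h12 _ h1) hne, d_span_singleton hne] at hW
  have a1 := d_nn (D.F 0 (j+1) ⊓ k ∙ e)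
  have a2 := d_nn (D.F 0 (j+2) ⊓ k ∙ e)
  have a3 := d_nn (D.F 1 (j+2) ⊓ k ∙ e)
  have a4 := d_nn (D.F 2 (j+2) ⊓ k ∙ e)
  have b1 := mul_nonneg hmu a1
  have b2 := mul_nonneg hmu a2
  have b3 := mul_nonneg (show 0 ≤ la + mu by omega) a3
  have b4 := mul_nonneg (show 0 ≤ la by omega) a4
  linarith

/-! ### the construction `tau` -/

def Zt (D : Tri k V) : Submodule k (Fin 3 → V) where
  carrier := {x | (∀ j, x j ∈ D.F 2 j) ∧ ∀ j, x j + x (j+1) + x (j+2) = 0}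
  add_mem' := by
    rintro x y ⟨a, b⟩ ⟨a', b'⟩
    refine ⟨fun j => add_mem (a j) (a' j), fun j => ?_⟩
    have h1 := b j; have h2 := b' j
    have : (x + y) j + (x + y) (j+1) + (x + y) (j+2) =
      (x j + x (j+1) + x (j+2)) + (y j + y (j+1) + y (j+2)) := by
      simp only [Pi.add_apply]; abel
    rw [this, h1, h2, add_zero]
  zero_mem' := ⟨fun j => zero_mem _, fun j => by simp⟩
  smul_mem' := by
    rintro c x ⟨a, b⟩
    refine ⟨fun j => Submodule.smul_mem _ _ (a j), fun j => ?_⟩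
    simp only [Pi.smul_apply, ← smul_add, b j, smul_zero]

def Bt (D : Tri k V) : Submodule k D.Zt where
  carrier := {x | ∃ a : Fin 3 → V, (∀ j, a j ∈ D.F 0 j) ∧ ∀ j, x.1 j = a (j+2) - a j}
  add_mem' := by
    rintro x y ⟨a, ha, hx⟩ ⟨b, hb, hy⟩
    refine ⟨a + b, fun j => add_mem (ha j) (hb j), fun j => ?_⟩
    simp only [Submodule.coe_add, Pi.add_apply, hx, hy]; abel
  zero_mem' := ⟨0, fun j => zero_mem _, fun j => by simp⟩
  smul_mem' := by
    rintro c x ⟨a, ha, hx⟩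
    refine ⟨c • a, fun j => Submodule.smul_mem _ _ (ha j), fun j => ?_⟩
    simp only [Submodule.coe_smul, Pi.smul_apply, hx, smul_sub]

abbrev TV (D : Tri k V) : Type u := D.Zt ⧸ D.Bt

abbrev cls (D : Tri k V) : D.Zt →ₗ[k] D.TV := D.Bt.mkQ

theorem cls_eq_zero (D : Tri k V) (x : D.Zt) :
    D.cls x = 0 ↔ ∃ a : Fin 3 → V, (∀ j, a j ∈ D.F 0 j) ∧ ∀ j, x.1 j = a (j+2) - a j := by
  rw [Submodule.mkQ_apply, Submodule.Quotient.mk_eq_zero]; rfl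

/-- coordinate -/
def co (D : Tri k V) (j : Fin 3) : D.Zt →ₗ[k] V := LinearMap.proj j ∘ₗ D.Zt.subtype

@[simp] theorem co_apply (D : Tri k V) (j : Fin 3) (x : D.Zt) : D.co j x = x.1 j := rfl

/-- preimages of the filtration of `tau` -/
def Gt (D : Tri k V) : Fin 3 → Fin 3 → Submodule k D.Zt :=
  ![fun j => LinearMap.ker (D.co j) ⊓ (D.F 1 (j+1)).comap (D.co (j+1)),
    fun j => LinearMap.ker (D.co j), fun j => (D.F 1 j).comap (D.co j)]

theorem mem_Gt0 (D : Tri k V) (j) (x : D.Zt) :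
    x ∈ D.Gt 0 j ↔ x.1 j = 0 ∧ x.1 (j+1) ∈ D.F 1 (j+1) := Iff.rfl
theorem mem_Gt1 (D : Tri k V) (j) (x : D.Zt) : x ∈ D.Gt 1 j ↔ x.1 j = 0 := Iff.rfl
theorem mem_Gt2 (D : Tri k V) (j) (x : D.Zt) : x ∈ D.Gt 2 j ↔ x.1 j ∈ D.F 1 j := Iff.rfl

def tau (D : Tri k V) : Tri k D.TV where
  F s j := (D.Gt s j).map D.cls
  h01 j := Submodule.map_mono fun x hx => ((mem_Gt0 D j x).1 hx).1
  h12 j := Submodule.map_mono fun x hx => by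
    rw [mem_Gt2, (mem_Gt1 D j x).1 hx]; exact zero_mem _
  h02 j := Submodule.map_mono fun x hx => ((mem_Gt0 D j x).1 hx).2

theorem mem_tau (D : Tri k V) (s j) (y : D.TV) : y ∈ D.tau.F s j ↔ ∃ x ∈ D.Gt s j, D.cls x = y :=
  Iff.rfl

/-- build an element of `Zt` -/
def mkZ (D : Tri k V) (j : Fin 3) (a : V) (h1 : a ∈ D.F 2 (j+1)) (h2 : a ∈ D.F 2 (j+2)) : D.Zt :=
  ⟨fun l => if l = j + 1 then a else if l = j + 2 then -a else 0, by
    constructor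
    · intro l
      beta_reduce; split_ifs with h h'
      · rw [h]; exact h1
      · rw [h']; exact neg_mem h2
      · exact zero_mem _
    · intro l; fin_cases j <;> fin_cases l <;> simp⟩

theorem mkZ_0 (D : Tri k V) (j : Fin 3) (a : V) (h1) (h2) : (D.mkZ j a h1 h2).1 j = 0 := by
  fin_cases j <;> simp [mkZ]
theorem mkZ_1 (D : Tri k V) (j : Fin 3) (a : V) (h1) (h2) : (D.mkZ j a h1 h2).1 (j+1) = a := by
  fin_cases j <;> simp [mkZ]
theorem mkZ_2 (D : Tri k V) (j : Fin 3) (a : V) (h1) (h2) : (D.mkZ j a h1 h2).1 (j+2) = -a := by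
  fin_cases j <;> simp [mkZ]

/-- elementary boundary: `-a` at `j`, `a` at `j+1` -/
def bd (D : Tri k V) (j : Fin 3) (a : V) (h : a ∈ D.F 0 j) : D.Zt :=
  ⟨fun l => if l = j then -a else if l = j + 1 then a else 0, by
    constructor
    · intro l
      beta_reduce; split_ifs with g h'
      · subst g; exact neg_mem (D.h12 _ (D.h01 _ h))
      · rw [h']; exact D.h02 _ h
      · exact zero_mem _
    · intro l; fin_cases j <;> fin_cases l <;> simp⟩

theorem bd_0 (D : Tri k V) (j : Fin 3) (a : V) (h) : (D.bd j a h).1 j = -a := by simp [bd]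
theorem bd_1 (D : Tri k V) (j : Fin 3) (a : V) (h) : (D.bd j a h).1 (j+1) = a := by
  fin_cases j <;> simp [bd]
theorem bd_2 (D : Tri k V) (j : Fin 3) (a : V) (h) : (D.bd j a h).1 (j+2) = 0 := by
  fin_cases j <;> simp [bd]

theorem cls_bd (D : Tri k V) (j : Fin 3) (a : V) (h) : D.cls (D.bd j a h) = 0 := by
  rw [cls_eq_zero]
  refine ⟨fun l => if l = j then a else 0, fun l => ?_, fun l => ?_⟩
  · beta_reduce; split_ifs with h'
    · rw [h']; exact h
    · exact zero_mem _
  · fin_cases j <;> fin_cases l <;> simp [bd]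

theorem Zt_ext {D : Tri k V} (j : Fin 3) {x y : D.Zt} (h0 : x.1 j = y.1 j)
    (h1 : x.1 (j+1) = y.1 (j+1)) (h2 : x.1 (j+2) = y.1 (j+2)) : x = y := by
  apply Subtype.ext; funext l
  have : l = j ∨ l = j + 1 ∨ l = j + 2 := jall j l
  rcases this with rfl | rfl | rfl <;> assumption

theorem mem_tau1_of (D : Tri k V) (j) (x : D.Zt) (hx : x.1 j ∈ D.F 0 j) : D.cls x ∈ D.tau.F 1 j := by
  refine ⟨x + D.bd j (x.1 j) hx, ?_, ?_⟩
  · rw [SetLike.mem_coe, mem_Gt1, Submodule.coe_add, Pi.add_apply, bd_0]; abel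
  · rw [map_add, cls_bd, add_zero]

theorem Adm.tau {D : Tri k V} (h : D.Adm) : D.tau.Adm := by
  intro j
  rw [eq_bot_iff]
  rintro y ⟨⟨x, hx, rfl⟩, ⟨x', hx', he⟩⟩
  obtain ⟨hx0, hx1⟩ := (mem_Gt0 D j x).1 hx
  have hx' := (mem_Gt1 D _ x').1 hx'
  have : D.cls (x - x') = 0 := by rw [map_sub, he, sub_self]
  obtain ⟨a, ha, hb⟩ := (cls_eq_zero D _).1 this
  have e1 := hb (j+1)
  rw [Submodule.coe_sub, Pi.sub_apply, hx', sub_zero, j12] at e1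
  have haj : a j = 0 := h.zero (ha j) (by
    have : a j = x.1 (j+1) + a (j+1) := by rw [e1]; abel
    rw [this]; exact add_mem hx1 (D.h01 _ (ha _)))
  rw [haj, zero_sub] at e1
  have e2 := x.2.2 j
  rw [hx0, e1] at e2
  have : x = D.bd (j+1) (a (j+1)) (ha _) := by
    apply Zt_ext j
    · have := bd_2 D (j+1) (a (j+1)) (ha _); rw [j12] at this; rw [hx0, this]
    · rw [bd_0, e1]
    · have := bd_1 D (j+1) (a (j+1)) (ha _); rw [j11] at this; rw [this]
      rw [← sub_eq_zero]; rw [← e2]; abel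
  rw [this, cls_bd]; exact zero_mem _

end Tri
end St6

set_option linter.unusedSectionVars false
set_option linter.unusedVariables false
namespace St6
open Module Submodule

variable {k : Type u} [Field k] {V : Type u} [AddCommGroup V] [Module k V] [FiniteDimensional k V]
  {V' : Type u} [AddCommGroup V'] [Module k V'] [FiniteDimensional k V']

namespace Tri

theorem finrank_Zt (D : Tri k V) :
    ∑ j, d (D.F 2 j) ≤ finrank k D.Zt + finrank k V := by
  let σ : (∀ j : Fin 3, D.F 2 j) →ₗ[k] V :=
    ∑ j, (D.F 2 j).subtype ∘ₗ LinearMap.proj j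
  have hσ : ∀ x, σ x = (x 0 : V) + x 1 + x 2 := by
    intro x; simp [σ, Fin.sum_univ_three]
  have h := LinearMap.finrank_range_add_finrank_ker σ
  rw [Module.finrank_pi_fintype] at h
  have h1 : finrank k (LinearMap.range σ) ≤ finrank k V := Submodule.finrank_le _
  let ρ : LinearMap.ker σ →ₗ[k] D.Zt :=
    LinearMap.codRestrict D.Zt ((LinearMap.pi fun j => (D.F 2 j).subtype ∘ₗ LinearMap.proj j) ∘ₗ
      (LinearMap.ker σ).subtype) (by
        rintro ⟨x, hx⟩
        have hx' := hσ x
        rw [LinearMap.mem_ker.1 hx] at hx'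
        refine ⟨fun j => (x j).2, fun j => ?_⟩
        rw [hx']
        fin_cases j
        · rfl
        · change (x 1 : V) + x 2 + x 0 = x 0 + x 1 + x 2; abel
        · change (x 2 : V) + x 0 + x 1 = x 0 + x 1 + x 2; abel)
  have h2 : finrank k (LinearMap.ker σ) ≤ finrank k D.Zt := by
    refine LinearMap.finrank_le_finrank_of_injective (f := ρ) ?_
    intro x y hxy
    apply Subtype.ext; funext j; apply Subtype.ext
    exact congrFun (congrArg Subtype.val hxy) j
  unfold d
  have : ((∑ j, finrank k (D.F 2 j) : ℕ) : ℤ) ≤ finrank k D.Zt + finrank k V := by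
    have : ∑ j, finrank k (D.F 2 j) ≤ finrank k D.Zt + finrank k V := by omega
    exact_mod_cast this
  push_cast at this
  exact this

theorem finrank_Bt (D : Tri k V) : d D.Bt ≤ ∑ j, d (D.F 0 j) := by
  let σ : (∀ j : Fin 3, D.F 0 j) →ₗ[k] (Fin 3 → V) :=
    LinearMap.pi fun j => (D.F 0 (j+2)).subtype ∘ₗ LinearMap.proj (j+2) -
      (D.F 0 j).subtype ∘ₗ LinearMap.proj j
  have h := LinearMap.finrank_range_add_finrank_ker σ
  rw [Module.finrank_pi_fintype] at h
  have h1 : d (D.Bt.map D.Zt.subtype) ≤ d (LinearMap.range σ) := by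
    refine d_mono ?_
    rintro _ ⟨x, ⟨a, ha, hx⟩, rfl⟩
    exact ⟨fun j => ⟨a j, ha j⟩, by funext j; simp [σ, hx]⟩
  rw [d_map_subtype] at h1
  refine h1.trans ?_
  unfold d
  have : finrank k (LinearMap.range σ) ≤ ∑ j, finrank k (D.F 0 j) := by omega
  exact_mod_cast this

theorem T1_v (D : Tri k V) : ∑ j, d (D.F 2 j) ≤ finrank k D.TV + finrank k V + ∑ j, d (D.F 0 j) := by
  have h1 := D.finrank_Zt
  have h2 := D.finrank_Bt
  have h3 := finrank_quot D.Bt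
  linarith

theorem T1_4 {D : Tri k V} (h : D.Adm) (j : Fin 3) :
    finrank k D.TV + d (D.F 1 j) + d (D.F 0 (j+2)) ≤ d (D.F 2 j) + d (D.tau.F 2 j) := by
  have hd : D.F 1 j ⊓ D.F 0 (j+2) = ⊥ := by
    have := h (j+2); rw [j21] at this; rw [inf_comm]; exact this
  have h1 := d_sup_inf (D.F 1 j) (D.F 0 (j+2))
  rw [hd, d_bot] at h1
  have := d_rel D.cls (D.co j) ⊤ (D.tau.F 2 j) (D.F 1 j ⊔ D.F 0 (j+2)) (D.F 2 j)
    (sup_le (D.h12 j) (by have := D.h02 (j+2); rwa [j21] at this)) (fun x _ => x.2.1 j) (by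
      intro x _ hx
      obtain ⟨y, hy, a, ha, e⟩ := Submodule.mem_sup.1 hx
      refine ⟨x - D.bd (j+2) a ha, ?_, by rw [map_sub, cls_bd, sub_zero]⟩
      have b1 := bd_1 D (j+2) a ha
      rw [j21] at b1
      rw [SetLike.mem_coe, mem_Gt2, Submodule.coe_sub, Pi.sub_apply, b1]
      rw [co_apply] at e
      rw [← e]; simpa using hy)
  rw [Submodule.map_top, Submodule.range_mkQ, d_top] at this
  linarith

theorem T1_3 (D : Tri k V) (j : Fin 3) :
    d (D.tau.F 2 j) + d (D.F 0 j) ≤ d (D.F 1 j) + d (D.tau.F 1 j) :=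
  d_rel D.cls (D.co j) (D.Gt 2 j) (D.tau.F 1 j) (D.F 0 j) (D.F 1 j) (D.h01 j) (fun x hx => hx)
    (fun x _ hx => D.mem_tau1_of j x hx)

theorem T1_2 (D : Tri k V) (j : Fin 3) :
    d (D.tau.F 1 j) + d (D.F 1 (j+1)) ≤ d (D.F 2 (j+1)) + d (D.tau.F 0 j) :=
  d_rel D.cls (D.co (j+1)) (D.Gt 1 j) (D.tau.F 0 j) (D.F 1 (j+1)) (D.F 2 (j+1)) (D.h12 _)
    (fun x hx => x.2.1 _) (fun x h1 hx => ⟨x, ⟨h1, hx⟩, rfl⟩)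

theorem T1 {D : Tri k V} (h : D.Adm) {la mu : ℤ} (hla : 1 ≤ la) (hmu : 0 ≤ mu) :
    D.L la mu ⊤ ≤ D.tau.L la mu ⊤ := by
  rw [L_top, L_top]
  have hv := mul_le_mul_of_nonneg_left D.T1_v (show 0 ≤ 3 * (la + mu) by omega)
  have h4 := fun j => mul_le_mul_of_nonneg_left (T1_4 h j) (show 0 ≤ 2 * (la + mu) by omega)
  have h3 := fun j => mul_le_mul_of_nonneg_left (D.T1_3 j) (show 0 ≤ la + 2 * mu by omega)
  have h2 := fun j => mul_le_mul_of_nonneg_left (D.T1_2 j) hmu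
  simp only [Fin.sum_univ_three] at *
  have a0 := h4 0; have a1 := h4 1; have a2 := h4 2
  have b0 := h3 0; have b1 := h3 1; have b2 := h3 2
  have c0 := h2 0; have c1 := h2 1; have c2 := h2 2
  simp only [show (0 : Fin 3) + 1 = 1 from rfl,
    show (1 : Fin 3) + 1 = 2 from rfl, show (2 : Fin 3) + 1 = 0 from rfl, show (0 : Fin 3) + 2 = 2 from rfl,
    show (1 : Fin 3) + 2 = 0 from rfl, show (2 : Fin 3) + 2 = 1 from rfl] at *
  linarith

/-! ### the map `u` attached to a filtered map `S → tau Y` -/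

/-- representing matrices -/
structure Mat (Y : Tri k V) {S : Tri k V'} (g : V' →ₗ[k] Y.TV) (i : S.Zt) (M : Fin 3 → Y.Zt) : Prop where
  col : ∀ l, (M l).1 l + (M (l+1)).1 l + (M (l+2)).1 l = 0
  diag : ∀ j, (M j).1 j ∈ Y.F 1 j
  rep : ∀ j, Y.cls (M j) = g (i.1 j)

theorem Mat.sub {Y : Tri k V} {S : Tri k V'} {g : V' →ₗ[k] Y.TV} {i i' : S.Zt} {M M' : Fin 3 → Y.Zt}
    (h : Mat Y g i M) (h' : Mat Y g i' M') : Mat Y g (i - i') (fun j => M j - M' j) where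
  col l := by
    have := h.col l; have h2 := h'.col l
    simp only [Submodule.coe_sub, Pi.sub_apply]
    rw [← sub_eq_zero.2 (this.trans h2.symm)]; abel
  diag j := sub_mem (h.diag j) (h'.diag j)
  rep j := by simp [map_sub, h.rep j, h'.rep j]

def uval {Y : Tri k V} (M : Fin 3 → Y.Zt) : V := (M 1).1 0 - (M 2).1 2

theorem Mat.row {Y : Tri k V} (M : Y.Zt) (j : Fin 3) : M.1 j + M.1 (j+1) + M.1 (j+2) = 0 := M.2.2 j

theorem Mat.shift {Y : Tri k V} {S : Tri k V'} {g : V' →ₗ[k] Y.TV} {i : S.Zt} {M : Fin 3 → Y.Zt}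
    (h : Mat Y g i M) (j : Fin 3) :
    (M (j+1)).1 j - (M (j+2)).1 (j+2) = (M (j+2)).1 (j+1) - (M j).1 j := by
  have c := h.col j
  have r := (M (j+2)).2.2 j
  have : (M (j+1)).1 j - (M (j+2)).1 (j+2) - ((M (j+2)).1 (j+1) - (M j).1 j) =
    ((M j).1 j + (M (j+1)).1 j + (M (j+2)).1 j) -
      ((M (j+2)).1 j + (M (j+2)).1 (j+1) + (M (j+2)).1 (j+2)) := by abel
  rw [← sub_eq_zero, this, c, r, sub_zero]

theorem Mat.uval_eq {Y : Tri k V} {S : Tri k V'} {g : V' →ₗ[k] Y.TV} {i : S.Zt} {M : Fin 3 → Y.Zt}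
    (h : Mat Y g i M) (j : Fin 3) : uval M = (M (j+1)).1 j - (M (j+2)).1 (j+2) := by
  have h0 := h.shift 0
  have h1 := h.shift 1
  fin_cases j
  · rfl
  · exact h0
  · exact Eq.trans h0 h1

theorem Mat.uval_eq' {Y : Tri k V} {S : Tri k V'} {g : V' →ₗ[k] Y.TV} {i : S.Zt} {M : Fin 3 → Y.Zt}
    (h : Mat Y g i M) (j : Fin 3) : uval M = (M (j+2)).1 (j+1) - (M j).1 j := by
  rw [h.uval_eq j, h.shift]

/-- third form -/
theorem Mat.uval_eq'' {Y : Tri k V} {S : Tri k V'} {g : V' →ₗ[k] Y.TV} {i : S.Zt} {M : Fin 3 → Y.Zt}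
    (h : Mat Y g i M) (j : Fin 3) : uval M = (M j).1 (j+2) - (M (j+1)).1 (j+1) := by
  rw [h.uval_eq' j]
  have c := h.col (j+1)
  rw [j11, j12] at c
  have r := (M j).2.2 j
  have : (M (j+2)).1 (j+1) - (M j).1 j - ((M j).1 (j+2) - (M (j+1)).1 (j+1)) =
    ((M (j+1)).1 (j+1) + (M (j+2)).1 (j+1) + (M j).1 (j+1)) -
      ((M j).1 j + (M j).1 (j+1) + (M j).1 (j+2)) := by abel
  rw [← sub_eq_zero, this, c, r, sub_zero]

/-- zero row: structure -/
theorem row_zero {Y : Tri k V} (hY : Y.Adm) (j : Fin 3) (M : Y.Zt) (hd : M.1 j ∈ Y.F 1 j)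
    (h0 : Y.cls M = 0) : M.1 j ∈ Y.F 0 j ∧ M.1 (j+2) ∈ Y.F 0 (j+1) := by
  obtain ⟨a, ha, hb⟩ := (cls_eq_zero Y _).1 h0
  have e1 := hb j
  have haz : a (j+2) = 0 := hY.zero (ha (j+2)) (by
    rw [j21]
    have : a (j+2) = M.1 j + a j := by rw [e1]; abel
    rw [this]; exact add_mem hd (Y.h01 _ (ha _)))
  constructor
  · rw [e1, haz, zero_sub]; exact neg_mem (ha j)
  · rw [hb (j+2), haz, sub_zero, j22]; exact ha _

theorem Mat.zero {Y : Tri k V} (hY : Y.Adm) {S : Tri k V'} {g : V' →ₗ[k] Y.TV} {M : Fin 3 → Y.Zt}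
    (h : Mat Y g (0 : S.Zt) M) : uval M = 0 := by
  have hz : ∀ j, Y.cls (M j) = 0 := fun j => by rw [h.rep j]; simp
  have hr := fun j => row_zero hY j (M j) (h.diag j) (hz j)
  -- column 0 : splits
  have e1 := h.uval_eq'' 0
  have e2 := h.uval_eq' 0
  have e3 := h.uval_eq 0
  -- uval ∈ F 0 1 by third form at 0
  have m1 : uval M ∈ Y.F 0 1 := by rw [h.uval_eq'' 0]; exact sub_mem (hr 0).2 (hr 1).1
  have m2 : uval M ∈ Y.F 0 2 := by rw [h.uval_eq'' 1]; exact sub_mem (hr 1).2 (hr 2).1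
  exact hY.zero m1 (Y.h01 _ m2)

theorem Mat.unique {Y : Tri k V} (hY : Y.Adm) {S : Tri k V'} {g : V' →ₗ[k] Y.TV} {i : S.Zt}
    {M M' : Fin 3 → Y.Zt} (h : Mat Y g i M) (h' : Mat Y g i M') : uval M = uval M' := by
  have := h.sub h'
  rw [sub_self] at this
  have := this.zero hY
  unfold uval at *
  simp only [Submodule.coe_sub, Pi.sub_apply] at this
  rw [← sub_eq_zero, ← this]; abel

end Tri
end St6

set_option linter.unusedSectionVars false
set_option linter.unusedVariables false
namespace St6
open Module Submodule

theorem lin_lift {k A B C : Type u} [Field k] [AddCommGroup A] [Module k A] [AddCommGroup B] [Module k B]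
    [AddCommGroup C] [Module k C] (f : A →ₗ[k] B) (P : Submodule k A) (q : C →ₗ[k] B)
    (h : ∀ c, q c ∈ P.map f) : ∃ σ : C →ₗ[k] A, ∀ c, σ c ∈ P ∧ f (σ c) = q c := by
  let f' : P →ₗ[k] P.map f := (f.domRestrict P).codRestrict (P.map f) (fun x => ⟨x, x.2, rfl⟩)
  have hs : LinearMap.range f' = ⊤ := by
    rw [LinearMap.range_eq_top]
    rintro ⟨_, x, hx, rfl⟩
    exact ⟨⟨x, hx⟩, rfl⟩
  obtain ⟨r, hr⟩ := LinearMap.exists_rightInverse_of_surjective f' hs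
  refine ⟨P.subtype ∘ₗ r ∘ₗ q.codRestrict (P.map f) h, fun c => ⟨(r _).2, ?_⟩⟩
  have := congrArg Subtype.val (LinearMap.congr_fun hr (q.codRestrict (P.map f) h c))
  exact this

variable {k : Type u} [Field k] {V : Type u} [AddCommGroup V] [Module k V] [FiniteDimensional k V]
  {V' : Type u} [AddCommGroup V'] [Module k V'] [FiniteDimensional k V']
  {V'' : Type u} [AddCommGroup V''] [Module k V''] [FiniteDimensional k V'']

namespace Tri

def bdL (D : Tri k V) (j : Fin 3) : D.F 0 j →ₗ[k] D.Zt where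
  toFun a := D.bd j a.1 a.2
  map_add' a b := by
    apply Zt_ext j <;> simp only [Submodule.coe_add, Pi.add_apply, bd_0, bd_1, bd_2] <;> abel
  map_smul' c a := by
    apply Zt_ext j <;> simp [bd_0, bd_1, bd_2]

theorem exists_matL {Y : Tri k V} {S : Tri k V'} {g : V' →ₗ[k] Y.TV} (hg : Fil S Y.tau g) :
    ∃ M : Fin 3 → (S.Zt →ₗ[k] Y.Zt), ∀ i, Mat Y g i (fun j => M j i) := by
  have h1 : ∀ j, ∃ σ : S.F 2 j →ₗ[k] Y.Zt, ∀ c, σ c ∈ Y.Gt 2 j ∧ Y.cls (σ c) = g c := fun j => by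
    obtain ⟨σ, hσ⟩ := lin_lift Y.cls (Y.Gt 2 j) (g ∘ₗ (S.F 2 j).subtype) (fun c => hg 2 j c c.2)
    exact ⟨σ, hσ⟩
  choose σ hσ using h1
  let R : Fin 3 → (S.Zt →ₗ[k] Y.Zt) := fun j =>
    σ j ∘ₗ (S.co j).codRestrict (S.F 2 j) (fun x => x.2.1 j)
  have hR1 : ∀ j i, (R j i).1 j ∈ Y.F 1 j := fun j i => (hσ j _).1
  have hR2 : ∀ j i, Y.cls (R j i) = g (i.1 j) := fun j i => (hσ j _).2
  let β : (∀ j : Fin 3, Y.F 0 j) →ₗ[k] Y.Zt := ∑ j, Y.bdL j ∘ₗ LinearMap.proj j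
  have hβ : ∀ a j, (β a).1 j = a (j+2) - a j := by
    intro a j
    have e : β a = Y.bd j (a j) (a j).2 + Y.bd (j+1) (a (j+1)) (a (j+1)).2 +
        Y.bd (j+2) (a (j+2)) (a (j+2)).2 := by
      simp only [β, Fin.sum_univ_three]
      change Y.bd 0 (a 0) (a 0).2 + Y.bd 1 (a 1) (a 1).2 + Y.bd 2 (a 2) (a 2).2 = _
      fin_cases j
      · rfl
      · change _ = Y.bd 1 (a 1) (a 1).2 + Y.bd 2 (a 2) (a 2).2 + Y.bd 0 (a 0) (a 0).2; abel
      · change _ = Y.bd 2 (a 2) (a 2).2 + Y.bd 0 (a 0) (a 0).2 + Y.bd 1 (a 1) (a 1).2; abel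
    rw [e]
    simp only [Submodule.coe_add, Pi.add_apply, bd_0]
    have b1 := bd_2 Y (j+1) (a (j+1)) (a (j+1)).2
    rw [j12] at b1
    have b2 := bd_1 Y (j+2) (a (j+2)) (a (j+2)).2
    rw [j21] at b2
    rw [b1, b2]; abel
  obtain ⟨a, ha⟩ := lin_lift β ⊤ (R 0 + R 1 + R 2) (by
    intro i
    have : Y.cls ((R 0 + R 1 + R 2) i) = 0 := by
      simp only [LinearMap.add_apply, map_add, hR2]
      rw [← map_add, ← map_add]
      have := i.2.2 0
      rw [show (i.1 0 + i.1 1 + i.1 2) = 0 from this, map_zero]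
    obtain ⟨a, ha, hb⟩ := (cls_eq_zero Y _).1 this
    refine ⟨fun j => ⟨a j, ha j⟩, trivial, ?_⟩
    apply Subtype.ext; funext j
    rw [hβ, hb])
  refine ⟨fun j => R j - Y.bdL j ∘ₗ LinearMap.proj j ∘ₗ a, fun i => ⟨fun l => ?_, fun j => ?_, fun j => ?_⟩⟩
  · have e := congrArg (fun z : Y.Zt => z.1 l) (ha i).2
    simp only [hβ] at e
    have e' : ((R 0 + R 1 + R 2) i).1 l = (R l i).1 l + (R (l+1) i).1 l + (R (l+2) i).1 l := by
      simp only [LinearMap.add_apply, Submodule.coe_add, Pi.add_apply]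
      fin_cases l
      · rfl
      · change (R 0 i).1 1 + (R 1 i).1 1 + (R 2 i).1 1 = (R 1 i).1 1 + (R 2 i).1 1 + (R 0 i).1 1; abel
      · change (R 0 i).1 2 + (R 1 i).1 2 + (R 2 i).1 2 = (R 2 i).1 2 + (R 0 i).1 2 + (R 1 i).1 2; abel
    rw [e'] at e
    have b0 := bd_0 Y l (a i l) (a i l).2
    have b1 := bd_2 Y (l+1) (a i (l+1)) (a i (l+1)).2
    rw [j12] at b1
    have b2 := bd_1 Y (l+2) (a i (l+2)) (a i (l+2)).2
    rw [j21] at b2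
    change ((R l i).1 l - (Y.bd l (a i l) (a i l).2).1 l) +
      ((R (l+1) i).1 l - (Y.bd (l+1) (a i (l+1)) (a i (l+1)).2).1 l) +
      ((R (l+2) i).1 l - (Y.bd (l+2) (a i (l+2)) (a i (l+2)).2).1 l) = 0
    rw [b0, b1, b2]; refine Eq.trans ?_ (sub_eq_zero.2 e.symm); abel
  · change (R j i).1 j - (Y.bd j (a i j) (a i j).2).1 j ∈ Y.F 1 j
    rw [bd_0]
    exact sub_mem (hR1 j i) (neg_mem (Y.h01 _ (a i j).2))
  · change Y.cls (R j i - Y.bd j (a i j) (a i j).2) = _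
    rw [map_sub, cls_bd, sub_zero, hR2]

theorem mat_of_B {Y : Tri k V} {S : Tri k V'} {g : V' →ₗ[k] Y.TV} (hg : Fil S Y.tau g)
    {i : S.Zt} (hi : S.cls i = 0) : ∃ M, Mat Y g i M ∧ uval M = 0 := by
  obtain ⟨a, ha, hb⟩ := (cls_eq_zero S _).1 hi
  have : ∀ j, ∃ w ∈ Y.Gt 0 j, Y.cls w = g (a j) := fun j => hg 0 j _ (ha j)
  choose w hw hw' using this
  refine ⟨fun j => w (j+2) - w j, ⟨fun l => ?_, fun j => ?_, fun j => ?_⟩, ?_⟩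
  · simp only [Submodule.coe_sub, Pi.sub_apply, j12, j22]; abel
  · have h1 := ((mem_Gt0 Y (j+2) _).1 (hw (j+2))).2
    rw [j21] at h1
    have h2 := ((mem_Gt0 Y j _).1 (hw j)).1
    simp only [Submodule.coe_sub, Pi.sub_apply, h2, sub_zero]; exact h1
  · rw [map_sub, hw', hw', hb, map_sub]
  · have r := (w 1).2.2 0
    have h0 := ((mem_Gt0 Y 0 _).1 (hw 0)).1
    have h1 := ((mem_Gt0 Y 1 _).1 (hw 1)).1
    have h2 := ((mem_Gt0 Y 2 _).1 (hw 2)).1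
    change ((w 0).1 0 - (w 1).1 0) - ((w 1).1 2 - (w 2).1 2) = 0
    rw [h0, h2]
    have r' : (w 1).1 0 + (w 1).1 1 + (w 1).1 2 = 0 := r
    rw [h1] at r'
    refine Eq.trans ?_ (neg_eq_zero.2 r'); abel

theorem exists_u {Y : Tri k V} (hY : Y.Adm) {S : Tri k V'} {g : V' →ₗ[k] Y.TV} (hg : Fil S Y.tau g) :
    ∃ u : S.TV →ₗ[k] V, ∀ i M, Mat Y g i M → u (S.cls i) = uval M := by
  obtain ⟨M, hM⟩ := exists_matL hg
  let u0 : S.Zt →ₗ[k] V := Y.co 0 ∘ₗ M 1 - Y.co 2 ∘ₗ M 2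
  have hu0 : ∀ i, u0 i = uval (fun j => M j i) := fun i => rfl
  refine ⟨S.Bt.liftQ u0 ?_, fun i M' h' => ?_⟩
  · intro i hi
    have hi' : S.cls i = 0 := (Submodule.Quotient.mk_eq_zero _).2 hi
    obtain ⟨M', h', h0⟩ := mat_of_B hg hi'
    rw [LinearMap.mem_ker, hu0, Mat.unique hY (hM i) h', h0]
  · rw [Submodule.mkQ_apply, Submodule.liftQ_apply, hu0]
    exact Mat.unique hY (hM i) h'

theorem exists_mat {Y : Tri k V} {S : Tri k V'} {g : V' →ₗ[k] Y.TV} (hg : Fil S Y.tau g) (i : S.Zt) :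
    ∃ M, Mat Y g i M := by
  obtain ⟨M, hM⟩ := exists_matL hg
  exact ⟨_, hM i⟩

/-- the specification of `u` -/
def IsU (Y : Tri k V) (S : Tri k V') (g : V' →ₗ[k] Y.TV) (u : S.TV →ₗ[k] V) : Prop :=
  ∀ i M, Mat Y g i M → u (S.cls i) = uval M

theorem diag_mem {Y : Tri k V} (hY : Y.Adm) (j : Fin 3) (M : Y.Zt) (hd : M.1 j ∈ Y.F 1 j)
    (h0 : Y.cls M ∈ Y.tau.F 1 j) : M.1 j ∈ Y.F 0 j := by
  obtain ⟨w, hw, hwM⟩ := h0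
  have hw := (mem_Gt1 Y j w).1 hw
  have := row_zero hY j (M - w) (by
    simp only [Submodule.coe_sub, Pi.sub_apply, hw, sub_zero]; exact hd) (by
    rw [map_sub, hwM, sub_self])
  have := this.1
  simpa only [Submodule.coe_sub, Pi.sub_apply, hw, sub_zero] using this

theorem IsU.fil {Y : Tri k V} (hY : Y.Adm) {S : Tri k V'} {g : V' →ₗ[k] Y.TV} (hg : Fil S Y.tau g)
    {u : S.TV →ₗ[k] V} (hu : IsU Y S g u) : Fil S.tau Y.rot u := by
  rintro s j _ ⟨i, hi, rfl⟩
  obtain ⟨M, hM⟩ := exists_mat hg i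
  rw [hu i M hM]
  change uval M ∈ Y.F s (j+1)
  revert hi
  fin_cases s
  · intro hi
    obtain ⟨hi0, hi1⟩ := (mem_Gt0 S j i).1 hi
    rw [hM.uval_eq'' j]
    have r := row_zero hY j (M j) (hM.diag j) (by rw [hM.rep, hi0, map_zero])
    refine sub_mem r.2 (diag_mem hY _ _ (hM.diag _) ?_)
    rw [hM.rep]; exact hg 1 _ _ hi1
  · intro hi
    have hi0 := (mem_Gt1 S j i).1 hi
    rw [hM.uval_eq'' j]
    have r := row_zero hY j (M j) (hM.diag j) (by rw [hM.rep, hi0, map_zero])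
    exact sub_mem (Y.h01 _ r.2) (hM.diag _)
  · intro hi
    have hi0 := (mem_Gt2 S j i).1 hi
    rw [hM.uval_eq' j]
    refine sub_mem ((M (j+2)).2.1 _) (Y.h02 _ (diag_mem hY _ _ (hM.diag _) ?_))
    rw [hM.rep]; exact hg 1 _ _ hi0

theorem IsU.range_le {Y : Tri k V} {S : Tri k V'} {g : V' →ₗ[k] Y.TV} (hg : Fil S Y.tau g)
    {u : S.TV →ₗ[k] V} (hu : IsU Y S g u) (j : Fin 3) :
    LinearMap.range u ≤ Y.F 2 j ⊔ Y.F 1 (j+2) := by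
  rintro _ ⟨y, rfl⟩
  obtain ⟨i, rfl⟩ := S.Bt.mkQ_surjective y
  obtain ⟨M, hM⟩ := exists_mat hg i
  rw [hu i M hM, hM.uval_eq j, sub_eq_add_neg]
  exact Submodule.add_mem_sup ((M (j+1)).2.1 j) (neg_mem (hM.diag _))

theorem IsU.zero {Y : Tri k V} {S : Tri k V'} {g : V' →ₗ[k] Y.TV} (hg : Fil S Y.tau g)
    {u : S.TV →ₗ[k] V} (hu : IsU Y S g u) {i : S.Zt} (hi : u (S.cls i) = 0) :
    ∃ α : Fin 3 → Y.TV, (∀ r, α r ∈ Y.tau.F 0 r) ∧ ∀ r, g (i.1 r) = α (r+2) - α r := by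
  obtain ⟨M, hM⟩ := exists_mat hg i
  rw [hu i M hM] at hi
  have e : ∀ r, (M r).1 (r+2) = (M (r+1)).1 (r+1) := fun r => by
    have := hM.uval_eq'' r
    rw [hi] at this
    exact sub_eq_zero.1 this.symm
  have m1 : ∀ r, (M (r+1)).1 (r+1) ∈ Y.F 2 (r+1) := fun r => (M (r+1)).2.1 _
  have m2 : ∀ r, (M (r+1)).1 (r+1) ∈ Y.F 2 (r+2) := fun r => by rw [← e]; exact (M r).2.1 _
  refine ⟨fun r => Y.cls (Y.mkZ r ((M (r+1)).1 (r+1)) (m1 r) (m2 r)), fun r => ⟨_, ?_, rfl⟩, fun r => ?_⟩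
  · rw [SetLike.mem_coe, mem_Gt0, mkZ_0, mkZ_1]
    exact ⟨rfl, hM.diag _⟩
  · rw [← hM.rep, ← map_sub]
    congr 1
    apply Zt_ext r
    · have := mkZ_1 Y (r+2) _ (m1 (r+2)) (m2 (r+2))
      simp only [j21] at this
      simp only [Submodule.coe_sub, Pi.sub_apply, mkZ_0, j21, this, sub_zero]
    · have := mkZ_2 Y (r+2) _ (m1 (r+2)) (m2 (r+2))
      simp only [j21, j22] at this
      have r' := (M r).2.2 r
      rw [e] at r'
      simp only [Submodule.coe_sub, Pi.sub_apply, mkZ_1, j21, this]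
      rw [← sub_eq_zero, ← r']; abel
    · have := mkZ_0 Y (r+2) _ (m1 (r+2)) (m2 (r+2))
      simp only [j21] at this
      simp only [Submodule.coe_sub, Pi.sub_apply, mkZ_2, j21, this, e]
      abel

theorem IsU.inj {Y : Tri k V} {S : Tri k V'} {g : V' →ₗ[k] Y.TV} (hg : Fil S Y.tau g)
    {u : S.TV →ₗ[k] V} (hu : IsU Y S g u) (hinj : Function.Injective g)
    (hc : ∀ α : Fin 3 → Y.TV, (∀ r, α r ∈ Y.tau.F 0 r) →
      (∀ r, α (r+2) - α r ∈ LinearMap.range g) → ∀ r, ∃ s ∈ S.F 0 r, g s = α r) :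
    Function.Injective u := by
  rw [injective_iff_map_eq_zero]
  intro y hy
  obtain ⟨i, rfl⟩ := S.Bt.mkQ_surjective y
  obtain ⟨α, hα, hα'⟩ := hu.zero hg hy
  have h := hc α hα (fun r => ⟨_, hα' r⟩)
  choose s hs hs' using h
  refine (cls_eq_zero S i).2 ⟨s, hs, fun r => hinj ?_⟩
  rw [map_sub, hs', hs', hα']

theorem sub_cond {D : Tri k V} {I : Submodule k V}
    (h : ∀ x, (∀ j, x ∈ (D.quot I).F 0 j) → x = 0) (α : Fin 3 → V) (hα : ∀ r, α r ∈ D.F 0 r)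
    (hα' : ∀ r, α (r+2) - α r ∈ I) (r : Fin 3) : α r ∈ I := by
  have e : ∀ r, I.mkQ (α (r+2)) = I.mkQ (α r) := fun r => by
    rw [← sub_eq_zero, ← map_sub]; exact (Submodule.Quotient.mk_eq_zero _).2 (hα' r)
  have e' : ∀ l, I.mkQ (α l) = I.mkQ (α r) := by
    intro l
    rcases jall r l with rfl | rfl | rfl
    · rfl
    · have := e (r+1); rw [j12] at this; exact this.symm
    · exact e r
  have := h (I.mkQ (α r)) (fun j => by rw [← e' j]; exact ⟨_, hα j, rfl⟩)
  exact (Submodule.Quotient.mk_eq_zero _).1 this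

theorem inter_zero {D : Tri k V} {la mu : ℤ} (hla : 1 ≤ la) (hmu : 0 ≤ mu)
    (h : ∀ W : Submodule k V, D.L la mu W ≤ 0) (x : V) (hx : ∀ j, x ∈ D.F 0 j) : x = 0 := by
  by_contra hne
  have := h (k ∙ x)
  rw [L_expand] at this
  simp only [fun j => d_inf_span_ge _ (hx j) hne, fun j => d_inf_span_ge _ (D.h01 _ (hx j)) hne,
    fun j => d_inf_span_ge _ (D.h12 _ (D.h01 _ (hx j))) hne, d_span_singleton hne, Fin.sum_univ_three] at this
  linarith

theorem fil_subtype (D : Tri k V) (W : Submodule k V) : Fil (D.sub W) D W.subtype := fun s j x hx => hx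

theorem fil_mkQ (D : Tri k V) (W : Submodule k V) : Fil D (D.quot W) W.mkQ := fun s j x hx => ⟨x, hx, rfl⟩

theorem T2 {Y : Tri k V} {la mu : ℤ} (hla : 1 ≤ la) (hmu : 0 ≤ mu) (hlow : Y.LowC la mu)
    (I : Submodule k Y.TV) : Y.tau.L la mu I ≤ 0 := by
  have hY := hlow.adm hla hmu
  obtain ⟨I0, -, hmax, hmax'⟩ := LL_max (fun p : Fin 3 × Fin 3 => Y.tau.F p.1 p.2)
    (fun p => cw la mu p.1) (fun _ => cw_nonneg hla hmu _) (3 * (la + mu)) (fun _ => True) ⟨⊥, trivial⟩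
  have hmax : ∀ W, Y.tau.L la mu W ≤ Y.tau.L la mu I0 := fun W => hmax W trivial
  refine (hmax I).trans ?_
  by_contra hcon
  push Not at hcon
  have hq : ∀ B : Submodule k (Y.TV ⧸ I0), (Y.tau.quot I0).L la mu B ≤ 0 := fun B => by
    rw [L_quot]; have := hmax (B.comap I0.mkQ); linarith
  have hg := fil_subtype Y.tau I0
  obtain ⟨u, hu⟩ := exists_u hY hg
  have hu : IsU Y _ _ u := hu
  have hinj := hu.inj hg Subtype.val_injective (by
    intro α hα hα' r
    have := sub_cond (D := Y.tau) (I := I0) (inter_zero hla hmu hq) α hα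
      (fun r => by obtain ⟨s, hs⟩ := hα' r; rw [← hs]; exact s.2) r
    exact ⟨⟨α r, this⟩, hα r, rfl⟩)
  have h1 := L_image hla hmu (hu.fil hY hg) ⊤
  rw [LinearMap.ker_eq_bot.2 hinj, inf_bot_eq, L_bot, L_rot, Submodule.map_top] at h1
  have h2 := hlow _ (hu.range_le hg)
  have h3 := T1 ((hY.tau).sub I0) hla hmu
  rw [L_sub, Submodule.map_top, Submodule.range_subtype] at h3
  linarith

end Tri
end St6

set_option linter.unusedSectionVars false
set_option linter.unusedVariables false
namespace St6
open Module Submodule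

section sec
variable {k : Type u} [Field k] {E Y : Type u} [AddCommGroup E] [Module k E]
  [AddCommGroup Y] [Module k Y]

theorem sec_step (π : E →ₗ[k] Y) (P Q : Submodule k Y) (A : Submodule k E)
    (hA : ∀ q ∈ Q, ∃ a ∈ A, π a = q) (s : Y →ₗ[k] E) (hs : ∀ p ∈ P, π (s p) = p)
    (hPQ : ∀ y ∈ P, y ∈ Q → s y ∈ A) :
    ∃ s' : Y →ₗ[k] E, (∀ p ∈ P, s' p = s p) ∧ (∀ q ∈ Q, s' q ∈ A) ∧ ∀ y ∈ P ⊔ Q, π (s' y) = y := by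
  obtain ⟨C, hC⟩ := Submodule.exists_isCompl (P ⊓ Q)
  have hQ : ∀ q ∈ Q, ∃ a b, a ∈ P ⊓ Q ∧ b ∈ C ⊓ Q ∧ a + b = q := by
    intro q hq
    have : q ∈ (P ⊓ Q) ⊔ C := by rw [hC.sup_eq_top]; trivial
    obtain ⟨a, ha, b, hb, rfl⟩ := Submodule.mem_sup.1 this
    refine ⟨a, b, ha, ⟨hb, ?_⟩, rfl⟩
    have := sub_mem hq ha.2
    simpa using this
  have hdis : Disjoint (C ⊓ Q) P := by
    rw [disjoint_iff, eq_bot_iff]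
    rintro x ⟨⟨h1, h2⟩, h3⟩
    rw [← hC.inf_eq_bot]; exact ⟨⟨h3, h2⟩, h1⟩
  obtain ⟨R, hR, hRP⟩ := hdis.exists_isCompl
  obtain ⟨ℓ, hℓ⟩ := lin_lift π A (C ⊓ Q).subtype (fun c => by
    obtain ⟨a, ha, e⟩ := hA c c.2.2; exact ⟨a, ha, e⟩)
  obtain ⟨ℓ', hℓ'⟩ := LinearMap.exists_extend ℓ
  have hℓ'' : ∀ c ∈ C ⊓ Q, ℓ' c ∈ A ∧ π (ℓ' c) = c := by
    intro c hc
    have := LinearMap.congr_fun hℓ' ⟨c, hc⟩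
    simp only [LinearMap.comp_apply, Submodule.subtype_apply] at this
    rw [this]; exact hℓ ⟨c, hc⟩
  let s' := LinearMap.ofIsCompl hRP (ℓ'.domRestrict R) (s.domRestrict P)
  have h1 : ∀ p ∈ P, s' p = s p := fun p hp =>
    LinearMap.ofIsCompl_apply_right hRP (φ := ℓ'.domRestrict R) (ψ := s.domRestrict P) ⟨p, hp⟩
  have h2 : ∀ c ∈ C ⊓ Q, s' c = ℓ' c := fun c hc =>
    LinearMap.ofIsCompl_apply_left hRP (φ := ℓ'.domRestrict R) (ψ := s.domRestrict P) ⟨c, hR hc⟩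
  have h3 : ∀ q ∈ Q, s' q ∈ A ∧ π (s' q) = q := by
    intro q hq
    obtain ⟨a, b, ha, hb, rfl⟩ := hQ q hq
    rw [map_add, h1 a ha.1, h2 b hb, map_add, hs a ha.1, (hℓ'' b hb).2]
    exact ⟨add_mem (hPQ a ha.1 ha.2) (hℓ'' b hb).1, rfl⟩
  refine ⟨s', h1, fun q hq => (h3 q hq).1, fun y hy => ?_⟩
  obtain ⟨p, hp, q, hq, rfl⟩ := Submodule.mem_sup.1 hy
  rw [map_add, map_add, (h3 q hq).2, h1 p hp, hs p hp]

/-- iterated version relative to a subspace `H`. -/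
theorem sec_step' (π : E →ₗ[k] Y) (H Q' Q : Submodule k Y) (A' A : Submodule k E) (hQ : Q' ≤ Q)
    (hAA : A' ≤ A) (hA : ∀ q ∈ Q, ∃ a ∈ A, π a = q) (s : Y →ₗ[k] E)
    (hs : ∀ y ∈ H ⊔ Q', π (s y) = y) (hs' : ∀ y ∈ Q', s y ∈ A') (hH : ∀ y ∈ H, y ∈ Q → s y ∈ A) :
    ∃ s' : Y →ₗ[k] E, (∀ p ∈ H ⊔ Q', s' p = s p) ∧ (∀ q ∈ Q, s' q ∈ A) ∧
      ∀ y ∈ H ⊔ Q, π (s' y) = y := by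
  obtain ⟨s', h1, h2, h3⟩ := sec_step π (H ⊔ Q') Q A hA s hs (by
    intro y hy hyQ
    obtain ⟨h, hh, q, hq, rfl⟩ := Submodule.mem_sup.1 hy
    rw [map_add]
    refine add_mem (hH h hh ?_) (hAA (hs' q hq))
    have := sub_mem hyQ (hQ hq); simpa using this)
  refine ⟨s', h1, h2, fun y hy => h3 y ?_⟩
  exact (sup_le_sup_right (le_sup_left : H ≤ H ⊔ Q') Q) hy

theorem dual_hom [FiniteDimensional k E] [FiniteDimensional k Y] (ℓ : (Y →ₗ[k] E) →ₗ[k] k) :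
    ∃ ψ : E →ₗ[k] Y, ∀ h : Y →ₗ[k] E, ℓ h = LinearMap.trace k E (h ∘ₗ ψ) := by
  let Θ : (E →ₗ[k] Y) →ₗ[k] Module.Dual k (Y →ₗ[k] E) :=
    LinearMap.mk₂ k (fun ψ h => LinearMap.trace k E (h ∘ₗ ψ))
      (fun a b c => by rw [LinearMap.comp_add, map_add])
      (fun a b c => by rw [LinearMap.comp_smul, map_smul])
      (fun a b c => by rw [LinearMap.add_comp, map_add])
      (fun a b c => by rw [LinearMap.smul_comp, map_smul])
  have hΘ : ∀ ψ h, Θ ψ h = LinearMap.trace k E (h ∘ₗ ψ) := fun _ _ => rfl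
  have hinj : Function.Injective Θ := by
    rw [injective_iff_map_eq_zero]
    intro ψ hψ
    ext x
    rw [LinearMap.zero_apply, ← Module.forall_dual_apply_eq_zero_iff k]
    intro φ
    have := LinearMap.congr_fun hψ (φ.smulRight x)
    rw [hΘ, show (φ.smulRight x) ∘ₗ ψ = (φ ∘ₗ ψ).smulRight x from rfl,
      LinearMap.trace_smulRight] at this
    exact this
  have hsurj := (LinearMap.injective_iff_surjective_of_finrank_eq_finrank (f := Θ) (by
    rw [Subspace.dual_finrank_eq, Module.finrank_linearMap, Module.finrank_linearMap, mul_comm])).1 hinj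
  obtain ⟨ψ, hψ⟩ := hsurj ℓ
  exact ⟨ψ, fun h => by rw [← hψ, hΘ]⟩

end sec

variable {k : Type u} [Field k] {V : Type u} [AddCommGroup V] [Module k V] [FiniteDimensional k V]
  {V' : Type u} [AddCommGroup V'] [Module k V'] [FiniteDimensional k V']

namespace Tri

def Zmap {D : Tri k V} {D' : Tri k V'} {g : V →ₗ[k] V'} (hg : Fil D D' g) : D.Zt →ₗ[k] D'.Zt :=
  LinearMap.codRestrict D'.Zt ((LinearMap.pi fun j => g ∘ₗ LinearMap.proj j) ∘ₗ D.Zt.subtype) (by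
    rintro ⟨x, hx⟩
    refine ⟨fun j => hg _ _ _ (hx.1 j), fun j => ?_⟩
    change g (x j) + g (x (j+1)) + g (x (j+2)) = 0
    rw [← map_add, ← map_add, hx.2 j, map_zero])

@[simp] theorem Zmap_apply {D : Tri k V} {D' : Tri k V'} {g : V →ₗ[k] V'} (hg : Fil D D' g) (x : D.Zt) (j) :
    (Zmap hg x).1 j = g (x.1 j) := rfl

def tmap {D : Tri k V} {D' : Tri k V'} {g : V →ₗ[k] V'} (hg : Fil D D' g) : D.TV →ₗ[k] D'.TV :=
  D.Bt.mapQ D'.Bt (Zmap hg) (by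
    rintro x ⟨a, ha, hx⟩
    exact ⟨fun j => g (a j), fun j => hg _ _ _ (ha j), fun j => by rw [Zmap_apply, hx, map_sub]⟩)

theorem tmap_cls {D : Tri k V} {D' : Tri k V'} {g : V →ₗ[k] V'} (hg : Fil D D' g) (x : D.Zt) :
    tmap hg (D.cls x) = D'.cls (Zmap hg x) := rfl

theorem tmap_fil {D : Tri k V} {D' : Tri k V'} {g : V →ₗ[k] V'} (hg : Fil D D' g) :
    Fil D.tau D'.tau (tmap hg) := by
  rintro s j _ ⟨x, hx, rfl⟩
  refine ⟨Zmap hg x, ?_, rfl⟩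
  revert hx
  fin_cases s
  · rintro ⟨h1, h2⟩
    have h1 : x.1 j = 0 := h1
    exact ⟨by change g (x.1 j) = 0; rw [h1, map_zero], hg _ _ _ h2⟩
  · intro h1
    have h1 : x.1 j = 0 := h1
    change g (x.1 j) = 0; rw [h1, map_zero]
  · intro h; exact hg _ _ _ h

theorem exists_sections (D : Tri k V) (X E2 H : Submodule k V) (hE : E2 ⊔ X = ⊤)
    (hcomp : ∀ s j, D.F s j ≤ (D.F s j ⊓ E2) ⊔ (D.F s j ⊓ X)) (hHE : H ≤ E2) (hHX : H ⊓ X = ⊥)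
    (hstr : ∀ s j, ∀ y ∈ H, X.mkQ y ∈ (D.quot X).F s j → y ∈ D.F s j) (j : Fin 3) :
    ∃ s : (V ⧸ X) →ₗ[k] V, (∀ y, X.mkQ (s y) = y) ∧ (∀ y, s y ∈ E2) ∧
      (∀ h ∈ H, s (X.mkQ h) = h) ∧ ∀ i, ∀ y ∈ (D.quot X).F i j, s y ∈ D.F i j := by
  have hH : ∀ a b, a ∈ H → b ∈ H → X.mkQ a = X.mkQ b → a = b := by
    intro a b ha hb e
    have : a - b ∈ H ⊓ X := ⟨sub_mem ha hb, (Submodule.Quotient.eq X).1 e⟩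
    rw [hHX] at this
    exact sub_eq_zero.1 ((Submodule.mem_bot k).1 this)
  obtain ⟨σ, hσ⟩ := lin_lift X.mkQ H (H.map X.mkQ).subtype (fun c => c.2)
  obtain ⟨s0, hs0⟩ := LinearMap.exists_extend σ
  have hs0H : ∀ h ∈ H, s0 (X.mkQ h) = h := by
    intro h hh
    have := LinearMap.congr_fun hs0 ⟨X.mkQ h, h, hh, rfl⟩
    have hc := hσ ⟨X.mkQ h, h, hh, rfl⟩
    rw [← this] at hc
    exact hH _ _ hc.1 hh hc.2
  set H' := H.map X.mkQ with hH'
  have hlift : ∀ i, ∀ q ∈ (D.quot X).F i j, ∃ a ∈ D.F i j ⊓ E2, X.mkQ a = q := by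
    rintro i _ ⟨x, hx, rfl⟩
    obtain ⟨a, ha, b, hb, rfl⟩ := Submodule.mem_sup.1 (hcomp i j hx)
    refine ⟨a, ha, ?_⟩
    rw [map_add]; rw [show X.mkQ b = 0 from (Submodule.Quotient.mk_eq_zero X).2 hb.2, add_zero]
  have hstr' : ∀ i, ∀ s : (V ⧸ X) →ₗ[k] V, (∀ h ∈ H, s (X.mkQ h) = h) → ∀ y ∈ H',
      y ∈ (D.quot X).F i j → s y ∈ D.F i j ⊓ E2 := by
    rintro i s hs _ ⟨h, hh, rfl⟩ hy
    rw [hs h hh]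
    exact ⟨hstr i j h hh hy, hHE hh⟩
  obtain ⟨s1, a1, b1, c1⟩ := sec_step' X.mkQ H' ⊥ ((D.quot X).F 0 j) ⊥ (D.F 0 j ⊓ E2) bot_le bot_le
    (hlift 0) s0 (by
      intro y hy
      rw [sup_bot_eq] at hy
      obtain ⟨h, hh, rfl⟩ := hy
      rw [hs0H h hh]) (by intro y hy; rw [Submodule.mem_bot] at hy ⊢; rw [hy, map_zero])
      (hstr' 0 s0 hs0H)
  have hs1H : ∀ h ∈ H, s1 (X.mkQ h) = h := fun h hh => by
    rw [a1 _ (Submodule.mem_sup_left ⟨h, hh, rfl⟩), hs0H h hh]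
  obtain ⟨s2, a2, b2, c2⟩ := sec_step' X.mkQ H' ((D.quot X).F 0 j) ((D.quot X).F 1 j) (D.F 0 j ⊓ E2)
    (D.F 1 j ⊓ E2) ((D.quot X).h01 j) (inf_le_inf_right _ (D.h01 j)) (hlift 1) s1 c1 b1 (hstr' 1 s1 hs1H)
  have hs2H : ∀ h ∈ H, s2 (X.mkQ h) = h := fun h hh => by
    rw [a2 _ (Submodule.mem_sup_left ⟨h, hh, rfl⟩), hs1H h hh]
  obtain ⟨s3, a3, b3, c3⟩ := sec_step' X.mkQ H' ((D.quot X).F 1 j) ((D.quot X).F 2 j) (D.F 1 j ⊓ E2)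
    (D.F 2 j ⊓ E2) ((D.quot X).h12 j) (inf_le_inf_right _ (D.h12 j)) (hlift 2) s2 c2 b2 (hstr' 2 s2 hs2H)
  have hs3H : ∀ h ∈ H, s3 (X.mkQ h) = h := fun h hh => by
    rw [a3 _ (Submodule.mem_sup_left ⟨h, hh, rfl⟩), hs2H h hh]
  obtain ⟨s4, a4, b4, c4⟩ := sec_step' X.mkQ H' ((D.quot X).F 2 j) ⊤ (D.F 2 j ⊓ E2)
    E2 le_top inf_le_right (by
      intro q _
      obtain ⟨x, rfl⟩ := X.mkQ_surjective q
      have : x ∈ E2 ⊔ X := by rw [hE]; trivial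
      obtain ⟨a, ha, b, hb, rfl⟩ := Submodule.mem_sup.1 this
      refine ⟨a, ha, ?_⟩
      rw [map_add]; rw [show X.mkQ b = 0 from (Submodule.Quotient.mk_eq_zero X).2 hb, add_zero])
    s3 c3 b3 (by rintro _ ⟨h, hh, rfl⟩ _; rw [hs3H h hh]; exact hHE hh)
  refine ⟨s4, fun y => c4 y (Submodule.mem_sup_right trivial), fun y => b4 y trivial, fun h hh => ?_, ?_⟩
  · rw [a4 _ (Submodule.mem_sup_left ⟨h, hh, rfl⟩), hs3H h hh]
  · intro i y hy
    have hy2 : y ∈ (D.quot X).F 2 j := by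
      fin_cases i
      · exact (D.quot X).h12 j ((D.quot X).h01 j hy)
      · exact (D.quot X).h12 j hy
      · exact hy
    rw [a4 _ (Submodule.mem_sup_right hy2)]
    fin_cases i
    · rw [a3 _ (Submodule.mem_sup_right ((D.quot X).h01 j hy)), a2 _ (Submodule.mem_sup_right hy)]
      exact (b1 y hy).1
    · rw [a3 _ (Submodule.mem_sup_right hy)]
      exact (b2 y hy).1
    · exact (b3 y hy).1

/-- strictly lowering families give filtered maps to `tau`. -/
theorem psi_map (X : Tri k V) (Y : Tri k V') (ψ : Fin 3 → (V →ₗ[k] V'))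
    (hsum : ∀ j x, ψ j x + ψ (j+1) x + ψ (j+2) x = 0) (h3 : ∀ j x, ψ j x ∈ Y.F 2 j)
    (h2 : ∀ j, ∀ x ∈ X.F 2 j, ψ j x ∈ Y.F 1 j) (h1 : ∀ j, ∀ x ∈ X.F 1 j, ψ j x ∈ Y.F 0 j)
    (h0 : ∀ j, ∀ x ∈ X.F 0 j, ψ j x = 0) :
    ∃ g : V →ₗ[k] Y.TV, Fil X Y.tau g ∧ ∀ x, ∃ z : Y.Zt, (∀ j, z.1 j = ψ j x) ∧ g x = Y.cls z := by
  let g0 : V →ₗ[k] Y.Zt := LinearMap.codRestrict Y.Zt (LinearMap.pi ψ)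
    (fun x => ⟨fun j => h3 j x, fun j => hsum j x⟩)
  have hg0 : ∀ x j, (g0 x).1 j = ψ j x := fun x j => rfl
  refine ⟨Y.cls ∘ₗ g0, ?_, fun x => ⟨g0 x, hg0 x, rfl⟩⟩
  intro s j x hx
  fin_cases s
  · exact ⟨g0 x, (mem_Gt0 Y j _).2 ⟨h0 j x hx, h2 (j+1) x (X.h02 j hx)⟩, rfl⟩
  · exact mem_tau1_of Y j _ (h1 j x hx)
  · exact ⟨g0 x, (mem_Gt2 Y j _).2 (h2 j x hx), rfl⟩

theorem trace_sq_zero (f : V →ₗ[k] V) (h : ∀ x, f (f x) = 0) : LinearMap.trace k V f = 0 := by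
  have : IsNilpotent f := ⟨2, by ext x; simp [pow_two, h]⟩
  exact (LinearMap.isNilpotent_trace_of_isNilpotent this).eq_zero

end Tri
end St6

set_option linter.unusedSectionVars false
set_option linter.unusedVariables false
namespace St6
open Module Submodule

variable {k : Type u} [Field k] {V : Type u} [AddCommGroup V] [Module k V] [FiniteDimensional k V]
  {V' : Type u} [AddCommGroup V'] [Module k V'] [FiniteDimensional k V']

theorem exists_proj {k W : Type u} [Field k] [AddCommGroup W] [Module k W] (P : Submodule k W) :
    ∃ e : W →ₗ[k] W, (∀ c, e c ∈ P) ∧ ∀ c ∈ P, e c = c := by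
  obtain ⟨r, hr⟩ := LinearMap.exists_extend (p := P) (LinearMap.id : P →ₗ[k] P)
  refine ⟨P.subtype ∘ₗ r, fun c => (r c).2, fun c hc => ?_⟩
  have := LinearMap.congr_fun hr ⟨c, hc⟩
  exact congrArg Subtype.val this

namespace Tri

theorem split_star (D : Tri k V) (X E2 H : Submodule k V) (hE : E2 ⊔ X = ⊤)
    (hcomp : ∀ s j, D.F s j ≤ (D.F s j ⊓ E2) ⊔ (D.F s j ⊓ X)) (hHE : H ≤ E2) (hHX : H ⊓ X = ⊥)
    (hstr : ∀ s j, ∀ y ∈ H, X.mkQ y ∈ (D.quot X).F s j → y ∈ D.F s j)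
    (hadm : ((D.quot X).quot (H.map X.mkQ)).Adm)
    (hg : ∀ g : X →ₗ[k] (D.quot X).TV, Fil (D.sub X) (D.quot X).tau g → ∀ x : X, x.1 ∈ E2 →
      tmap (fil_mkQ (D.quot X) (H.map X.mkQ)) (g x) = 0) :
    ∃ C, IsCompl X C ∧ ∀ s j, D.F s j ≤ (D.F s j ⊓ X) ⊔ (D.F s j ⊓ C) := by
  set Y := D.quot X with hY
  set H' := H.map X.mkQ with hH'
  set Q := Y.quot H' with hQ
  have hsec := exists_sections D X E2 H hE hcomp hHE hHX hstr
  choose s s1 s2 s3 s4 using hsec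
  have htX : ∀ j y, s j y - s 0 y ∈ X := fun j y => by
    rw [← Submodule.Quotient.mk_eq_zero X]
    change X.mkQ (s j y - s 0 y) = 0
    rw [map_sub, s1, s1, sub_self]
  let t : Fin 3 → ((V ⧸ X) →ₗ[k] X) := fun j => (s j - s 0).codRestrict X (htX j)
  have ht : ∀ j y, (t j y : V) = s j y - s 0 y := fun j y => rfl
  let N : Submodule k (Fin 3 → ((V ⧸ X) →ₗ[k] X)) :=
    { carrier := {n | ∃ h : (V ⧸ X) →ₗ[k] X, ∃ hj : Fin 3 → ((V ⧸ X) →ₗ[k] X),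
        (∀ j i, ∀ y ∈ Y.F i j, (hj j y : V) ∈ D.F i j) ∧ ∀ j, n j = h - hj j}
      add_mem' := by
        rintro n n' ⟨h, hj, a, b⟩ ⟨h', hj', a', b'⟩
        refine ⟨h + h', fun j => hj j + hj' j, fun j i y hy => ?_, fun j => ?_⟩
        · exact add_mem (a j i y hy) (a' j i y hy)
        · rw [Pi.add_apply, b, b']; exact sub_add_sub_comm _ _ _ _
      zero_mem' := ⟨0, 0, fun j i y hy => zero_mem _, fun j => by simp⟩
      smul_mem' := by
        rintro c n ⟨h, hj, a, b⟩
        refine ⟨c • h, fun j => c • hj j, fun j i y hy => ?_, fun j => ?_⟩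
        · exact Submodule.smul_mem _ _ (a j i y hy)
        · rw [Pi.smul_apply, b, smul_sub] }
  have key : t ∈ N := by
    by_contra htN
    obtain ⟨f, hf0, hf⟩ := Submodule.exists_le_ker_of_notMem htN
    have hdual := fun j => dual_hom (f ∘ₗ LinearMap.single k (fun _ : Fin 3 => ((V ⧸ X) →ₗ[k] X)) j)
    choose ψ hψ using hdual
    have hfs : ∀ n, f n = ∑ j, LinearMap.trace k X (n j ∘ₗ ψ j) := by
      intro n
      have : n = ∑ j, LinearMap.single k (fun _ : Fin 3 => ((V ⧸ X) →ₗ[k] X)) j (n j) := by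
        simp only [LinearMap.coe_single]; exact (Finset.univ_sum_single n).symm
      conv_lhs => rw [this]
      rw [map_sum]
      refine Finset.sum_congr rfl fun j _ => ?_
      rw [← hψ]; rfl
    have hsum0 : ∀ x, ψ 0 x + ψ 1 x + ψ 2 x = 0 := by
      intro x
      rw [← Module.forall_dual_apply_eq_zero_iff k]
      intro φ
      have h1 : (fun _ => φ.smulRight x : Fin 3 → ((V ⧸ X) →ₗ[k] X)) ∈ N :=
        ⟨φ.smulRight x, 0, fun j i y hy => zero_mem _, fun j => by simp⟩
      have h2 := hf h1
      rw [LinearMap.mem_ker, hfs, Fin.sum_univ_three] at h2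
      have e : ∀ j, (φ.smulRight x) ∘ₗ ψ j = (φ ∘ₗ ψ j).smulRight x := fun j => rfl
      simp only [e, LinearMap.trace_smulRight, LinearMap.comp_apply] at h2
      rw [map_add, map_add]; exact h2
    have hsum : ∀ j x, ψ j x + ψ (j+1) x + ψ (j+2) x = 0 := by
      intro j x
      rw [← hsum0 x]
      fin_cases j
      · rfl
      · change ψ 1 x + ψ 2 x + ψ 0 x = _; abel
      · change ψ 2 x + ψ 0 x + ψ 1 x = _; abel
    have hlow : ∀ j (P : Submodule k (V ⧸ X)) (x : X), (∀ i, (x : V) ∈ D.F i j ∨ Y.F i j ≤ P) →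
        ψ j x ∈ P := by
      intro j P x hx
      by_contra hcon
      obtain ⟨φ, hφ0, hφ⟩ := Submodule.exists_le_ker_of_notMem hcon
      have h1 : LinearMap.single k (fun _ : Fin 3 => ((V ⧸ X) →ₗ[k] X)) j (φ.smulRight x) ∈ N := by
        refine ⟨0, fun l => - LinearMap.single k (fun _ : Fin 3 => ((V ⧸ X) →ₗ[k] X)) j (φ.smulRight x) l,
          fun l i y hy => ?_, fun l => by simp⟩
        by_cases hl : l = j
        · subst hl
          simp only [LinearMap.coe_single, Pi.single_eq_same, LinearMap.neg_apply, Submodule.coe_neg,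
            LinearMap.smulRight_apply, Submodule.coe_smul]
          refine neg_mem ?_
          rcases hx i with h | h
          · exact Submodule.smul_mem _ _ h
          · have : φ y = 0 := hφ (h hy)
            rw [this, zero_smul]; exact zero_mem _
        · simp [hl]
      have h2 := hf h1
      rw [LinearMap.mem_ker] at h2
      have h3 := hψ j (φ.smulRight x)
      rw [LinearMap.comp_apply, h2] at h3
      have e : (φ.smulRight x) ∘ₗ ψ j = (φ ∘ₗ ψ j).smulRight x := rfl
      rw [e, LinearMap.trace_smulRight] at h3
      exact hφ0 h3.symm
    have l3 : ∀ j x, ψ j x ∈ Y.F 2 j := fun j x => hlow j _ x (fun i => Or.inr (by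
      fin_cases i
      · exact (Y.h01 j).trans (Y.h12 j)
      · exact Y.h12 j
      · exact le_rfl))
    have l2 : ∀ j, ∀ x ∈ (D.sub X).F 2 j, ψ j x ∈ Y.F 1 j := fun j x hx => hlow j _ x (fun i => by
      fin_cases i
      · exact Or.inr (Y.h01 j)
      · exact Or.inr le_rfl
      · exact Or.inl hx)
    have l1 : ∀ j, ∀ x ∈ (D.sub X).F 1 j, ψ j x ∈ Y.F 0 j := fun j x hx => hlow j _ x (fun i => by
      fin_cases i
      · exact Or.inr le_rfl
      · exact Or.inl hx
      · exact Or.inl (D.h12 j hx))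
    have l0 : ∀ j, ∀ x ∈ (D.sub X).F 0 j, ψ j x = 0 := fun j x hx => by
      rw [← Submodule.mem_bot k]
      exact hlow j _ x (fun i => by
        fin_cases i
        · exact Or.inl hx
        · exact Or.inl (D.h01 j hx)
        · exact Or.inl (D.h12 j (D.h01 j hx)))
    obtain ⟨g, hgf, hgz⟩ := psi_map (D.sub X) Y ψ hsum l3 l2 l1 l0
    set Sx : Submodule k X := E2.comap X.subtype with hSx
    let fm : (Fin 3 → (V ⧸ X)) →ₗ[k] (Fin 3 → ((V ⧸ X) ⧸ H')) :=
      LinearMap.pi fun j => H'.mkQ ∘ₗ ((LinearMap.proj (j+2) : (Fin 3 → (V ⧸ X)) →ₗ[k] (V ⧸ X)) - LinearMap.proj j)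
    obtain ⟨η0, hη0⟩ := lin_lift fm (Submodule.pi Set.univ fun j => Y.F 0 j)
      ((LinearMap.pi fun j => H'.mkQ ∘ₗ ψ j) ∘ₗ Sx.subtype) (by
        intro c
        obtain ⟨z, hz, hz'⟩ := hgz c.1
        have h0 := hg g hgf c.1 c.2
        rw [hz', tmap_cls] at h0
        obtain ⟨a, ha, hb⟩ := (cls_eq_zero _ _).1 h0
        choose b hb1 hb2 using ha
        refine ⟨b, fun j _ => hb1 j, ?_⟩
        funext j
        change H'.mkQ (b (j+2) - b j) = H'.mkQ (ψ j c.1)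
        have := hb j
        rw [Zmap_apply, hz] at this
        rw [this, map_sub, hb2, hb2])
    have hη1 : ∀ c j, η0 c j ∈ Y.F 0 j := fun c j => (hη0 c).1 j trivial
    have hη2 : ∀ c j, H'.mkQ (η0 c (j+2)) - H'.mkQ (η0 c j) = H'.mkQ (ψ j c.1) := fun c j => by
      rw [← map_sub]; exact congrFun (hη0 c).2 j
    have hη3 : ∀ (c : Sx) j, (c.1 : V) ∈ D.F 2 (j+1) → H'.mkQ (η0 c j) = 0 := by
      intro c j hc
      refine hadm.zero (j := j) ⟨_, hη1 c j, rfl⟩ ?_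
      have h1 := hη2 c (j+1)
      rw [j12] at h1
      rw [sub_eq_iff_eq_add] at h1
      rw [h1]
      exact add_mem ⟨_, l2 (j+1) c.1 hc, rfl⟩ ⟨_, Y.h01 _ (hη1 c (j+1)), rfl⟩
    have hpr : ∀ j, ∃ e : Sx →ₗ[k] Sx, (∀ c, ((e c).1 : V) ∈ D.F 2 (j+1)) ∧
        ∀ c : Sx, (c.1 : V) ∈ D.F 2 (j+1) → e c = c := by
      intro j
      let P : Submodule k Sx := ((D.F 2 (j+1)).comap X.subtype).comap Sx.subtype
      exact exists_proj P
    choose e he1 he2 using hpr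
    let η : Fin 3 → (Sx →ₗ[k] (V ⧸ X)) := fun j =>
      LinearMap.proj j ∘ₗ η0 - (LinearMap.proj j ∘ₗ η0) ∘ₗ e j
    have hηd : ∀ j c, η j c = η0 c j - η0 (e j c) j := fun j c => rfl
    have e1 : ∀ j c, η j c ∈ Y.F 0 j := fun j c => sub_mem (hη1 _ _) (hη1 _ _)
    have e2 : ∀ j c, H'.mkQ (η j c) = H'.mkQ (η0 c j) := fun j c => by
      rw [hηd, map_sub]; rw [hη3 (e j c) j (he1 j c), sub_zero]
    have e3 : ∀ j (c : Sx), (c.1 : V) ∈ D.F 2 (j+1) → η j c = 0 := fun j c hc => by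
      rw [hηd, he2 j c hc, sub_self]
    have htS : ∀ j y, t j y ∈ Sx := fun j y => sub_mem (s2 j y) (s2 0 y)
    let t' : Fin 3 → ((V ⧸ X) →ₗ[k] Sx) := fun j => (t j).codRestrict Sx (htS j)
    have htH : ∀ j, ∀ y ∈ H', t' j y = 0 := by
      rintro j _ ⟨h, hh, rfl⟩
      apply Subtype.ext; apply Subtype.ext
      change s j (X.mkQ h) - s 0 (X.mkQ h) = 0
      rw [s3 j h hh, s3 0 h hh, sub_self]
    have hcomp' : ∀ j, t' j ∘ₗ (ψ j ∘ₗ Sx.subtype) = t' j ∘ₗ η (j+2) - t' j ∘ₗ η j := by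
      intro j
      ext1 c
      have : ψ j c.1 - (η (j+2) c - η j c) ∈ H' := by
        rw [← Submodule.Quotient.mk_eq_zero H']
        change H'.mkQ _ = 0
        rw [map_sub, map_sub, e2, e2, hη2, sub_self]
      have := htH j _ this
      rw [map_sub, map_sub, sub_eq_zero] at this
      exact this
    have htr : ∀ j, LinearMap.trace k X (t j ∘ₗ ψ j) =
        LinearMap.trace k Sx (t' j ∘ₗ η (j+2)) - LinearMap.trace k Sx (t' j ∘ₗ η j) := by
      intro j
      rw [← map_sub, ← hcomp']
      have : t j ∘ₗ ψ j = Sx.subtype ∘ₗ (t' j ∘ₗ ψ j) := rfl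
      rw [this, LinearMap.trace_comp_comm']
      rfl
    have hz : ∀ j, LinearMap.trace k Sx (t' (j+1) ∘ₗ η j) - LinearMap.trace k Sx (t' j ∘ₗ η j) = 0 := by
      intro j
      rw [← map_sub, ← LinearMap.sub_comp]
      apply trace_sq_zero
      intro c
      rw [LinearMap.comp_apply, LinearMap.comp_apply]
      rw [e3 j _ _, map_zero]
      change (s (j+1) (η j c) - s 0 (η j c)) - (s j (η j c) - s 0 (η j c)) ∈ D.F 2 (j+1)
      rw [sub_sub_sub_cancel_right]
      exact sub_mem (s4 (j+1) 2 _ (Y.h02 _ (e1 j c))) (D.h02 _ (s4 j 0 _ (e1 j c)))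
    apply hf0
    rw [hfs, Fin.sum_univ_three, htr, htr, htr]
    have z0 := hz 0
    have z1 := hz 1
    have z2 := hz 2
    simp only [show (0 : Fin 3) + 1 = 1 from rfl, show (1 : Fin 3) + 1 = 2 from rfl,
      show (2 : Fin 3) + 1 = 0 from rfl] at z0 z1 z2
    simp only [show (0 : Fin 3) + 2 = 2 from rfl, show (1 : Fin 3) + 2 = 0 from rfl,
      show (2 : Fin 3) + 2 = 1 from rfl]
    linear_combination z0 + z1 + z2
  obtain ⟨h, hj, hfil, he⟩ := key
  let σ : (V ⧸ X) →ₗ[k] V := s 0 + X.subtype ∘ₗ h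
  have hσj : ∀ j y, σ y = s j y + (hj j y : V) := by
    intro j y
    have := congrArg Subtype.val (LinearMap.congr_fun (he j) y)
    rw [ht] at this
    change s j y - s 0 y = (h y : V) - hj j y at this
    change s 0 y + (h y : V) = _
    rw [sub_eq_sub_iff_add_eq_add] at this
    rw [this]; abel
  have hσ1 : ∀ y, X.mkQ (σ y) = y := by
    intro y
    rw [hσj 0, map_add, s1]; rw [show X.mkQ (hj 0 y : V) = 0 from (Submodule.Quotient.mk_eq_zero X).2 (hj 0 y).2, add_zero]
  have hσ2 : ∀ i j, ∀ y ∈ Y.F i j, σ y ∈ D.F i j := fun i j y hy => by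
    rw [hσj j]; exact add_mem (s4 j i y hy) (hfil j i y hy)
  have hdec : ∀ v, v - σ (X.mkQ v) ∈ X := fun v => by
    rw [← Submodule.Quotient.mk_eq_zero X]
    change X.mkQ _ = 0
    rw [map_sub, hσ1, sub_self]
  refine ⟨LinearMap.range σ, IsCompl.of_eq ?_ ?_, fun i j v hv => ?_⟩
  · rw [eq_bot_iff]
    rintro _ ⟨hx, y, rfl⟩
    have : X.mkQ (σ y) = 0 := (Submodule.Quotient.mk_eq_zero X).2 hx
    rw [hσ1] at this
    rw [this, map_zero]; exact zero_mem _
  · rw [eq_top_iff]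
    intro v _
    have : v = (v - σ (X.mkQ v)) + σ (X.mkQ v) := by abel
    rw [this]
    exact Submodule.add_mem_sup (hdec v) ⟨_, rfl⟩
  · have hs := hσ2 i j _ (show X.mkQ v ∈ Y.F i j from ⟨v, hv, rfl⟩)
    have : v = (v - σ (X.mkQ v)) + σ (X.mkQ v) := by abel
    rw [this]
    exact Submodule.add_mem_sup ⟨sub_mem hv hs, hdec v⟩ ⟨hs, _, rfl⟩

end Tri
end St6

set_option linter.unusedSectionVars false
set_option linter.unusedVariables false
namespace St6
open Module Submodule

variable {k : Type u} [Field k] {V : Type u} [AddCommGroup V] [Module k V] [FiniteDimensional k V]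
  {V' : Type u} [AddCommGroup V'] [Module k V'] [FiniteDimensional k V']

abbrev Cl : Type := ℤ × (Fin 3 → Fin 3 → ℤ)

def Lc (la mu : ℤ) (x : Cl) : ℤ :=
  ∑ j, (mu * x.2 0 j + (la + mu) * x.2 1 j + la * x.2 2 j) - 3 * (la + mu) * x.1

def Pc (x : Cl) : ℤ := ∑ j, (x.2 2 j - x.2 0 j)

def rotC (x : Cl) : Cl := (x.1, fun s j => x.2 s (j+1))

def tauC (x : Cl) : Cl :=
  (Pc x - x.1, ![fun j => Pc x - x.1 - (x.2 2 j - x.2 1 j - x.2 0 (j+2)) - (x.2 1 j - x.2 0 j) -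
      (x.2 2 (j+1) - x.2 1 (j+1)),
    fun j => Pc x - x.1 - (x.2 2 j - x.2 1 j - x.2 0 (j+2)) - (x.2 1 j - x.2 0 j),
    fun j => Pc x - x.1 - (x.2 2 j - x.2 1 j - x.2 0 (j+2))])

theorem Lc_add (la mu : ℤ) (x y : Cl) : Lc la mu (x + y) = Lc la mu x + Lc la mu y := by
  simp [Lc, Fin.sum_univ_three]; ring
theorem Lc_sub (la mu : ℤ) (x y : Cl) : Lc la mu (x - y) = Lc la mu x - Lc la mu y := by
  simp [Lc, Fin.sum_univ_three]; ring
theorem Pc_add (x y : Cl) : Pc (x + y) = Pc x + Pc y := by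
  simp [Pc, Fin.sum_univ_three]; ring
theorem Pc_sub (x y : Cl) : Pc (x - y) = Pc x - Pc y := by
  simp [Pc, Fin.sum_univ_three]; ring
theorem Pc_zero : Pc 0 = 0 := by simp [Pc]

theorem Cl_ext {x y : Cl} (h : x.1 = y.1) (h0 : ∀ j, x.2 0 j = y.2 0 j) (h1 : ∀ j, x.2 1 j = y.2 1 j)
    (h2 : ∀ j, x.2 2 j = y.2 2 j) : x = y := by
  apply Prod.ext h
  funext s j
  fin_cases s
  · exact h0 j
  · exact h1 j
  · exact h2 j

theorem Pc_rotC (x : Cl) : Pc (rotC x) = Pc x := by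
  simp [Pc, rotC, Fin.sum_univ_three]; ring
theorem Pc_tauC (x : Cl) : Pc (tauC x) = Pc x := by
  simp [Pc, tauC, Fin.sum_univ_three]; ring
theorem tauC_tauC (x : Cl) : tauC (tauC x) = rotC x := by
  apply Cl_ext
  · simp [tauC, Pc_tauC, rotC, Pc, Fin.sum_univ_three]; ring
  all_goals intro j; fin_cases j <;> simp [tauC, rotC, Pc, Fin.sum_univ_three] <;> ring
theorem tauC_rotC (x : Cl) : tauC (rotC x) = rotC (tauC x) := by
  rw [← tauC_tauC, ← tauC_tauC]
theorem rotC3 (x : Cl) : rotC (rotC (rotC x)) = x := by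
  apply Cl_ext
  · rfl
  all_goals intro j; fin_cases j <;> rfl
theorem rotC_inj {x y : Cl} (h : rotC x = rotC y) : x = y := by
  rw [← rotC3 x, h, rotC3]
theorem tauC_zero : tauC 0 = 0 := by
  apply Cl_ext
  · simp [tauC, Pc]
  all_goals intro j; simp [tauC, Pc]
theorem tauC_add (x y : Cl) : tauC (x + y) = tauC x + tauC y := by
  apply Cl_ext
  · simp [tauC, Pc, Fin.sum_univ_three]; ring
  all_goals intro j; simp [tauC, Pc, Fin.sum_univ_three]; ring

theorem weights_zero {la mu : ℤ} (hla : 1 ≤ la) (hmu : 0 ≤ mu) (x : Cl) (h0 : ∀ s j, 0 ≤ x.2 s j)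
    (hx : ∑ j, (mu * x.2 0 j + (la + mu) * x.2 1 j + la * x.2 2 j) ≤ 0) (j : Fin 3) :
    mu * x.2 0 j = 0 ∧ x.2 1 j = 0 ∧ x.2 2 j = 0 := by
  have a := fun j => mul_nonneg hmu (h0 0 j)
  have b := fun j => mul_nonneg (show 0 ≤ la + mu by omega) (h0 1 j)
  have c := fun j => mul_nonneg (show 0 ≤ la by omega) (h0 2 j)
  rw [sum3 j] at hx
  have a0 := a j; have a1 := a (j+1); have a2 := a (j+2)
  have b0 := b j; have b1 := b (j+1); have b2 := b (j+2)
  have c0 := c j; have c1 := c (j+1); have c2 := c (j+2)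
  refine ⟨by linarith, ?_, ?_⟩
  · have : (la + mu) * x.2 1 j = 0 := by linarith
    rcases mul_eq_zero.1 this with h | h
    · omega
    · exact h
  · have : la * x.2 2 j = 0 := by linarith
    rcases mul_eq_zero.1 this with h | h
    · omega
    · exact h

theorem d_quot_inf (F W : Submodule k V) (B : Submodule k (V ⧸ W)) :
    d (F.map W.mkQ ⊓ B) = d (F ⊓ B.comap W.mkQ) - d (F ⊓ W) := by
  have := LL_quot (fun _ : Unit => F) (fun _ => 1) 0 W B
  simpa [LL] using this

theorem d_sub_inf (F W : Submodule k V) (A : Submodule k W) :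
    d (F.comap W.subtype ⊓ A) = d (F ⊓ A.map W.subtype) := by
  have := LL_sub (fun _ : Unit => F) (fun _ => 1) 0 W A
  simpa [LL] using this

namespace Tri

/-- class of a subspace -/
noncomputable def cS (D : Tri k V) (W : Submodule k V) : Cl := (d W, fun s j => d (D.F s j ⊓ W))

noncomputable def cl (D : Tri k V) : Cl := D.cS ⊤

theorem L_eq (D : Tri k V) (la mu : ℤ) (W : Submodule k V) : D.L la mu W = Lc la mu (D.cS W) := L_expand D la mu W

theorem cS_sub (D : Tri k V) (W : Submodule k V) (A : Submodule k W) :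
    (D.sub W).cS A = D.cS (A.map W.subtype) := by
  refine Prod.ext (d_map_subtype W A).symm ?_
  funext s j
  exact d_sub_inf _ _ _

theorem cl_sub (D : Tri k V) (W : Submodule k V) : (D.sub W).cl = D.cS W := by
  rw [cl, cS_sub, Submodule.map_top, Submodule.range_subtype]

theorem cS_quot (D : Tri k V) (W : Submodule k V) (B : Submodule k (V ⧸ W)) :
    (D.quot W).cS B = D.cS (B.comap W.mkQ) - D.cS W := by
  refine Prod.ext ?_ ?_
  · change d B = d (B.comap W.mkQ) - d W
    rw [d_comap_mkQ]; ring
  funext s j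
  exact d_quot_inf _ _ _

theorem cl_quot (D : Tri k V) (W : Submodule k V) : (D.quot W).cl = D.cl - D.cS W := by
  rw [cl, cS_quot, Submodule.comap_top]; rfl

theorem cS_bot (D : Tri k V) : D.cS ⊥ = 0 := by
  refine Prod.ext (d_bot) ?_
  funext s j
  simp [cS]

theorem cl_fst (D : Tri k V) : D.cl.1 = finrank k V := d_top
theorem cl_snd (D : Tri k V) (s j) : D.cl.2 s j = d (D.F s j) := by simp [cl, cS]

theorem cl_rot (D : Tri k V) : D.rot.cl = rotC D.cl := rfl
theorem cS_rot (D : Tri k V) (W) : D.rot.cS W = rotC (D.cS W) := rfl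

structure Good (D : Tri k V) (la mu : ℤ) : Prop where
  top : D.L la mu ⊤ = 0
  le : ∀ W, D.L la mu W ≤ 0
  z0 : mu = 0 → ∀ j, D.F 0 j = ⊥
  z1 : mu = 0 → ∀ j, D.F 1 j ⊓ D.F 2 (j+1) = ⊥

variable {la mu : ℤ}

theorem Good.lowC {D : Tri k V} (h : D.Good la mu) : D.LowC la mu := fun W _ => h.le W
theorem Good.adm (hla : 1 ≤ la) (hmu : 0 ≤ mu) {D : Tri k V} (h : D.Good la mu) : D.Adm :=
  h.lowC.adm hla hmu

theorem Good.rot {D : Tri k V} (h : D.Good la mu) : D.rot.Good la mu where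
  top := by rw [L_rot, h.top]
  le W := by rw [L_rot]; exact h.le W
  z0 e j := h.z0 e _
  z1 e j := h.z1 e _

theorem Good.sub {D : Tri k V} (h : D.Good la mu) {W : Submodule k V} (hW : D.L la mu W = 0) :
    (D.sub W).Good la mu where
  top := by rw [L_sub, Submodule.map_top, Submodule.range_subtype, hW]
  le A := by rw [L_sub]; exact h.le _
  z0 e j := by
    change (D.F 0 j).comap W.subtype = ⊥
    rw [h.z0 e, eq_bot_iff]
    intro x hx
    have : (x : V) = 0 := by simpa using hx
    simpa using this
  z1 e j := by
    rw [eq_bot_iff]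
    rintro x ⟨hx1, hx2⟩
    have : (x : V) ∈ D.F 1 j ⊓ D.F 2 (j+1) := ⟨hx1, hx2⟩
    rw [h.z1 e] at this
    simpa using this

/-- in the degenerate case the summands are complementary -/
theorem Good.compl {D : Tri k V} (h : D.Good la mu) (hla : 1 ≤ la) (e : mu = 0) (j : Fin 3) :
    d (D.F 1 j) + d (D.F 2 (j+1)) = finrank k V := by
  have hle : ∀ j, d (D.F 1 j) + d (D.F 2 (j+1)) ≤ finrank k V := by
    intro j
    rw [← d_sup_inf, h.z1 e j, d_bot, add_zero, ← d_top (k := k)]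
    exact d_mono le_top
  have ht := h.top
  rw [L_top, sum3 j, e, h.z0 e, h.z0 e, h.z0 e] at ht
  have h0 := hle j; have h1 := hle (j+1); have h2 := hle (j+2)
  rw [j11] at h1; rw [j21] at h2
  have : la * (d (D.F 1 j) + d (D.F 2 (j+1)) + (d (D.F 1 (j+1)) + d (D.F 2 (j+2))) +
      (d (D.F 1 (j+2)) + d (D.F 2 j)) - 3 * finrank k V) = 0 := by linear_combination ht
  rcases mul_eq_zero.1 this with h' | h'
  · omega
  · omega

theorem Good.quot {D : Tri k V} (h : D.Good la mu) (hla : 1 ≤ la) {W : Submodule k V}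
    (hW : D.L la mu W = 0) : (D.quot W).Good la mu where
  top := by rw [L_quot, Submodule.comap_top, hW, h.top, sub_zero]
  le A := by rw [L_quot, hW, sub_zero]; exact h.le _
  z0 e j := by
    change (D.F 0 j).map W.mkQ = ⊥
    rw [h.z0 e, Submodule.map_bot]
  z1 e j := by
    have h1 := h.compl hla e j
    have h2 := (h.sub hW).compl hla e j
    have e1 := cl_snd (D.sub W) 1 j
    have e2 := cl_snd (D.sub W) 2 (j+1)
    rw [cl_sub] at e1 e2
    rw [← e1, ← e2] at h2
    have q1 := cl_snd (D.quot W) 1 j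
    have q2 := cl_snd (D.quot W) 2 (j+1)
    rw [cl_quot] at q1 q2
    change D.cl.2 1 j - (D.cS W).2 1 j = _ at q1
    change D.cl.2 2 (j+1) - (D.cS W).2 2 (j+1) = _ at q2
    rw [cl_snd] at q1 q2
    have hq := finrank_quot W
    have ht : D.F 1 j ⊔ D.F 2 (j+1) = ⊤ := by
      apply eq_of_le_of_d le_top
      have := d_sup_inf (D.F 1 j) (D.F 2 (j+1))
      rw [h.z1 e, d_bot] at this
      rw [d_top]; omega
    have ht' : (D.quot W).F 1 j ⊔ (D.quot W).F 2 (j+1) = ⊤ := by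
      change (D.F 1 j).map W.mkQ ⊔ (D.F 2 (j+1)).map W.mkQ = ⊤
      rw [← Submodule.map_sup, ht, Submodule.map_top, Submodule.range_mkQ]
    have := d_sup_inf ((D.quot W).F 1 j) ((D.quot W).F 2 (j+1))
    rw [ht', d_top] at this
    apply d_eq_zero
    have hd : (finrank k W : ℤ) = d W := rfl
    omega

theorem Good.tau (hla : 1 ≤ la) (hmu : 0 ≤ mu) {D : Tri k V} (h : D.Good la mu) : D.tau.Good la mu where
  top := by
    have h1 := T1 (h.adm hla hmu) hla hmu
    have h2 := T2 hla hmu h.lowC ⊤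
    have := h.top
    omega
  le := T2 hla hmu h.lowC
  z0 e j := by
    rw [eq_bot_iff]
    rintro _ ⟨x, hx, rfl⟩
    obtain ⟨h0, h1⟩ := (mem_Gt0 D j x).1 hx
    have hr := x.2.2 j
    rw [h0, zero_add] at hr
    have : x.1 (j+1) ∈ D.F 1 (j+1) ⊓ D.F 2 (j+1+1) := by
      refine ⟨h1, ?_⟩
      rw [j11, eq_neg_of_add_eq_zero_left hr]
      exact neg_mem (x.2.1 _)
    rw [h.z1 e, Submodule.mem_bot] at this
    rw [this, zero_add] at hr
    have : x = 0 := by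
      apply Zt_ext j
      · exact h0
      · exact this
      · exact hr
    rw [this, map_zero]; exact zero_mem _
  z1 e j := by
    rw [eq_bot_iff]
    rintro _ ⟨⟨x, hx, rfl⟩, ⟨y, hy, hxy⟩⟩
    have hB : x = y := by
      have : D.cls (x - y) = 0 := by rw [map_sub, hxy, sub_self]
      obtain ⟨a, ha, hb⟩ := (cls_eq_zero D _).1 this
      have ha' : ∀ j, a j = 0 := fun j => by have := ha j; rw [h.z0 e] at this; simpa using this
      rw [← sub_eq_zero]
      apply Subtype.ext; funext l
      rw [hb l, ha', ha', sub_zero]; rfl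
    subst hB
    have h0 := (mem_Gt1 D j x).1 hx
    have h1 := (mem_Gt2 D (j+1) x).1 hy
    have hr := x.2.2 j
    rw [h0, zero_add] at hr
    have : x.1 (j+1) ∈ D.F 1 (j+1) ⊓ D.F 2 (j+1+1) := by
      refine ⟨h1, ?_⟩
      rw [j11, eq_neg_of_add_eq_zero_left hr]
      exact neg_mem (x.2.1 _)
    rw [h.z1 e, Submodule.mem_bot] at this
    rw [this, zero_add] at hr
    have : x = 0 := by
      apply Zt_ext j
      · exact h0
      · exact this
      · exact hr
    rw [this, map_zero]; exact zero_mem _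

theorem Good.cl_tau (hla : 1 ≤ la) (hmu : 0 ≤ mu) {D : Tri k V} (h : D.Good la mu) :
    D.tau.cl = tauC D.cl := by
  have ht := h.top
  have ht' := (h.tau hla hmu).top
  have hA := h.adm hla hmu
  rw [L_top] at ht ht'
  have hv := mul_le_mul_of_nonneg_left D.T1_v (show 0 ≤ 3 * (la + mu) by omega)
  have h4 := fun j => mul_le_mul_of_nonneg_left (T1_4 hA j) (show 0 ≤ 2 * (la + mu) by omega)
  have h3 := fun j => mul_le_mul_of_nonneg_left (D.T1_3 j) (show 0 ≤ la + 2 * mu by omega)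
  have h2 := fun j => mul_le_mul_of_nonneg_left (D.T1_2 j) hmu
  simp only [Fin.sum_univ_three] at ht ht' hv
  have a0 := h4 0; have a1 := h4 1; have a2 := h4 2
  have b0 := h3 0; have b1 := h3 1; have b2 := h3 2
  have c0 := h2 0; have c1 := h2 1; have c2 := h2 2
  simp only [show (0 : Fin 3) + 1 = 1 from rfl,
    show (1 : Fin 3) + 1 = 2 from rfl, show (2 : Fin 3) + 1 = 0 from rfl, show (0 : Fin 3) + 2 = 2 from rfl,
    show (1 : Fin 3) + 2 = 0 from rfl, show (2 : Fin 3) + 2 = 1 from rfl] at *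
  have ev := mul_left_cancel₀ (show 3 * (la + mu) ≠ 0 by omega) (le_antisymm hv (by linarith))
  have x0 := mul_left_cancel₀ (show 2 * (la + mu) ≠ 0 by omega) (le_antisymm a0 (by linarith))
  have x1 := mul_left_cancel₀ (show 2 * (la + mu) ≠ 0 by omega) (le_antisymm a1 (by linarith))
  have x2 := mul_left_cancel₀ (show 2 * (la + mu) ≠ 0 by omega) (le_antisymm a2 (by linarith))
  have y0 := mul_left_cancel₀ (show la + 2 * mu ≠ 0 by omega) (le_antisymm b0 (by linarith))
  have y1 := mul_left_cancel₀ (show la + 2 * mu ≠ 0 by omega) (le_antisymm b1 (by linarith))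
  have y2 := mul_left_cancel₀ (show la + 2 * mu ≠ 0 by omega) (le_antisymm b2 (by linarith))
  have z : d (D.tau.F 1 0) + d (D.F 1 1) = d (D.F 2 1) + d (D.tau.F 0 0) ∧
      d (D.tau.F 1 1) + d (D.F 1 2) = d (D.F 2 2) + d (D.tau.F 0 1) ∧
      d (D.tau.F 1 2) + d (D.F 1 0) = d (D.F 2 0) + d (D.tau.F 0 2) := by
    by_cases hm : mu = 0
    · have g0 := h.compl hla hm 0
      have g1 := h.compl hla hm 1
      have g2 := h.compl hla hm 2
      simp only [show (0 : Fin 3) + 1 = 1 from rfl,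
        show (1 : Fin 3) + 1 = 2 from rfl, show (2 : Fin 3) + 1 = 0 from rfl] at g0 g1 g2
      have t0 := h.z0 hm
      have t1 := (h.tau hla hmu).z0 hm
      simp only [t0, t1, d_bot] at *
      refine ⟨?_, ?_, ?_⟩ <;> linarith
    · exact ⟨mul_left_cancel₀ hm (le_antisymm c0 (by linarith)),
        mul_left_cancel₀ hm (le_antisymm c1 (by linarith)), mul_left_cancel₀ hm (le_antisymm c2 (by linarith))⟩
  obtain ⟨z0, z1, z2⟩ := z
  apply Cl_ext
  · simp only [tauC, Pc, Fin.sum_univ_three, cl_snd, cl_fst]; linarith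
  all_goals intro j; fin_cases j <;> simp [tauC, Pc, Fin.sum_univ_three, cl_snd, cl_fst] <;> linarith

end Tri
end St6

set_option linter.unusedSectionVars false
set_option linter.unusedVariables false
namespace St6
open Module Submodule

variable {k : Type u} [Field k] {V : Type u} [AddCommGroup V] [Module k V] [FiniteDimensional k V]
  {V' : Type u} [AddCommGroup V'] [Module k V'] [FiniteDimensional k V']

theorem tauC_inj {x y : Cl} (h : tauC x = tauC y) : x = y := by
  apply rotC_inj; rw [← tauC_tauC, ← tauC_tauC, h]

namespace Tri
variable {la mu : ℤ}

theorem Good.crit_sup_inf (hla : 1 ≤ la) (hmu : 0 ≤ mu) {D : Tri k V} (h : D.Good la mu) {A B : Submodule k V}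
    (hA : D.L la mu A = 0) (hB : D.L la mu B = 0) :
    D.L la mu (A ⊔ B) = 0 ∧ D.L la mu (A ⊓ B) = 0 := by
  have := D.L_super hla hmu A B
  have := h.le (A ⊔ B); have := h.le (A ⊓ B)
  constructor <;> omega

theorem ker_crit (hla : 1 ≤ la) (hmu : 0 ≤ mu) {D : Tri k V} {D' : Tri k V'} (h : ∀ W, D.L la mu W ≤ 0)
    (h' : ∀ W, D'.L la mu W ≤ 0) {g : V →ₗ[k] V'} (hg : Fil D D' g) {A : Submodule k V} (hA : D.L la mu A = 0) :
    D.L la mu (A ⊓ LinearMap.ker g) = 0 ∧ D'.L la mu (A.map g) = 0 := by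
  have := L_image hla hmu hg A
  have := h (A ⊓ LinearMap.ker g); have := h' (A.map g)
  constructor <;> omega

theorem d_map_disj {g : V →ₗ[k] V'} {A B : Submodule k V} (hd : A ⊓ LinearMap.ker g = ⊥) (hB : B ≤ A) :
    d (B.map g) = d B := by
  rw [d_map]
  have : B ⊓ LinearMap.ker g = ⊥ := by
    rw [eq_bot_iff, ← hd]; exact inf_le_inf_right _ hB
  rw [this, d_bot, sub_zero]

theorem inj_class (hla : 1 ≤ la) (hmu : 0 ≤ mu) {D : Tri k V} {D' : Tri k V'} (h : D.Good la mu)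
    (h' : D'.Good la mu) {g : V →ₗ[k] V'} (hg : Fil D D' g) {A : Submodule k V} (hA : D.L la mu A = 0)
    (hd : A ⊓ LinearMap.ker g = ⊥) :
    D'.L la mu (A.map g) = 0 ∧ D'.cS (A.map g) = D.cS A ∧
      ∀ s j, D'.F s j ⊓ A.map g = (D.F s j ⊓ A).map g := by
  have hc := (ker_crit hla hmu h.le h'.le hg hA).2
  have hle : ∀ s j, (D.F s j ⊓ A).map g ≤ D'.F s j ⊓ A.map g := by
    rintro s j _ ⟨x, hx, rfl⟩
    exact ⟨hg _ _ _ hx.1, ⟨x, hx.2, rfl⟩⟩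
  have hdd : ∀ s j, d ((D.F s j ⊓ A).map g) = d (D.F s j ⊓ A) := fun s j => d_map_disj hd inf_le_right
  have hv : (D'.cS (A.map g) - D.cS A).1 = 0 := by
    change d (A.map g) - d A = 0
    rw [d_map_disj hd le_rfl, sub_self]
  have hL : Lc la mu (D'.cS (A.map g) - D.cS A) = 0 := by
    rw [Lc_sub, ← L_eq, ← L_eq, hc, hA, sub_self]
  have hn : ∀ s j, 0 ≤ (D'.cS (A.map g) - D.cS A).2 s j := fun s j => by
    change 0 ≤ d (D'.F s j ⊓ A.map g) - d (D.F s j ⊓ A)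
    rw [← hdd]
    have := d_mono (hle s j); omega
  have hw := weights_zero hla hmu _ hn (by
    unfold Lc at hL; rw [hv] at hL; linarith)
  have heq : D'.cS (A.map g) = D.cS A := by
    rw [← sub_eq_zero]
    apply Cl_ext
    · exact hv
    · intro j
      by_cases e : mu = 0
      · change d (D'.F 0 j ⊓ A.map g) - d (D.F 0 j ⊓ A) = 0
        rw [h.z0 e, h'.z0 e]; simp
      · exact (mul_eq_zero.1 (hw j).1).resolve_left e
    · exact fun j => (hw j).2.1
    · exact fun j => (hw j).2.2
  refine ⟨hc, heq, fun s j => ?_⟩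
  symm
  apply eq_of_le_of_d (hle s j)
  rw [hdd]
  have := congrArg (fun x : Cl => x.2 s j) heq
  exact this.le

theorem Good.Pc_cl (hla : 1 ≤ la) (hmu : 0 ≤ mu) {D : Tri k V} (h : D.Good la mu) :
    Pc D.cl = finrank k V + finrank k D.TV := by
  have := congrArg Prod.fst (h.cl_tau hla hmu)
  rw [cl_fst] at this
  change _ = Pc D.cl - D.cl.1 at this
  rw [cl_fst] at this
  omega

theorem Good.Pc_ge (hla : 1 ≤ la) (hmu : 0 ≤ mu) {D : Tri k V} (h : D.Good la mu) {W : Submodule k V}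
    (hW : D.L la mu W = 0) : d W ≤ Pc (D.cS W) := by
  rw [← cl_sub, (h.sub hW).Pc_cl hla hmu]
  unfold d; omega

theorem Good.Pc_pos (hla : 1 ≤ la) (hmu : 0 ≤ mu) {D : Tri k V} (h : D.Good la mu) {W : Submodule k V}
    (hW : D.L la mu W = 0) (hne : W ≠ ⊥) : 0 < Pc (D.cS W) :=
  lt_of_lt_of_le (d_pos hne) (h.Pc_ge hla hmu hW)

theorem cS_mono_Pc (hla : 1 ≤ la) (hmu : 0 ≤ mu) {D : Tri k V} (h : D.Good la mu) {A B : Submodule k V}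
    (hA : D.L la mu A = 0) (hB : D.L la mu B = 0) (hAB : A ≤ B) (hP : Pc (D.cS B) ≤ Pc (D.cS A)) : A = B := by
  have hq := h.quot hla hA
  have e : (B.map A.mkQ).comap A.mkQ = B := by
    rw [Submodule.comap_map_mkQ]; exact sup_eq_right.2 hAB
  have hc : (D.quot A).L la mu (B.map A.mkQ) = 0 := by rw [L_quot, e, hA, hB, sub_zero]
  have h1 := hq.Pc_ge hla hmu hc
  rw [cS_quot, e, Pc_sub] at h1
  have : B.map A.mkQ = ⊥ := d_eq_zero (by omega)
  apply le_antisymm hAB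
  rw [← e, this, Submodule.comap_bot, Submodule.ker_mkQ]

theorem Good.tau_nontriv (hla : 1 ≤ la) (hmu : 0 ≤ mu) {D : Tri k V} (h : D.Good la mu) (hV : Nontrivial V) :
    Nontrivial D.TV := by
  by_contra hn
  rw [not_nontrivial_iff_subsingleton] at hn
  have hz : ∀ W : Submodule k D.TV, d W = 0 := fun W => by
    have : W = ⊥ := Subsingleton.elim _ _
    rw [this, d_bot]
  have h1 := congrArg Prod.fst (tauC_tauC D.cl)
  rw [← h.cl_tau hla hmu] at h1
  have h2 : (rotC D.cl).1 = finrank k V := cl_fst D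
  rw [h2] at h1
  have h3 : (tauC D.tau.cl).1 = 0 := by
    change Pc D.tau.cl - D.tau.cl.1 = 0
    simp only [Pc, cl]
    simp [cS, hz]
  rw [h3] at h1
  have := finrank_pos (R := k) (M := V)
  omega

theorem IsU.quot {Y : Tri k V} {S : Tri k V'} {g : V' →ₗ[k] Y.TV} (hg : Fil S Y.tau g)
    {u : S.TV →ₗ[k] V} (hu : IsU Y S g u) (H : Submodule k V) (hH : (Y.quot H).Adm) :
    IsU (Y.quot H) S (tmap (fil_mkQ Y H) ∘ₗ g) (H.mkQ ∘ₗ u) := by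
  intro i M' hM'
  obtain ⟨M, hM⟩ := exists_mat hg i
  have hm : Mat (Y.quot H) (tmap (fil_mkQ Y H) ∘ₗ g) i (fun j => Zmap (fil_mkQ Y H) (M j)) := by
    refine ⟨fun l => ?_, fun j => ?_, fun j => ?_⟩
    · have := congrArg H.mkQ (hM.col l)
      rw [map_add, map_add, map_zero] at this
      exact this
    · exact ⟨_, hM.diag j, rfl⟩
    · rw [← tmap_cls, hM.rep j]; rfl
  rw [hM'.unique hH hm, LinearMap.comp_apply, hu i M hM]
  unfold uval
  rw [map_sub]; rfl

structure Atom (S : Tri k V) (la mu : ℤ) : Prop where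
  good : S.Good la mu
  nt : Nontrivial V
  simple : ∀ W, S.L la mu W = 0 → W = ⊥ ∨ W = ⊤

structure Mono (D : Tri k V) (la mu : ℤ) (S : Submodule k V) : Prop where
  ne : S ≠ ⊥
  crit : D.L la mu S = 0
  le : ∀ W, D.L la mu W = 0 → W ≠ ⊥ → S ≤ W

theorem u_inj (hla : 1 ≤ la) (hmu : 0 ≤ mu) {Y : Tri k V} {S : Tri k V'} (hS : S.Good la mu)
    (hY : Y.Good la mu) {g : V' →ₗ[k] Y.TV} (hg : Fil S Y.tau g) {u : S.TV →ₗ[k] V} (hu : IsU Y S g u)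
    (hinj : Function.Injective g) : Function.Injective u := by
  have hk : (⊤ : Submodule k V') ⊓ LinearMap.ker g = ⊥ := by rw [LinearMap.ker_eq_bot.2 hinj, inf_bot_eq]
  obtain ⟨hc, -, hs⟩ := inj_class hla hmu hS (hY.tau hla hmu) hg hS.top hk
  rw [Submodule.map_top] at hc hs
  apply hu.inj hg hinj
  intro α hα hα' r
  have hm := sub_cond (D := Y.tau) (I := LinearMap.range g) (fun x hx =>
    inter_zero hla hmu ((hY.tau hla hmu).quot hla hc).le x hx) α hα hα' r
  have : α r ∈ Y.tau.F 0 r ⊓ LinearMap.range g := ⟨hα r, hm⟩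
  rw [hs] at this
  obtain ⟨s, hs, e⟩ := this
  exact ⟨s, hs.1, e⟩

theorem comp_zero (hla : 1 ≤ la) (hmu : 0 ≤ mu) {Y : Tri k V} {S : Tri k V'} (hS : S.Atom la mu)
    (hY : Y.Good la mu) {H : Submodule k V} (hH : Y.Mono la mu H) {g : V' →ₗ[k] Y.TV} (hg : Fil S Y.tau g)
    (x : V') : tmap (fil_mkQ Y H) (g x) = 0 := by
  by_contra hne
  have hq := hY.quot hla hH.crit
  have hgf : Fil S (Y.quot H).tau (tmap (fil_mkQ Y H) ∘ₗ g) :=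
    fun s j x hx => tmap_fil (fil_mkQ Y H) _ _ _ (hg s j x hx)
  have hinj : Function.Injective (tmap (fil_mkQ Y H) ∘ₗ g) := by
    have := (ker_crit hla hmu hS.good.le (hq.tau hla hmu).le hgf hS.good.top).1
    rw [top_inf_eq] at this
    rcases hS.simple _ this with h | h
    · exact LinearMap.ker_eq_bot.1 h
    · exfalso; apply hne
      have : x ∈ LinearMap.ker (tmap (fil_mkQ Y H) ∘ₗ g) := by rw [h]; trivial
      exact this
  obtain ⟨u, hu⟩ := exists_u (hY.adm hla hmu) hg
  have hu' := IsU.quot hg hu H (hq.adm hla hmu)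
  have hui := u_inj hla hmu hS.good hq hgf hu' hinj
  have huf := IsU.fil (hY.adm hla hmu) hg hu
  have hr := (ker_crit hla hmu (hS.good.tau hla hmu).le hY.rot.le huf (hS.good.tau hla hmu).top).2
  rw [L_rot, Submodule.map_top] at hr
  have := hS.good.tau_nontriv hla hmu hS.nt
  have hrne : LinearMap.range u ≠ ⊥ := by
    intro h
    obtain ⟨z, hz⟩ := exists_ne (0 : S.TV)
    apply hz
    apply hui
    have : u z ∈ LinearMap.range u := ⟨z, rfl⟩
    rw [h, Submodule.mem_bot] at this
    simp [this]
  have hle := hH.le _ hr hrne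
  obtain ⟨y, hy, hy0⟩ := Submodule.exists_mem_ne_zero_of_ne_bot hH.ne
  obtain ⟨z, rfl⟩ := hle hy
  apply hy0
  have : z = 0 := by
    apply hui
    rw [map_zero]
    exact (Submodule.Quotient.mk_eq_zero H).2 hy
  rw [this, map_zero]

/-- compatible subspaces pair -/
def Spl (D : Tri k V) (A B : Submodule k V) : Prop :=
  IsCompl A B ∧ ∀ s j, D.F s j ≤ (D.F s j ⊓ A) ⊔ (D.F s j ⊓ B)

theorem atom_sub {D : Tri k V} {S W : Submodule k V} (hS : (D.sub S).Atom la mu) (hW : D.L la mu W = 0)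
    (hWS : W ≤ S) : W = ⊥ ∨ W = S := by
  have e : (W.comap S.subtype).map S.subtype = W := by
    rw [Submodule.map_comap_subtype]; exact inf_eq_right.2 hWS
  have := hS.simple (W.comap S.subtype) (by rw [L_sub, e, hW])
  rcases this with h | h
  · left; rw [← e, h, Submodule.map_bot]
  · right; rw [← e, h, Submodule.map_top, Submodule.range_subtype]

theorem mono_ext (hla : 1 ≤ la) (hmu : 0 ≤ mu) {D : Tri k V} (hD : D.Good la mu) {S H0 : Submodule k V}
    (hS : (D.sub S).Atom la mu) (hSc : D.L la mu S = 0) (hH0 : D.L la mu H0 = 0) (hlt : S < H0)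
    (hmin : ∀ W, D.L la mu W = 0 → S < W → H0 ≤ W) (hns : ∀ C, ¬ D.Spl S C) : D.Mono la mu S := by
  refine ⟨?_, hSc, ?_⟩
  · have := hS.nt
    exact (Submodule.nontrivial_iff_ne_bot).1 this
  intro W hW hne
  by_contra hnle
  have hWS : W ⊓ S = ⊥ := by
    rcases atom_sub hS (hD.crit_sup_inf hla hmu hW hSc).2 inf_le_right with h | h
    · exact h
    · exact absurd (inf_eq_right.1 h) hnle
  have hlt' : S < W ⊔ S := by
    refine lt_of_le_of_ne le_sup_right fun h => hne ?_
    have : W ≤ S := by rw [h]; exact le_sup_left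
    rw [← hWS, inf_eq_left.2 this]
  have hle := hmin _ (hD.crit_sup_inf hla hmu hW hSc).1 hlt'
  set H := W ⊓ H0 with hH
  have hHc : D.L la mu H = 0 := (hD.crit_sup_inf hla hmu hW hH0).2
  have hHS : H ⊓ S = ⊥ := by
    rw [eq_bot_iff, ← hWS]; exact inf_le_inf_right _ inf_le_left
  have hsup : H ⊔ S = H0 := by
    rw [hH, inf_comm]
    rw [inf_sup_assoc_of_le W hlt.le]
    exact inf_eq_left.2 hle
  have hfq := fil_mkQ D S
  have hqg := hD.quot hla hSc
  obtain ⟨hcr, -, hst⟩ := inj_class hla hmu hD hqg hfq hHc (by rw [Submodule.ker_mkQ]; exact hHS)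
  have hMono : (D.quot S).Mono la mu (H.map S.mkQ) := by
    refine ⟨fun h => ?_, hcr, fun W' hW' hne' => ?_⟩
    · have hHle : H ≤ S := by
        intro x hx
        have : S.mkQ x ∈ H.map S.mkQ := ⟨x, hx, rfl⟩
        rw [h] at this
        exact (Submodule.Quotient.mk_eq_zero S).1 this
      rw [sup_eq_right.2 hHle] at hsup
      exact hlt.ne hsup
    · rw [Submodule.map_le_iff_le_comap]
      rw [L_quot, hSc, sub_zero] at hW'
      refine le_trans inf_le_right (hmin _ hW' ?_)
      refine lt_of_le_of_ne ?_ fun h => hne' ?_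
      · intro x hx
        change S.mkQ x ∈ W'
        rw [show S.mkQ x = 0 from (Submodule.Quotient.mk_eq_zero S).2 hx]; exact zero_mem _
      · rw [eq_bot_iff]
        intro y hy
        obtain ⟨x, rfl⟩ := S.mkQ_surjective y
        have : x ∈ S := by rw [h]; exact hy
        exact (Submodule.Quotient.mk_eq_zero S).2 this
  obtain ⟨C, hC1, hC2⟩ := split_star D S ⊤ H (by simp) (fun s j => by
      rw [inf_top_eq]; exact le_sup_left) le_top hHS (fun s j y hy hyF => by
      have : S.mkQ y ∈ (D.quot S).F s j ⊓ H.map S.mkQ := ⟨hyF, ⟨y, hy, rfl⟩⟩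
      rw [hst] at this
      obtain ⟨y', ⟨hy'1, hy'2⟩, he⟩ := this
      have hs : y' - y ∈ S := (Submodule.Quotient.eq S).1 he
      have : y' - y ∈ H ⊓ S := ⟨sub_mem hy'2 hy, hs⟩
      rw [hHS, Submodule.mem_bot, sub_eq_zero] at this
      rw [← this]; exact hy'1) ((hqg.quot hla hcr).adm hla hmu)
      (fun g hg x _ => comp_zero hla hmu hS hqg hMono hg x)
  exact hns C ⟨hC1, hC2⟩

theorem atom_tau (hla : 1 ≤ la) (hmu : 0 ≤ mu) {S : Tri k V} (hS : S.Atom la mu) : S.tau.Atom la mu := by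
  refine ⟨hS.good.tau hla hmu, hS.good.tau_nontriv hla hmu hS.nt, fun T hT => ?_⟩
  by_cases hne : T = ⊥
  · exact Or.inl hne
  right
  have hTg := (hS.good.tau hla hmu).sub hT
  have hg := fil_subtype S.tau T
  obtain ⟨u, hu⟩ := exists_u (hS.good.adm hla hmu) hg
  have hui := u_inj hla hmu hTg hS.good hg hu T.injective_subtype
  have huf := IsU.fil (hS.good.adm hla hmu) hg hu
  have hTT := hTg.tau hla hmu
  obtain ⟨hc, hcl, -⟩ := inj_class hla hmu hTT hS.good.rot huf hTT.top (by
    rw [LinearMap.ker_eq_bot.2 hui, inf_bot_eq])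
  rw [Submodule.map_top] at hc hcl
  have := hTg.tau_nontriv hla hmu (Submodule.nontrivial_iff_ne_bot.2 hne)
  have hrne : LinearMap.range u ≠ ⊥ := by
    intro h
    obtain ⟨z, hz⟩ := exists_ne (0 : (S.tau.sub T).TV)
    apply hz
    apply hui
    have : u z ∈ LinearMap.range u := ⟨z, rfl⟩
    rw [h, Submodule.mem_bot] at this
    simp [this]
  rw [L_rot] at hc
  have hrt := (hS.simple _ hc).resolve_left hrne
  rw [hrt, cS_rot] at hcl
  change rotC S.cl = (S.tau.sub T).tau.cl at hcl
  rw [hTg.cl_tau hla hmu, cl_sub] at hcl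
  have := congrArg Pc hcl
  rw [Pc_rotC, Pc_tauC] at this
  apply cS_mono_Pc hla hmu (hS.good.tau hla hmu) hT (hS.good.tau hla hmu).top le_top
  rw [← this]
  change Pc S.tau.cl ≤ _
  rw [hS.good.cl_tau hla hmu, Pc_tauC]

theorem class_step (hla : 1 ≤ la) (hmu : 0 ≤ mu) {D : Tri k V} (hD : D.Good la mu) {S : Submodule k V}
    (hS : (D.sub S).Atom la mu) (hSc : D.L la mu S = 0) (hns : ∀ C, ¬ D.Spl S C) {H : Submodule k (V ⧸ S)}
    (hH : (D.quot S).Mono la mu H) : D.cS S = tauC ((D.quot S).cS H) := by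
  have hq := hD.quot hla hSc
  have hex : ∃ g, Fil (D.sub S) (D.quot S).tau g ∧ ∃ x, g x ≠ 0 := by
    by_contra hcon
    push Not at hcon
    obtain ⟨C, hC1, hC2⟩ := split_star D S ⊤ ⊥ (by simp) (fun s j => by
      rw [inf_top_eq]; exact le_sup_left) le_top (bot_inf_eq _) (fun s j y hy hyF => by
      rw [(Submodule.mem_bot k).1 hy]; exact zero_mem _) (by
        apply Good.adm hla hmu
        apply hq.quot hla
        rw [Submodule.map_bot, L_bot]) (fun g hg x _ => by rw [hcon g hg x, map_zero])
    exact hns C ⟨hC1, hC2⟩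
  obtain ⟨g, hg, x, hx⟩ := hex
  have hinj : Function.Injective g := by
    have := (ker_crit hla hmu hS.good.le (hq.tau hla hmu).le hg hS.good.top).1
    rw [top_inf_eq] at this
    rcases hS.simple _ this with h | h
    · exact LinearMap.ker_eq_bot.1 h
    · exfalso; apply hx
      have : x ∈ LinearMap.ker g := by rw [h]; trivial
      exact this
  obtain ⟨u, hu⟩ := exists_u (hq.adm hla hmu) hg
  have hui := u_inj hla hmu hS.good hq hg hu hinj
  have huf := IsU.fil (hq.adm hla hmu) hg hu
  have hA := atom_tau hla hmu hS
  obtain ⟨hc, hcl, -⟩ := inj_class hla hmu hA.good hq.rot huf hA.good.top (by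
    rw [LinearMap.ker_eq_bot.2 hui, inf_bot_eq])
  rw [Submodule.map_top] at hc hcl
  have := hA.nt
  have hrne : LinearMap.range u ≠ ⊥ := by
    intro h
    obtain ⟨z, hz⟩ := exists_ne (0 : (D.sub S).TV)
    apply hz
    apply hui
    have : u z ∈ LinearMap.range u := ⟨z, rfl⟩
    rw [h, Submodule.mem_bot] at this
    simp [this]
  rw [L_rot] at hc
  have hle := hH.le _ hc hrne
  have hHr : (D.quot S).rot.L la mu H = 0 := by rw [L_rot, hH.crit]
  have hkc := (ker_crit hla hmu hA.good.le (hq.rot.quot hla hHr).le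
    (g := H.mkQ ∘ₗ u) (fun s j x hx => ⟨u x, huf s j x hx, rfl⟩) hA.good.top).1
  rw [top_inf_eq] at hkc
  have hrH : LinearMap.range u = H := by
    apply le_antisymm _ hle
    rcases hA.simple _ hkc with h | h
    · exfalso
      obtain ⟨y, hy, hy0⟩ := Submodule.exists_mem_ne_zero_of_ne_bot hH.ne
      obtain ⟨z, rfl⟩ := hle hy
      apply hy0
      have : z ∈ LinearMap.ker (H.mkQ ∘ₗ u) := (Submodule.Quotient.mk_eq_zero H).2 hy
      rw [h, Submodule.mem_bot] at this
      rw [this, map_zero]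
    · rintro _ ⟨z, rfl⟩
      have : z ∈ LinearMap.ker (H.mkQ ∘ₗ u) := by rw [h]; trivial
      exact (Submodule.Quotient.mk_eq_zero H).1 this
  rw [hrH, cS_rot] at hcl
  change _ = (D.sub S).tau.cl at hcl
  rw [hS.good.cl_tau hla hmu, cl_sub, ← tauC_tauC] at hcl
  exact (tauC_inj hcl).symm

end Tri
end St6

set_option linter.unusedSectionVars false
set_option linter.unusedVariables false
namespace St6
open Module Submodule

variable {k : Type u} [Field k] {V : Type u} [AddCommGroup V] [Module k V] [FiniteDimensional k V]
  {V' : Type u} [AddCommGroup V'] [Module k V'] [FiniteDimensional k V']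

theorem mkQ_zero {S : Submodule k V} {x : V} (hx : x ∈ S) : S.mkQ x = 0 := (Submodule.Quotient.mk_eq_zero S).2 hx
theorem mem_of_mkQ {S : Submodule k V} {x : V} (hx : S.mkQ x = 0) : x ∈ S := (Submodule.Quotient.mk_eq_zero S).1 hx
theorem mem_of_mkQ_eq {S : Submodule k V} {x y : V} (hx : S.mkQ x = S.mkQ y) : x - y ∈ S :=
  (Submodule.Quotient.eq S).1 hx
theorem le_comap_mkQ' (S : Submodule k V) (B : Submodule k (V ⧸ S)) : S ≤ B.comap S.mkQ := fun x hx => by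
  rw [Submodule.mem_comap, mkQ_zero hx]; exact zero_mem _
theorem comap_mkQ_inj {S : Submodule k V} {A B : Submodule k (V ⧸ S)} (h : A.comap S.mkQ = B.comap S.mkQ) : A = B :=
  Submodule.comap_injective_of_surjective S.mkQ_surjective h

namespace Tri
variable {la mu : ℤ}

theorem Pc_le (hla : 1 ≤ la) (hmu : 0 ≤ mu) {D : Tri k V} (h : D.Good la mu) {A B : Submodule k V}
    (hA : D.L la mu A = 0) (hB : D.L la mu B = 0) (hAB : A ≤ B) : Pc (D.cS A) ≤ Pc (D.cS B) := by
  have hq := h.quot hla hA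
  have e : (B.map A.mkQ).comap A.mkQ = B := by
    rw [Submodule.comap_map_mkQ]; exact sup_eq_right.2 hAB
  have hc : (D.quot A).L la mu (B.map A.mkQ) = 0 := by rw [L_quot, e, hA, hB, sub_zero]
  have h1 := hq.Pc_ge hla hmu hc
  rw [cS_quot, e, Pc_sub] at h1
  have := d_nonneg (B.map A.mkQ)
  omega

theorem Spl.symm {D : Tri k V} {A B : Submodule k V} (h : D.Spl A B) : D.Spl B A :=
  ⟨h.1.symm, fun s j => by rw [sup_comm]; exact h.2 s j⟩

theorem Spl.cl {D : Tri k V} {A B : Submodule k V} (h : D.Spl A B) : D.cS A + D.cS B = D.cl := by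
  have key : ∀ F : Submodule k V, F ≤ (F ⊓ A) ⊔ (F ⊓ B) → d (F ⊓ A) + d (F ⊓ B) = d F := by
    intro F hF
    have e1 : (F ⊓ A) ⊔ (F ⊓ B) = F := le_antisymm (sup_le inf_le_left inf_le_left) hF
    have e2 : (F ⊓ A) ⊓ (F ⊓ B) = ⊥ := by
      rw [eq_bot_iff, ← h.1.inf_eq_bot]
      exact inf_le_inf inf_le_right inf_le_right
    have := d_sup_inf (F ⊓ A) (F ⊓ B)
    rw [e1, e2, d_bot] at this
    omega
  refine Prod.ext ?_ ?_
  · have := key ⊤ (by rw [top_inf_eq, top_inf_eq, h.1.sup_eq_top])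
    simpa [cS, Tri.cl] using this
  · funext s j
    have := key _ (h.2 s j)
    simpa [cS, Tri.cl] using this

theorem Spl.crit {D : Tri k V} (hD : D.Good la mu) {A B : Submodule k V} (h : D.Spl A B) :
    D.L la mu A = 0 ∧ D.L la mu B = 0 := by
  have h1 := hD.le A; have h2 := hD.le B
  have h3 := hD.top
  rw [L_eq] at h1 h2 h3
  rw [L_eq, L_eq]
  change Lc la mu D.cl = 0 at h3
  rw [← h.cl, Lc_add] at h3
  constructor <;> omega

theorem spl_trans {D : Tri k V} {A B : Submodule k V} (h : D.Spl A B) {P R : Submodule k A}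
    (h' : (D.sub A).Spl P R) : D.Spl (P.map A.subtype) (R.map A.subtype ⊔ B) := by
  have hd : ∀ a ∈ A, ∀ b ∈ B, a = b → a = 0 := fun a ha b hb e => by
    have : a ∈ A ⊓ B := ⟨ha, e ▸ hb⟩
    rw [h.1.inf_eq_bot] at this; simpa using this
  refine ⟨⟨?_, ?_⟩, fun s j v hv => ?_⟩
  · rw [Submodule.disjoint_def]
    rintro _ ⟨p, hp, rfl⟩ hx
    obtain ⟨_, ⟨r, hr, rfl⟩, b, hb, e⟩ := Submodule.mem_sup.1 hx
    simp only [Submodule.subtype_apply] at *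
    have h1 : (p : V) - r = b := by rw [← e]; abel
    have h2 := hd _ (sub_mem p.2 r.2) b hb h1
    have h3 : p = r := by apply Subtype.ext; exact sub_eq_zero.1 h2
    have : p ∈ P ⊓ R := ⟨hp, h3 ▸ hr⟩
    rw [h'.1.inf_eq_bot, Submodule.mem_bot] at this
    rw [this]; rfl
  · rw [codisjoint_iff, eq_top_iff]
    intro v _
    have hv : v ∈ A ⊔ B := by rw [h.1.sup_eq_top]; trivial
    obtain ⟨a, ha, b, hb, rfl⟩ := Submodule.mem_sup.1 hv
    have ha' : (⟨a, ha⟩ : A) ∈ P ⊔ R := by rw [h'.1.sup_eq_top]; trivial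
    obtain ⟨p, hp, r, hr, e⟩ := Submodule.mem_sup.1 ha'
    have e' : (p : V) + r = a := congrArg Subtype.val e
    rw [← e', add_assoc]
    exact Submodule.add_mem_sup ⟨p, hp, rfl⟩ (Submodule.add_mem_sup ⟨r, hr, rfl⟩ hb)
  · obtain ⟨a, ha, b, hb, rfl⟩ := Submodule.mem_sup.1 (h.2 s j hv)
    obtain ⟨p, hp, r, hr, e⟩ := Submodule.mem_sup.1 (h'.2 s j (show (⟨a, ha.2⟩ : A) ∈ _ from ha.1))
    have e' : (p : V) + r = a := congrArg Subtype.val e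
    rw [← e', add_assoc]
    exact Submodule.add_mem_sup ⟨hp.1, ⟨p, hp.2, rfl⟩⟩ ⟨add_mem hr.1 hb.1,
      Submodule.add_mem_sup ⟨r, hr.2, rfl⟩ hb.2⟩

theorem spl_lift {D : Tri k V} {S : Submodule k V} {A B : Submodule k (V ⧸ S)} (h : (D.quot S).Spl A B)
    {C : Submodule k (A.comap S.mkQ)}
    (h' : (D.sub (A.comap S.mkQ)).Spl (S.comap (A.comap S.mkQ).subtype) C) :
    D.Spl (C.map (A.comap S.mkQ).subtype) (B.comap S.mkQ) := by
  refine ⟨⟨?_, ?_⟩, fun s j v hv => ?_⟩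
  · rw [Submodule.disjoint_def]
    rintro _ ⟨c, hc, rfl⟩ hx
    simp only [Submodule.subtype_apply] at *
    have h1 : S.mkQ c.1 ∈ A ⊓ B := ⟨c.2, hx⟩
    rw [h.1.inf_eq_bot, Submodule.mem_bot] at h1
    have h2 : c ∈ S.comap (A.comap S.mkQ).subtype ⊓ C := ⟨(mem_of_mkQ h1 : (c : V) ∈ S), hc⟩
    rw [h'.1.inf_eq_bot, Submodule.mem_bot] at h2
    rw [h2]; rfl
  · rw [codisjoint_iff, eq_top_iff]
    intro v _
    have hv : S.mkQ v ∈ A ⊔ B := by rw [h.1.sup_eq_top]; trivial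
    obtain ⟨a, ha, b, hb, e⟩ := Submodule.mem_sup.1 hv
    obtain ⟨x, rfl⟩ := S.mkQ_surjective a
    have ha' : (⟨x, ha⟩ : A.comap S.mkQ) ∈ S.comap (A.comap S.mkQ).subtype ⊔ C := by
      rw [h'.1.sup_eq_top]; trivial
    obtain ⟨p, hp, r, hr, e'⟩ := Submodule.mem_sup.1 ha'
    have e' : (p : V) + r = x := congrArg Subtype.val e'
    have : v = r + (v - r) := by abel
    rw [this]
    refine Submodule.add_mem_sup ⟨r, hr, rfl⟩ ?_
    rw [Submodule.mem_comap, map_sub, ← e, ← e', map_add, mkQ_zero (x := (p : V)) hp]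
    simpa using hb
  · obtain ⟨a, ⟨⟨x, hx, rfl⟩, ha⟩, b, ⟨hb, hb'⟩, e⟩ := Submodule.mem_sup.1 (h.2 s j ⟨v, hv, rfl⟩)
    obtain ⟨p, hp, r, hr, e'⟩ := Submodule.mem_sup.1 (h'.2 s j (show (⟨x, ha⟩ : A.comap S.mkQ) ∈ _ from hx))
    have e' : (p : V) + r = x := congrArg Subtype.val e'
    have : v = r + (v - r) := by abel
    rw [this]
    refine Submodule.add_mem_sup ⟨hr.1, ⟨r, hr.2, rfl⟩⟩ ⟨sub_mem hv hr.1, ?_⟩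
    rw [SetLike.mem_coe, Submodule.mem_comap, map_sub, ← e, ← e', map_add, mkQ_zero (x := (p : V)) hp.2]
    simpa using hb'

theorem atom_of_min {D : Tri k V} (hD : D.Good la mu) {S : Submodule k V} (hS : D.L la mu S = 0) (hne : S ≠ ⊥)
    (hm : ∀ W, D.L la mu W = 0 → W ≤ S → W = ⊥ ∨ W = S) : (D.sub S).Atom la mu := by
  refine ⟨hD.sub hS, Submodule.nontrivial_iff_ne_bot.2 hne, fun W hW => ?_⟩
  rw [L_sub] at hW
  rcases hm _ hW (Submodule.map_subtype_le S W) with h | h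
  · left
    rw [← Submodule.comap_map_eq_of_injective S.injective_subtype W, h, Submodule.comap_bot, Submodule.ker_subtype]
  · right
    rw [← Submodule.comap_map_eq_of_injective S.injective_subtype W, h, Submodule.comap_subtype_self]

theorem comap_map_sub {S A : Submodule k V} (h : A ≤ S) : (A.comap S.subtype).map S.subtype = A := by
  rw [Submodule.map_comap_subtype]; exact inf_eq_right.2 h

theorem Mono.out {D : Tri k V} {A : Submodule k V} {T : Submodule k A} (h : (D.sub A).Mono la mu T) :
    T.map A.subtype ≠ ⊥ ∧ D.L la mu (T.map A.subtype) = 0 ∧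
    ∀ W, D.L la mu W = 0 → W ≤ A → W ≠ ⊥ → T.map A.subtype ≤ W := by
  refine ⟨fun e => h.ne ?_, by rw [← L_sub]; exact h.crit, fun W hW hle hne => ?_⟩
  · rw [← Submodule.comap_map_eq_of_injective A.injective_subtype T, e, Submodule.comap_bot, Submodule.ker_subtype]
  · rw [← comap_map_sub hle]
    apply Submodule.map_mono
    apply h.le
    · rw [L_sub, comap_map_sub hle, hW]
    · intro e; apply hne; rw [← comap_map_sub hle, e, Submodule.map_bot]

def Indec (D : Tri k V) : Prop := Nontrivial V ∧ ∀ A B, D.Spl A B → A = ⊥ ∨ B = ⊥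

/-- `S` is essential in a lift of an indecomposable summand -/
theorem ess_lift (hla : 1 ≤ la) (hmu : 0 ≤ mu) {D : Tri k V} (hD : D.Good la mu) {S : Submodule k V}
    (hS : D.L la mu S = 0) (hne : S ≠ ⊥) (hm : ∀ W, D.L la mu W = 0 → W ≤ S → W = ⊥ ∨ W = S)
    {A T : Submodule k (V ⧸ S)} (hA : (D.quot S).L la mu A = 0)
    (hT : (D.quot S).L la mu T = 0) (hTA : T ≤ A) (hTne : T ≠ ⊥)
    (hTm : ∀ W, (D.quot S).L la mu W = 0 → W ≤ A → W ≠ ⊥ → T ≤ W)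
    (hns : ∀ C, ¬ (D.sub (A.comap S.mkQ)).Spl (S.comap (A.comap S.mkQ).subtype) C) :
    ∀ W, D.L la mu W = 0 → W ≤ A.comap S.mkQ → W ≠ ⊥ → S ≤ W := by
  set E := A.comap S.mkQ with hE
  have hSE : S ≤ E := le_comap_mkQ' S A
  have hEc : D.L la mu E = 0 := by rw [L_quot, hS, sub_zero] at hA; exact hA
  have hDE := hD.sub hEc
  have hTc : D.L la mu (T.comap S.mkQ) = 0 := by rw [L_quot, hS, sub_zero] at hT; exact hT
  have hTE : T.comap S.mkQ ≤ E := Submodule.comap_mono hTA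
  have hScr : (D.sub E).L la mu (S.comap E.subtype) = 0 := by rw [L_sub, comap_map_sub hSE, hS]
  have hatom : ((D.sub E).sub (S.comap E.subtype)).Atom la mu := by
    apply atom_of_min hDE hScr
    · intro e; apply hne; rw [← comap_map_sub hSE, e, Submodule.map_bot]
    · intro W hW hWS
      rw [L_sub] at hW
      have := hm _ hW (by rw [Submodule.map_le_iff_le_comap]; exact hWS)
      rcases this with h | h
      · left
        rw [← Submodule.comap_map_eq_of_injective E.injective_subtype W, h, Submodule.comap_bot, Submodule.ker_subtype]
      · right
        rw [← Submodule.comap_map_eq_of_injective E.injective_subtype W, h]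
  have hmono := mono_ext hla hmu hDE (S := S.comap E.subtype) (H0 := (T.comap S.mkQ).comap E.subtype) hatom hScr
    (by rw [L_sub, comap_map_sub hTE, hTc])
    (by
      refine lt_of_le_of_ne (Submodule.comap_mono (le_comap_mkQ' S T)) fun e => hTne ?_
      have := congrArg (Submodule.map E.subtype) e
      rw [comap_map_sub hSE, comap_map_sub hTE] at this
      apply comap_mkQ_inj
      rw [← this, Submodule.comap_bot, Submodule.ker_mkQ])
    (by
      intro W hW hlt
      rw [L_sub] at hW
      have hlt1 : S ≤ W.map E.subtype := by
        rw [← comap_map_sub hSE]; exact Submodule.map_mono hlt.le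
      have e2 : ((W.map E.subtype).map S.mkQ).comap S.mkQ = W.map E.subtype := by
        rw [Submodule.comap_map_mkQ]; exact sup_eq_right.2 hlt1
      have hle : T ≤ (W.map E.subtype).map S.mkQ := by
        apply hTm
        · rw [L_quot, e2, hW, hS, sub_zero]
        · rw [Submodule.map_le_iff_le_comap]; exact Submodule.map_subtype_le E W
        · intro e
          apply hlt.ne
          rw [e, Submodule.comap_bot, Submodule.ker_mkQ] at e2
          rw [e2]
          exact Submodule.comap_map_eq_of_injective E.injective_subtype W
      have : T.comap S.mkQ ≤ W.map E.subtype := by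
        rw [← e2]; exact Submodule.comap_mono hle
      rw [← Submodule.comap_map_eq_of_injective E.injective_subtype W]
      exact Submodule.comap_mono this)
    hns
  have := hmono.out
  rw [comap_map_sub hSE] at this
  exact this.2.2

end Tri
end St6

set_option linter.unusedSectionVars false
set_option linter.unusedVariables false
namespace St6
open Module Submodule

variable {k : Type u} [Field k] {V : Type u} [AddCommGroup V] [Module k V] [FiniteDimensional k V]
  {V' : Type u} [AddCommGroup V'] [Module k V'] [FiniteDimensional k V']

namespace Tri
variable {la mu : ℤ}

/-- `t` is the class of an atom -/
def IsAtomCl (k : Type u) [Field k] (la mu : ℤ) (t : Cl) : Prop :=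
  ∃ (W : Type u) (_ : AddCommGroup W) (_ : Module k W) (_ : FiniteDimensional k W) (S : Tri k W),
    S.Atom la mu ∧ S.cl = t

theorem exists_min_crit {D : Tri k V} (hne : ∃ W, D.L la mu W = 0 ∧ W ≠ ⊥) :
    ∃ S, D.L la mu S = 0 ∧ S ≠ ⊥ ∧ (∀ W, D.L la mu W = 0 → W ≤ S → W = ⊥ ∨ W = S) := by
  obtain ⟨S, ⟨hS, hS'⟩, hmax⟩ := exists_max (fun W => D.L la mu W = 0 ∧ W ≠ ⊥) (fun W => - d W) 0
    (fun W _ => by have := d_nonneg W; omega) hne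
  refine ⟨S, hS, hS', fun W hW hle => ?_⟩
  by_cases h : W = ⊥
  · exact Or.inl h
  · right
    apply eq_of_le_of_d hle
    have := hmax W ⟨hW, h⟩
    omega

theorem quot_indec (hla : 1 ≤ la) (hmu : 0 ≤ mu) {D : Tri k V} (hD : D.Good la mu) (hI : D.Indec)
    {S : Submodule k V}
    (hS : D.L la mu S = 0) (hne : S ≠ ⊥) (hm : ∀ W, D.L la mu W = 0 → W ≤ S → W = ⊥ ∨ W = S)
    (hnt : S ≠ ⊤)
    (IH : ∀ A : Submodule k (V ⧸ S), ((D.quot S).sub A).Indec → ((D.quot S).sub A).Good la mu →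
      ∃ T, ((D.quot S).sub A).Mono la mu T) : (D.quot S).Indec := by
  have hq := hD.quot hla hS
  refine ⟨Submodule.Quotient.nontrivial_iff.2 hnt, ?_⟩
  by_contra hcon
  push Not at hcon
  obtain ⟨A0, B0, h0, hA0, hB0⟩ := hcon
  obtain ⟨B, ⟨hBne, A, hA, hAne⟩, hBmin⟩ := exists_max
    (fun B : Submodule k (V ⧸ S) => B ≠ ⊥ ∧ ∃ A, (D.quot S).Spl A B ∧ A ≠ ⊥) (fun B => - Pc ((D.quot S).cS B)) 0
    (fun B hB => by
      obtain ⟨h1, A, h2, h3⟩ := hB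
      have := hq.Pc_pos hla hmu (h2.crit hq).2 h1
      omega) ⟨B0, hB0, A0, h0, hA0⟩
  obtain ⟨A1, ⟨hA1ne, hA1le, A1c, hA1⟩, hA1min⟩ := exists_max
    (fun A1 : Submodule k (V ⧸ S) => A1 ≠ ⊥ ∧ A1 ≤ A ∧ ∃ C, (D.quot S).Spl A1 C) (fun A1 => - d A1) 0
    (fun A1 _ => by have := d_nonneg A1; omega) ⟨A, hAne, le_rfl, B, hA⟩
  have hA1cr := (hA1.crit hq).1
  have hA1cne : A1c ≠ ⊥ := by
    intro e
    have h1 := hA1.1.sup_eq_top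
    rw [e, sup_bot_eq] at h1
    rw [h1, top_le_iff] at hA1le
    have h2 := hA.1.inf_eq_bot
    rw [hA1le, top_inf_eq] at h2
    exact hBne h2
  have hPA1 : Pc ((D.quot S).cS B) ≤ Pc ((D.quot S).cS A1) := by
    have := hBmin A1 ⟨hA1ne, A1c, hA1.symm, hA1cne⟩
    omega
  have hA1ind : ((D.quot S).sub A1).Indec := by
    refine ⟨Submodule.nontrivial_iff_ne_bot.2 hA1ne, fun P R hPR => ?_⟩
    by_contra hc
    push Not at hc
    have h1 := hA1min (P.map A1.subtype) ⟨fun e => hc.1 ?_, le_trans (Submodule.map_subtype_le _ _) hA1le,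
      _, spl_trans hA1 hPR⟩
    · rw [d_map_subtype] at h1
      have h2 := d_pos hc.2
      have h3 := d_sup_inf P R
      rw [hPR.1.sup_eq_top, hPR.1.inf_eq_bot, d_top, d_bot] at h3
      have h4 : (finrank k A1 : ℤ) = d A1 := rfl
      omega
    · rw [← Submodule.comap_map_eq_of_injective A1.injective_subtype P, e, Submodule.comap_bot,
        Submodule.ker_subtype]
  obtain ⟨T, hT⟩ := IH A1 hA1ind (hq.sub hA1cr)
  obtain ⟨hT1, hT2, hT3⟩ := hT.out
  have hSle : ∀ B : Submodule k (V ⧸ S), B.comap S.mkQ ≠ ⊥ := fun B e => hne (by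
    rw [eq_bot_iff, ← e]; exact le_comap_mkQ' S B)
  have hns : ∀ C, ¬ (D.sub (A1.comap S.mkQ)).Spl (S.comap (A1.comap S.mkQ).subtype) C := by
    intro C hC
    rcases hI.2 _ _ (spl_lift hA1 hC) with h | h
    · have hC0 : C = ⊥ := by
        rw [← Submodule.comap_map_eq_of_injective (A1.comap S.mkQ).injective_subtype C, h, Submodule.comap_bot,
          Submodule.ker_subtype]
      have h1 := hC.1.sup_eq_top
      rw [hC0, sup_bot_eq] at h1
      have h2 := congrArg (Submodule.map (A1.comap S.mkQ).subtype) h1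
      rw [comap_map_sub (le_comap_mkQ' S A1), Submodule.map_top, Submodule.range_subtype] at h2
      apply hA1ne
      apply comap_mkQ_inj
      rw [← h2, Submodule.comap_bot, Submodule.ker_mkQ]
    · exact hSle _ h
  have hess := ess_lift hla hmu hD hS hne hm hA1cr hT2 (Submodule.map_subtype_le _ _) hT1 hT3 hns
  have hE1c : D.L la mu (A1.comap S.mkQ) = 0 := by rw [L_quot, hS, sub_zero] at hA1cr; exact hA1cr
  have hAc := (hA.crit hq).1
  rw [L_quot, hS, sub_zero] at hAc
  have hXq := hD.quot hla hAc
  set X := A.comap S.mkQ with hX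
  have hE1X : A1.comap S.mkQ ≤ X := Submodule.comap_mono hA1le
  have hkill : ∀ g, Fil (D.sub X) (D.quot X).tau g → ∀ x : X, x.1 ∈ S → g x = 0 := by
    intro g hg x hx
    have hkc := (ker_crit hla hmu (hD.sub hAc).le (hXq.tau hla hmu).le hg (hD.sub hAc).top).1
    rw [top_inf_eq, L_sub] at hkc
    by_cases hb : (LinearMap.ker g).map X.subtype ⊓ A1.comap S.mkQ = ⊥
    · exfalso
      have hcr : (D.sub X).L la mu ((A1.comap S.mkQ).comap X.subtype) = 0 := by
        rw [L_sub, comap_map_sub hE1X, hE1c]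
      obtain ⟨h1, h2, -⟩ := inj_class hla hmu (hD.sub hAc) (hXq.tau hla hmu) hg hcr (by
        rw [eq_bot_iff]
        rintro y ⟨hy1, hy2⟩
        have : (y : V) ∈ (LinearMap.ker g).map X.subtype ⊓ A1.comap S.mkQ := ⟨⟨y, hy2, rfl⟩, hy1⟩
        rw [hb, Submodule.mem_bot] at this
        exact (Submodule.mem_bot k).2 (Subtype.ext this))
      have h3 := Pc_le hla hmu (hXq.tau hla hmu) h1 (hXq.tau hla hmu).top le_top
      rw [h2, cS_sub, comap_map_sub hE1X] at h3
      change _ ≤ Pc (D.quot X).tau.cl at h3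
      rw [hXq.cl_tau hla hmu, Pc_tauC, cl_quot, Pc_sub] at h3
      have h4 := cS_quot D S A1
      have h5 := cS_quot D S A
      have h6 := cl_quot D S
      have h7 := hA.cl
      have h8 := hq.Pc_pos hla hmu (hA.crit hq).2 hBne
      have h9 := hD.Pc_pos hla hmu hS hne
      rw [← hX] at h5
      have q4 := congrArg Pc h4
      have q5 := congrArg Pc h5
      have q6 := congrArg Pc h6
      have q7 := congrArg Pc h7
      rw [Pc_sub] at q4 q5 q6
      rw [Pc_add] at q7
      omega
    · have hs := hess _ (hD.crit_sup_inf hla hmu hkc hE1c).2 inf_le_right hb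
      obtain ⟨y, hy, e⟩ := (hs hx).1
      have : y = x := Subtype.ext e
      rw [← this]; exact hy
  obtain ⟨C, hC1, hC2⟩ := split_star D X (B.comap S.mkQ) ⊥ (by
      rw [eq_top_iff]
      intro v _
      have hv : S.mkQ v ∈ A ⊔ B := by rw [hA.1.sup_eq_top]; trivial
      obtain ⟨a, ha, b, hb, e⟩ := Submodule.mem_sup.1 hv
      obtain ⟨x, rfl⟩ := S.mkQ_surjective a
      have : v = (v - x) + x := by abel
      rw [this]
      refine Submodule.add_mem_sup ?_ ha
      rw [Submodule.mem_comap, map_sub, ← e, add_sub_cancel_left]; exact hb) (by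
      intro s j v hv
      obtain ⟨a, ⟨⟨x, hx, rfl⟩, ha⟩, b, ⟨hb, hb'⟩, e⟩ := Submodule.mem_sup.1 (hA.2 s j ⟨v, hv, rfl⟩)
      have : v = (v - x) + x := by abel
      rw [this]
      refine Submodule.add_mem_sup ⟨sub_mem hv hx, ?_⟩ ⟨hx, ha⟩
      rw [SetLike.mem_coe, Submodule.mem_comap, map_sub, ← e, add_sub_cancel_left]; exact hb')
    bot_le (bot_inf_eq _) (fun s j y hy hyF => by
      rw [(Submodule.mem_bot k).1 hy]; exact zero_mem _) (by
        apply Good.adm hla hmu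
        apply hXq.quot hla
        rw [Submodule.map_bot, L_bot]) (fun g hg x hx => by
          rw [hkill g hg x, map_zero]
          apply mem_of_mkQ
          have : S.mkQ x.1 ∈ A ⊓ B := ⟨x.2, hx⟩
          rw [hA.1.inf_eq_bot, Submodule.mem_bot] at this
          exact this)
  rcases hI.2 _ _ ⟨hC1, hC2⟩ with h | h
  · exact hSle _ h
  · have h1 := hC1.sup_eq_top
    rw [h, sup_bot_eq] at h1
    have h2 : A = ⊤ := by apply comap_mkQ_inj; rw [← hX, h1, Submodule.comap_top]
    have h3 := hA.1.inf_eq_bot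
    rw [h2, top_inf_eq] at h3
    exact hBne h3

theorem uniserial (hla : 1 ≤ la) (hmu : 0 ≤ mu) (N : ℕ) : ∀ (V : Type u) [AddCommGroup V] [Module k V]
    [FiniteDimensional k V] (D : Tri k V), finrank k V ≤ N → D.Good la mu → D.Indec →
    ∃ (S : Submodule k V) (n : ℕ) (t : Cl), D.Mono la mu S ∧ IsAtomCl k la mu t ∧
      D.cl = ∑ i ∈ Finset.range (n+1), tauC^[i] t ∧ D.cS S = tauC^[n] t := by
  induction N with
  | zero =>
    intro V _ _ _ D hN hD hI
    have := hI.1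
    have := finrank_pos (R := k) (M := V)
    omega
  | succ N ih =>
    intro V _ _ _ D hN hD hI
    have hnt := hI.1
    obtain ⟨S, hS, hne, hm⟩ := exists_min_crit (D := D) ⟨⊤, hD.top, top_ne_bot⟩
    have hatom := atom_of_min hD hS hne hm
    by_cases hST : S = ⊤
    · refine ⟨S, 0, D.cl, ⟨hne, hS, fun W hW hWne => ?_⟩, ⟨_, _, _, inferInstance, D.sub S, hatom, ?_⟩, ?_, ?_⟩
      · rcases hm W hW (hST ▸ le_top) with h | h
        · exact absurd h hWne
        · exact h.ge
      · rw [cl_sub, hST]; rfl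
      · simp
      · rw [hST]; rfl
    have hlt : finrank k (V ⧸ S) < finrank k V := by
      have h1 := finrank_quot S
      have h2 := d_pos hne
      omega
    have hqi := quot_indec hla hmu hD hI hS hne hm hST (fun A hAi hAg => by
      have : finrank k A ≤ finrank k (V ⧸ S) := Submodule.finrank_le A
      obtain ⟨T, n, t, hT, -⟩ := ih A ((D.quot S).sub A) (by omega) hAg hAi
      exact ⟨T, hT⟩)
    obtain ⟨H, n, t, hH, ht, hcl, hcS⟩ := ih (V ⧸ S) (D.quot S) (by omega) (hD.quot hla hS) hqi
    have hns : ∀ C, ¬ D.Spl S C := by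
      intro C hC
      rcases hI.2 _ _ hC with h | h
      · exact hne h
      · have := hC.1.sup_eq_top
        rw [h, sup_bot_eq] at this
        exact hST this
    have hHc := hH.crit
    rw [L_quot, hS, sub_zero] at hHc
    have hmono : D.Mono la mu S := by
      refine mono_ext hla hmu hD hatom hS hHc ?_ ?_ hns
      · refine lt_of_le_of_ne (le_comap_mkQ' S H) fun e => hH.ne ?_
        apply comap_mkQ_inj
        rw [← e, Submodule.comap_bot, Submodule.ker_mkQ]
      · intro W hW hlt
        have e : (W.map S.mkQ).comap S.mkQ = W := by
          rw [Submodule.comap_map_mkQ]; exact sup_eq_right.2 hlt.le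
        rw [← e]
        apply Submodule.comap_mono
        apply hH.le
        · rw [L_quot, e, hW, hS, sub_zero]
        · intro e'
          rw [e', Submodule.comap_bot, Submodule.ker_mkQ] at e
          exact hlt.ne e
    have hc := class_step hla hmu hD hatom hS hns hH
    refine ⟨S, n+1, t, hmono, ht, ?_, ?_⟩
    · rw [Finset.sum_range_succ, ← hcl, Function.iterate_succ_apply', ← hcS, ← hc, cl_quot, sub_add_cancel]
    · rw [hc, hcS, Function.iterate_succ_apply']

end Tri
end St6

set_option linter.unusedSectionVars false
set_option linter.unusedVariables false
namespace St6
open Module Submodule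

/-- Euler form -/
def chi (x y : Cl) : ℤ :=
  ∑ j, (x.2 0 j * y.2 0 j + (x.2 1 j - x.2 0 j) * y.2 1 j + (x.2 2 j - x.2 1 j) * y.2 2 j + (x.1 - x.2 2 j) * y.1)
   - 2 * x.1 * y.1 + ∑ j, x.2 0 j * (y.1 - y.2 2 (j+1))

def fC (x : Cl) : ℤ := ∑ s, (x.2 s 0 + x.2 s 2 - 2 * x.2 s 1)

theorem chi_tau (x y : Cl) : chi x (tauC y) = - chi y x := by
  simp [chi, tauC, Pc, Fin.sum_univ_three]; ring

theorem chi_add_left (x y z : Cl) : chi (x + y) z = chi x z + chi y z := by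
  simp [chi, Fin.sum_univ_three]; ring
theorem chi_add_right (x y z : Cl) : chi x (y + z) = chi x y + chi x z := by
  simp [chi, Fin.sum_univ_three]; ring
theorem chi_tau_tau (x y : Cl) : chi (tauC x) (tauC y) = chi x y := by
  rw [chi_tau, chi_tau, neg_neg]
theorem chi_smul (e : ℤ) (x y : Cl) (hx : x.1 = e * y.1) (hs : ∀ s j, x.2 s j = e * y.2 s j) :
    chi x x = e * e * chi y y := by
  simp only [chi, hx, hs, Fin.sum_univ_three]; ring

theorem fC_add (x y : Cl) : fC (x + y) = fC x + fC y := by simp [fC, Fin.sum_univ_three]; ring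
theorem fC_rot (x : Cl) : fC x + fC (rotC x) + fC (rotC (rotC x)) = 0 := by
  simp [fC, rotC, Fin.sum_univ_three]; ring

theorem abs_le_sq' (a : ℤ) : |a| ≤ a ^ 2 := by
  rw [← sq_abs]
  have := abs_nonneg a
  nlinarith [sq_nonneg (|a| - 1), Int.le_self_sq |a|]

theorem root9 (y : Fin 9 → ℤ) (v : ℤ) (h1 : ∑ i, y i = 3 * v) (h2 : ∑ i, y i ^ 2 - v ^ 2 ≤ 2)
    (a : Fin 9 → ℤ) (ha : a = ![3, -3, 0, 2, -1, -1, 1, 1, -2]) : |∑ i, a i * y i| ≤ 6 := by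
  have key : ∀ (w : ℤ) (x : Fin 9 → ℤ) (ε : ℤ), ε = 1 ∨ ε = -1 → (∀ i, y i = w + ε * x i) → ∑ i, x i = 3 →
      ∑ i, x i ^ 2 ≤ 3 → |∑ i, a i * y i| ≤ 6 := by
    intro w x ε hε hy hs hq
    have hx : ∀ i, 0 ≤ x i ^ 2 - x i := fun i => by
      have := Int.le_self_sq (x i); omega
    have hsum : ∑ i, (x i ^ 2 - x i) ≤ 0 := by rw [Finset.sum_sub_distrib]; omega
    have hz : ∀ i, x i = 0 ∨ x i = 1 := fun i => by
      have h3 := Finset.single_le_sum (f := fun i => x i ^ 2 - x i) (fun i _ => hx i) (Finset.mem_univ i)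
      have h4 : x i * (x i - 1) = 0 := by
        have := hx i
        have h3' : x i ^ 2 - x i ≤ ∑ i, (x i ^ 2 - x i) := h3
        nlinarith
      rcases mul_eq_zero.1 h4 with h | h
      · exact Or.inl h
      · right; omega
    have hb : ∀ i, 0 ≤ x i ∧ x i ≤ 1 := fun i => by rcases hz i with h | h <;> omega
    subst ha
    have b0 := hb 0; have b1 := hb 1; have b2 := hb 2; have b3 := hb 3; have b4 := hb 4
    have b5 := hb 5; have b6 := hb 6; have b7 := hb 7; have b8 := hb 8
    simp only [hy]
    rw [abs_le]
    simp [Fin.sum_univ_succ] at hs ⊢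
    rcases hε with rfl | rfl <;> constructor <;> omega
  obtain ⟨w, hw⟩ : ∃ w, v = 3 * w ∨ v = 3 * w + 1 ∨ v = 3 * w - 1 := ⟨(v + 1) / 3, by omega⟩
  rcases hw with hw | hw | hw
  · have hx : ∑ i, (y i - w) ^ 2 ≤ 2 := by
      have : ∑ i, (y i - w) ^ 2 = ∑ i, y i ^ 2 - 2 * w * ∑ i, y i + 9 * w ^ 2 := by
        simp [Fin.sum_univ_succ]; ring
      rw [this, h1, hw]; rw [hw] at h2; nlinarith
    have hx2 : ∑ i, |y i - w| ≤ 2 := le_trans (Finset.sum_le_sum fun i _ => abs_le_sq' _) hx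
    have e : ∑ i, a i * y i = ∑ i, a i * (y i - w) := by
      subst ha; simp [Fin.sum_univ_succ]; ring
    rw [e]
    calc |∑ i, a i * (y i - w)| ≤ ∑ i, |a i * (y i - w)| := Finset.abs_sum_le_sum_abs _ _
      _ ≤ ∑ i, 3 * |y i - w| := by
        apply Finset.sum_le_sum
        intro i _
        rw [abs_mul]
        apply mul_le_mul_of_nonneg_right _ (abs_nonneg _)
        subst ha; fin_cases i <;> simp
      _ ≤ 6 := by rw [← Finset.mul_sum]; omega
  · apply key w (fun i => y i - w) 1 (Or.inl rfl) (fun i => by ring)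
    · rw [Finset.sum_sub_distrib, h1, hw]; simp; ring
    · have : ∑ i, (y i - w) ^ 2 = ∑ i, y i ^ 2 - 2 * w * ∑ i, y i + 9 * w ^ 2 := by
        simp [Fin.sum_univ_succ]; ring
      rw [this, h1, hw]; rw [hw] at h2; nlinarith
  · apply key w (fun i => w - y i) (-1) (Or.inr rfl) (fun i => by ring)
    · rw [Finset.sum_sub_distrib, h1, hw]; simp; ring
    · have : ∑ i, (w - y i) ^ 2 = ∑ i, y i ^ 2 - 2 * w * ∑ i, y i + 9 * w ^ 2 := by
        simp [Fin.sum_univ_succ]; ring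
      rw [this, h1, hw]; rw [hw] at h2; nlinarith

theorem root_bound (x : Cl) (hq : chi x x ≤ 1) : |fC x| ≤ 6 := by
  have := root9 ![x.2 0 0 + (x.1 - x.2 2 1), x.2 0 1 + (x.1 - x.2 2 2), x.2 0 2 + (x.1 - x.2 2 0),
    x.2 1 0 - x.2 0 0, x.2 1 1 - x.2 0 1, x.2 1 2 - x.2 0 2,
    x.2 2 0 - x.2 1 0, x.2 2 1 - x.2 1 1, x.2 2 2 - x.2 1 2] x.1 (by simp [Fin.sum_univ_succ]; ring) (by
      have h : 2 * chi x x ≤ 2 := by omega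
      refine le_trans (le_of_eq ?_) h
      simp [chi, Fin.sum_univ_succ]
      ring) _ rfl
  convert this using 2
  simp [fC, Fin.sum_univ_succ]; ring

end St6

set_option linter.unusedSectionVars false
set_option linter.unusedVariables false
namespace St6
open Module Submodule

variable {k : Type u} [Field k] {V : Type u} [AddCommGroup V] [Module k V] [FiniteDimensional k V]
  {V' : Type u} [AddCommGroup V'] [Module k V'] [FiniteDimensional k V']

def CM (A : Submodule k V) (B : Submodule k V') : Submodule k (V →ₗ[k] V') where
  carrier := {g | ∀ x ∈ A, g x ∈ B}
  add_mem' := fun ha hb x hx => B.add_mem (ha x hx) (hb x hx)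
  zero_mem' := fun x _ => B.zero_mem
  smul_mem' := fun c g hg x hx => B.smul_mem c (hg x hx)

theorem mem_CM {A : Submodule k V} {B : Submodule k V'} {g : V →ₗ[k] V'} : g ∈ CM A B ↔ ∀ x ∈ A, g x ∈ B :=
  Iff.rfl

theorem CM_mono {A A' : Submodule k V} {B B' : Submodule k V'} (hA : A' ≤ A) (hB : B ≤ B') : CM A B ≤ CM A' B' :=
  fun _ hg x hx => hB (hg x (hA hx))

/-- restrict and project -/
def RP (A : Submodule k V) (B : Submodule k V') : (V →ₗ[k] V') →ₗ[k] (A →ₗ[k] V' ⧸ B) where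
  toFun g := B.mkQ ∘ₗ g ∘ₗ A.subtype
  map_add' g h := by ext x; simp
  map_smul' c g := by ext x; simp

theorem ker_RP (A : Submodule k V) (B : Submodule k V') : LinearMap.ker (RP A B) = CM A B := by
  ext g
  rw [LinearMap.mem_ker, mem_CM]
  constructor
  · intro h x hx
    have := LinearMap.congr_fun h ⟨x, hx⟩
    simpa [RP] using this
  · intro h
    ext x
    simpa [RP] using h x.1 x.2

theorem CM_step {A : Submodule k V} {B B' : Submodule k V'} {Q : Submodule k (V →ₗ[k] V')} (hQ : Q ≤ CM A B')
    (hB : B ≤ B') : d Q - d A * (d B' - d B) ≤ d (Q ⊓ CM A B) := by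
  have h1 := d_map (RP A B) Q
  rw [ker_RP] at h1
  have h2 : Q.map (RP A B) ≤ LinearMap.range (LinearMap.compRight (M := A) k (B'.map B.mkQ).subtype) := by
    rintro _ ⟨g, hg, rfl⟩
    refine ⟨LinearMap.codRestrict _ (RP A B g) fun x => ?_, ?_⟩
    · exact Submodule.mem_map_of_mem (hQ hg x.1 x.2)
    · ext x; rfl
  have h3 := d_mono h2
  have h4 : d (LinearMap.range (LinearMap.compRight (M := A) k (B'.map B.mkQ).subtype)) ≤
      d A * d (B'.map B.mkQ) := by
    have := LinearMap.finrank_range_le (LinearMap.compRight (M := A) k (B'.map B.mkQ).subtype)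
    rw [Module.finrank_linearMap] at this
    unfold d; exact_mod_cast this
  have h5 : d (B'.map B.mkQ) = d B' - d B := by
    rw [d_map, Submodule.ker_mkQ, inf_eq_right.2 hB]
  rw [h5] at h4
  linarith

theorem CM_pair {A A' : Submodule k V} (B B' : Submodule k V') (h : A ⊓ A' = ⊥) :
    d (CM A B ⊓ CM A' B') = finrank k V * finrank k V' - d A * (finrank k V' - d B) - d A' * (finrank k V' - d B') := by
  have hs : Function.Surjective ((RP A B).prod (RP A' B')) := by
    rintro ⟨p, q⟩
    obtain ⟨C, hC, hc⟩ := (disjoint_iff.2 h).symm.exists_isCompl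
    obtain ⟨s, hs⟩ := LinearMap.exists_rightInverse_of_surjective B.mkQ (B.range_mkQ)
    obtain ⟨s', hs'⟩ := LinearMap.exists_rightInverse_of_surjective B'.mkQ (B'.range_mkQ)
    obtain ⟨g, hg⟩ := LinearMap.exists_extend (s' ∘ₗ q)
    refine ⟨LinearMap.ofIsCompl hc.symm (s ∘ₗ p) (g ∘ₗ C.subtype), ?_⟩
    refine Prod.ext ?_ ?_
    · ext x
      have : LinearMap.ofIsCompl hc.symm (s ∘ₗ p) (g ∘ₗ C.subtype) x.1 = s (p x) := by
        rw [LinearMap.ofIsCompl_apply_left]; rfl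
      change B.mkQ (LinearMap.ofIsCompl hc.symm (s ∘ₗ p) (g ∘ₗ C.subtype) x.1) = p x
      rw [this]; exact LinearMap.congr_fun hs (p x)
    · ext x
      have : LinearMap.ofIsCompl hc.symm (s ∘ₗ p) (g ∘ₗ C.subtype) x.1 = s' (q x) := by
        rw [LinearMap.ofIsCompl_apply_right hc.symm (φ := s ∘ₗ p) (ψ := g ∘ₗ C.subtype) ⟨x.1, hC x.2⟩]
        exact LinearMap.congr_fun hg x
      change B'.mkQ (LinearMap.ofIsCompl hc.symm (s ∘ₗ p) (g ∘ₗ C.subtype) x.1) = q x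
      rw [this]; exact LinearMap.congr_fun hs' (q x)
  have e : LinearMap.ker ((RP A B).prod (RP A' B')) = CM A B ⊓ CM A' B' := by
    rw [LinearMap.ker_prod, ker_RP, ker_RP]
  have h1 := LinearMap.finrank_range_add_finrank_ker ((RP A B).prod (RP A' B'))
  rw [LinearMap.range_eq_top.2 hs, finrank_top, e, Module.finrank_prod, Module.finrank_linearMap,
    Module.finrank_linearMap, Module.finrank_linearMap] at h1
  have h2 := Submodule.finrank_quotient_add_finrank B
  have h3 := Submodule.finrank_quotient_add_finrank B'
  unfold d
  zify at h1 h2 h3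
  rw [← h1]
  rw [show (finrank k V' : ℤ) - finrank k B = finrank k (V' ⧸ B) by linarith,
    show (finrank k V' : ℤ) - finrank k B' = finrank k (V' ⧸ B') by linarith]
  ring


namespace Tri

def PJ (D : Tri k V) (D' : Tri k V') (j : Fin 3) : Submodule k (V →ₗ[k] V') :=
  CM (D.F 2 j) (D'.F 2 j) ⊓ CM (D.F 1 j) (D'.F 1 j) ⊓ CM (D.F 0 j) (D'.F 0 j)

def HF (D : Tri k V) (D' : Tri k V') : Submodule k (V →ₗ[k] V') := D.PJ D' 0 ⊓ D.PJ D' 1 ⊓ D.PJ D' 2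

theorem PJ_le (D : Tri k V) (D' : Tri k V') (s j : Fin 3) : D.PJ D' j ≤ CM (D.F s j) (D'.F s j) := by
  intro g hg
  obtain ⟨⟨h2, h1⟩, h0⟩ := hg
  fin_cases s
  exacts [h0, h1, h2]

theorem mem_HF {D : Tri k V} {D' : Tri k V'} {g : V →ₗ[k] V'} : g ∈ D.HF D' ↔ Fil D D' g := by
  constructor
  · rintro ⟨⟨h0, h1⟩, h2⟩ s j
    fin_cases j
    exacts [PJ_le D D' s _ h0, PJ_le D D' s _ h1, PJ_le D D' s _ h2]
  · intro h
    exact ⟨⟨⟨⟨h 2 0, h 1 0⟩, h 0 0⟩, ⟨h 2 1, h 1 1⟩, h 0 1⟩, ⟨h 2 2, h 1 2⟩, h 0 2⟩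

theorem d_PJ (D : Tri k V) (D' : Tri k V') (j : Fin 3) :
    (D.cl.2 0 j * D'.cl.2 0 j + (D.cl.2 1 j - D.cl.2 0 j) * D'.cl.2 1 j +
      (D.cl.2 2 j - D.cl.2 1 j) * D'.cl.2 2 j + (D.cl.1 - D.cl.2 2 j) * D'.cl.1) ≤ d (D.PJ D' j) := by
  have h1 := CM_step (A := D.F 2 j) (B := D'.F 2 j) (B' := ⊤) (Q := ⊤) (fun g _ x _ => mem_top) le_top
  have h2 := CM_step (A := D.F 1 j) (B := D'.F 1 j) (B' := D'.F 2 j) (Q := CM (D.F 2 j) (D'.F 2 j))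
    (CM_mono (D.h12 j) le_rfl) (D'.h12 j)
  have h3 := CM_step (A := D.F 0 j) (B := D'.F 0 j) (B' := D'.F 1 j)
    (Q := CM (D.F 2 j) (D'.F 2 j) ⊓ CM (D.F 1 j) (D'.F 1 j))
    (inf_le_right.trans (CM_mono (D.h01 j) le_rfl)) (D'.h01 j)
  rw [top_inf_eq, d_top, d_top, Module.finrank_linearMap] at h1
  simp only [cl_snd, cl_fst]
  change _ ≤ d (CM (D.F 2 j) (D'.F 2 j) ⊓ CM (D.F 1 j) (D'.F 1 j) ⊓ CM (D.F 0 j) (D'.F 0 j))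
  push_cast at h1
  linarith

theorem chi_le {D : Tri k V} {D' : Tri k V'} (h : D.Adm) : chi D.cl D'.cl ≤ d (D.HF D') := by
  have a0 := d_PJ D D' 0
  have a1 := d_PJ D D' 1
  have a2 := d_PJ D D' 2
  have h1 : D.PJ D' 0 ⊔ D.PJ D' 1 ≤ CM (D.F 0 0) (D'.F 2 1) := by
    apply sup_le
    · exact (PJ_le D D' 0 0).trans (CM_mono le_rfl (D'.h02 0))
    · exact (PJ_le D D' 2 1).trans (CM_mono (D.h02 0) le_rfl)
  have h2 : D.PJ D' 0 ⊓ D.PJ D' 1 ⊔ D.PJ D' 2 ≤ CM (D.F 0 2) (D'.F 2 0) ⊓ CM (D.F 0 1) (D'.F 2 2) := by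
    apply sup_le
    · apply le_inf
      · exact inf_le_left.trans ((PJ_le D D' 2 0).trans (CM_mono (D.h02 2) le_rfl))
      · exact inf_le_right.trans ((PJ_le D D' 0 1).trans (CM_mono le_rfl (D'.h02 1)))
    · apply le_inf
      · exact (PJ_le D D' 0 2).trans (CM_mono le_rfl (D'.h02 2))
      · exact (PJ_le D D' 2 2).trans (CM_mono (D.h02 1) le_rfl)
  have e1 := d_sup_inf (D.PJ D' 0) (D.PJ D' 1)
  have e2 := d_sup_inf (D.PJ D' 0 ⊓ D.PJ D' 1) (D.PJ D' 2)
  have b1 := d_mono h1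
  have b2 := d_mono h2
  have c1 := CM_pair (A := D.F 0 0) (A' := ⊥) (D'.F 2 1) ⊤ (inf_bot_eq _)
  have : CM (⊥ : Submodule k V) (⊤ : Submodule k V') = ⊤ := by
    rw [eq_top_iff]; exact fun g _ x _ => mem_top
  rw [this, inf_top_eq, d_bot] at c1
  have dj : D.F 0 2 ⊓ D.F 0 1 = ⊥ := by
    rw [eq_bot_iff, ← h 1, inf_comm]
    exact inf_le_inf_left _ (D.h01 2)
  have c2 := CM_pair (D'.F 2 0) (D'.F 2 2) dj
  simp only [chi, Fin.sum_univ_three]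
  rw [show (1 : Fin 3) + 1 = 2 from rfl, show (2 : Fin 3) + 1 = 0 from rfl, show (0 : Fin 3) + 1 = 1 from rfl]
  simp only [cl_snd, cl_fst] at *
  change _ ≤ d (D.PJ D' 0 ⊓ D.PJ D' 1 ⊓ D.PJ D' 2)
  linarith

variable {la mu : ℤ}

theorem atom_hom (hla : 1 ≤ la) (hmu : 0 ≤ mu) {S : Tri k V} {S' : Tri k V'} (hS : S.Atom la mu)
    (hS' : S'.Atom la mu) {g : V →ₗ[k] V'} (hg : Fil S S' g) (h0 : g ≠ 0) :
    Function.Injective g ∧ S.cl = S'.cl := by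
  have hk := (ker_crit hla hmu hS.good.le hS'.good.le hg hS.good.top).1
  have hk' : (⊤ : Submodule k V) ⊓ LinearMap.ker g = ⊥ := by
    rcases hS.simple _ hk with h | h
    · exact h
    · exfalso; apply h0
      rw [top_inf_eq, LinearMap.ker_eq_top] at h
      exact h
  obtain ⟨a, b, -⟩ := inj_class hla hmu hS.good hS'.good hg hS.good.top hk'
  refine ⟨LinearMap.ker_eq_bot.1 (by rwa [top_inf_eq] at hk'), ?_⟩
  rcases hS'.simple _ a with h | h
  · exfalso; apply h0
    rw [Submodule.map_top, LinearMap.range_eq_bot] at h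
    exact h
  · rw [h] at b; exact b.symm

theorem atom_chi (hla : 1 ≤ la) (hmu : 0 ≤ mu) {S : Tri k V} {S' : Tri k V'} (hS : S.Atom la mu)
    (hS' : S'.Atom la mu) (hne : S.cl ≠ S'.cl) : chi S.cl S'.cl ≤ 0 := by
  refine (chi_le (hS.good.adm hla hmu)).trans ?_
  have : S.HF S' = ⊥ := by
    rw [eq_bot_iff]
    intro g hg
    by_contra h0
    exact hne (atom_hom hla hmu hS hS' (mem_HF.1 hg) (by simpa using h0)).2
  rw [this, d_bot]

theorem atom_dvd (hla : 1 ≤ la) (hmu : 0 ≤ mu) {S : Tri k V} (hS : S.Atom la mu) (W : Submodule k V)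
    (hW : ∀ g, Fil S S g → ∀ x ∈ W, g x ∈ W) : d (S.HF S) ∣ d W := by
  obtain ⟨W', ⟨hle, hst, hdv⟩, hmax⟩ := exists_max
    (fun W' : Submodule k V => W' ≤ W ∧ (∀ g, Fil S S g → ∀ x ∈ W', g x ∈ W') ∧ d (S.HF S) ∣ d W') d (d W)
    (fun a ha => d_mono ha.1) ⟨⊥, bot_le, fun g _ x hx => by simp_all, by simp⟩
  by_cases he : W' = W
  · rw [← he]; exact hdv
  exfalso
  obtain ⟨x, hxW, hx⟩ := SetLike.exists_of_lt (lt_of_le_of_ne hle he)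
  let ev : (V →ₗ[k] V) →ₗ[k] V := LinearMap.applyₗ x
  have hev : ∀ g, ev g = g x := fun g => rfl
  have hinj : ∀ g, Fil S S g → g x ∈ W' → g = 0 := by
    intro g hg hgx
    by_contra h0
    have hi := (atom_hom hla hmu hS hS hg h0).1
    have : W'.map g = W' := by
      apply eq_of_le_of_d
      · rintro _ ⟨y, hy, rfl⟩; exact hst g hg y hy
      · rw [d_map_inj g hi]
    rw [← this] at hgx
    obtain ⟨y, hy, hyx⟩ := hgx
    exact hx (hi hyx ▸ hy)
  have hd : d ((S.HF S).map ev) = d (S.HF S) := by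
    rw [d_map]
    have : S.HF S ⊓ LinearMap.ker ev = ⊥ := by
      rw [eq_bot_iff]
      rintro g ⟨hg, hk⟩
      have : g x = 0 := hk
      rw [Submodule.mem_bot]
      exact hinj g (mem_HF.1 hg) (by rw [this]; exact W'.zero_mem)
    rw [this]; simp
  have hdis : W' ⊓ (S.HF S).map ev = ⊥ := by
    rw [eq_bot_iff]
    rintro _ ⟨hy, g, hg, rfl⟩
    rw [hinj g (mem_HF.1 hg) hy]; simp
  have hsum := d_sup_inf W' ((S.HF S).map ev)
  rw [hdis, d_bot, hd] at hsum
  have h1 := hmax (W' ⊔ (S.HF S).map ev) ⟨sup_le hle ?_, ?_, ?_⟩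
  · have : 0 < d (S.HF S) := by
      apply d_pos
      intro h
      have hid : (LinearMap.id : V →ₗ[k] V) ∈ S.HF S := mem_HF.2 fun s j x hx => hx
      rw [h] at hid
      have h2 : (LinearMap.id : V →ₗ[k] V) = 0 := by simpa using hid
      apply hx
      have h3 := LinearMap.congr_fun h2 x
      have h4 : x = 0 := h3
      rw [h4]; exact W'.zero_mem
    omega
  · rintro _ ⟨g, hg, rfl⟩
    exact hW g (mem_HF.1 hg) x hxW
  · intro g hg y hy
    obtain ⟨a, ha, b, hb, rfl⟩ := Submodule.mem_sup.1 hy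
    obtain ⟨g', hg', rfl⟩ := hb
    rw [map_add]
    refine Submodule.add_mem_sup (hst g hg a ha) ?_
    exact ⟨g ∘ₗ g', mem_HF.2 fun s j z hz => hg s j _ (mem_HF.1 hg' s j z hz), rfl⟩
  · rw [show d (W' ⊔ (S.HF S).map ev) = d W' + d (S.HF S) by linarith]
    exact dvd_add hdv dvd_rfl

theorem atom_q (hla : 1 ≤ la) (hmu : 0 ≤ mu) {S : Tri k V} (hS : S.Atom la mu) : chi S.cl S.cl ≤ 1 := by
  have h1 := chi_le (D' := S) (hS.good.adm hla hmu)
  have h2 : ∀ s j, ∃ c, S.cl.2 s j = d (S.HF S) * c := fun s j => by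
    rw [cl_snd]; exact atom_dvd hla hmu hS _ fun g hg x hx => hg s j x hx
  obtain ⟨c, hc⟩ : ∃ c, S.cl.1 = d (S.HF S) * c := by
    rw [cl_fst, ← d_top]; exact atom_dvd hla hmu hS ⊤ fun g hg x hx => mem_top
  choose f hf using h2
  have h3 := chi_smul (d (S.HF S)) S.cl (c, f) hc hf
  have h4 := d_nonneg (S.HF S)
  rw [h3] at h1 ⊢
  by_contra hlt
  have h5 : 1 ≤ chi (c, f) (c, f) := by
    by_contra h
    have : d (S.HF S) * d (S.HF S) * chi (c, f) (c, f) ≤ 0 := mul_nonpos_of_nonneg_of_nonpos (mul_nonneg h4 h4) (by omega)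
    omega
  nlinarith

theorem Atom.rot {S : Tri k V} (h : S.Atom la mu) : S.rot.Atom la mu :=
  ⟨h.good.rot, h.nt, fun W hW => h.simple W (by rwa [L_rot] at hW)⟩

end Tri

/-- numerical data of an atom class -/
structure NumAt (t : Cl) : Prop where
  q : chi t t ≤ 1
  o1 : tauC t = t ∨ chi (tauC t) t ≤ 0
  o2 : rotC t = t ∨ chi (rotC t) t ≤ 0

theorem Tri.IsAtomCl.tau {la mu : ℤ} (hla : 1 ≤ la) (hmu : 0 ≤ mu) {t : Cl} (h : Tri.IsAtomCl k la mu t) :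
    Tri.IsAtomCl k la mu (tauC t) := by
  obtain ⟨W, _, _, _, S, hS, rfl⟩ := h
  exact ⟨S.TV, _, _, inferInstance, S.tau, Tri.atom_tau hla hmu hS, hS.good.cl_tau hla hmu⟩

theorem Tri.IsAtomCl.num {la mu : ℤ} (hla : 1 ≤ la) (hmu : 0 ≤ mu) {t : Cl} (h : Tri.IsAtomCl k la mu t) :
    NumAt t := by
  obtain ⟨W, _, _, _, S, hS, rfl⟩ := h
  refine ⟨Tri.atom_q hla hmu hS, ?_, ?_⟩
  · by_cases he : tauC S.cl = S.cl
    · exact Or.inl he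
    · right
      have hc := hS.good.cl_tau hla hmu
      rw [← hc] at he ⊢
      exact Tri.atom_chi hla hmu (Tri.atom_tau hla hmu hS) hS he
  · by_cases he : rotC S.cl = S.cl
    · exact Or.inl he
    · right
      rw [← Tri.cl_rot] at he ⊢
      exact Tri.atom_chi hla hmu hS.rot hS he


theorem NumAt.three {t : Cl} (h : NumAt t) :
    |fC t| ≤ 6 ∧ |fC t + fC (tauC t)| ≤ 6 ∧ |fC t + fC (tauC t) + fC (tauC (tauC t))| ≤ 6 := by
  by_cases hr : rotC t = t
  · have h1 := fC_rot t
    have h2 := fC_rot (tauC t)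
    have h3 : rotC (tauC t) = tauC t := by rw [← tauC_rotC, hr]
    rw [hr, hr] at h1
    rw [h3, h3] at h2
    rw [tauC_tauC, hr]
    have e1 : fC t = 0 := by omega
    have e2 : fC (tauC t) = 0 := by omega
    simp [e1, e2]
  have o1 : chi (tauC t) t ≤ 0 := by
    rcases h.o1 with h1 | h1
    · exact absurd (by rw [← tauC_tauC, h1, h1]) hr
    · exact h1
  have o2 := h.o2.resolve_left hr
  rw [← tauC_tauC] at o2
  have q := h.q
  have c1 := chi_tau t t
  have c2 := chi_tau (tauC t) (tauC t)
  have c3 := chi_tau t (tauC t)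
  have c4 := chi_tau_tau t t
  have c5 := chi_tau_tau (tauC t) (tauC t)
  have c6 := chi_tau_tau (tauC t) t
  refine ⟨root_bound t q, ?_, ?_⟩
  · rw [← fC_add]
    apply root_bound
    rw [chi_add_left, chi_add_right, chi_add_right]
    omega
  · rw [← fC_add, ← fC_add]
    apply root_bound
    simp only [chi_add_left, chi_add_right]
    omega

theorem Tri.IsAtomCl.sum_bound {la mu : ℤ} (hla : 1 ≤ la) (hmu : 0 ≤ mu) {t : Cl} (h : Tri.IsAtomCl k la mu t) (n : ℕ) :
    |fC (∑ i ∈ Finset.range n, tauC^[i] t)| ≤ 6 := by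
  have hz : fC 0 = 0 := by simp [fC]
  have h1 := h.tau hla hmu
  have h2 := h1.tau hla hmu
  have h3 := h2.tau hla hmu
  have h4 := h3.tau hla hmu
  have h5 := h4.tau hla hmu
  have b0 := (h.num hla hmu).three
  have b4 := (h4.num hla hmu).three
  have b5 := (h5.num hla hmu).three
  have r0 := fC_rot t
  have r1 := fC_rot (tauC t)
  have e6 : tauC^[6] t = t := by
    simp only [Function.iterate_succ, Function.comp, Function.iterate_zero, id]
    rw [tauC_tauC, tauC_tauC, tauC_tauC, rotC3]
  simp only [← tauC_tauC] at r0 r1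
  have key : ∀ n, ∑ i ∈ Finset.range (n + 6), tauC^[i] t = (∑ i ∈ Finset.range 6, tauC^[i] t) + ∑ i ∈ Finset.range n, tauC^[i] t := by
    intro n
    rw [add_comm n 6, Finset.sum_range_add]
    congr 1
    apply Finset.sum_congr rfl
    intro i _
    rw [add_comm, Function.iterate_add_apply, e6]
  induction n using Nat.strong_induction_on with
  | _ n ih =>
    by_cases hn : n < 6
    · have : n = 0 ∨ n = 1 ∨ n = 2 ∨ n = 3 ∨ n = 4 ∨ n = 5 := by omega
      rcases this with rfl | rfl | rfl | rfl | rfl | rfl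
      · simp [hz]
      all_goals
        simp only [Finset.sum_range_succ, Finset.sum_range_zero, fC_add, hz, Function.iterate_succ, Function.comp,
          Function.iterate_zero, id]
        simp only [abs_le] at *
        omega
    · obtain ⟨m, rfl⟩ : ∃ m, n = m + 6 := ⟨n - 6, by omega⟩
      rw [key, fC_add]
      have : fC (∑ i ∈ Finset.range 6, tauC^[i] t) = 0 := by
        simp only [Finset.sum_range_succ, Finset.sum_range_zero, fC_add, hz, Function.iterate_succ, Function.comp,
          Function.iterate_zero, id]
        omega
      rw [this, zero_add]
      exact ih m (by omega)

theorem Tri.good_bound {la mu : ℤ} (hla : 1 ≤ la) (hmu : 0 ≤ mu) {D : Tri k V} (h : D.Good la mu) (hI : D.Indec) :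
    |fC D.cl| ≤ 6 := by
  obtain ⟨S, n, t, -, ht, hc, -⟩ := Tri.uniserial hla hmu (finrank k V) V D le_rfl h hI
  rw [hc]
  exact ht.sum_bound hla hmu _

end St6

set_option linter.unusedSectionVars false
set_option linter.unusedVariables false
namespace St6
open Module Submodule

variable {k : Type u} [Field k] {V : Type u} [AddCommGroup V] [Module k V] [FiniteDimensional k V]
  {V' : Type u} [AddCommGroup V'] [Module k V'] [FiniteDimensional k V']

namespace Tri

theorem Adm.quot_bot {T : Tri k V} (h : T.Adm) : (T.quot ⊥).Adm := by
  intro j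
  change (T.F 0 j).map (⊥ : Submodule k V).mkQ ⊓ (T.F 1 (j+1)).map (⊥ : Submodule k V).mkQ = ⊥
  rw [← Submodule.map_inf _ (LinearMap.ker_eq_bot.1 (Submodule.ker_mkQ _)), h j, Submodule.map_bot]

theorem split_zero (T : Tri k V) (X : Submodule k V) (ha : (T.quot X).Adm)
    (h : ∀ g, Fil (T.sub X) (T.quot X).tau g → ∀ x, g x = 0) : ∃ C, T.Spl X C := by
  obtain ⟨C, hC1, hC2⟩ := split_star T X ⊤ ⊥ (by simp) (fun s j => by
      rw [inf_top_eq]; exact le_sup_left) le_top (bot_inf_eq _) (fun s j y hy hyF => by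
      rw [(Submodule.mem_bot k).1 hy]; exact zero_mem _) (by
        rw [Submodule.map_bot]; exact ha.quot_bot) (fun g hg x _ => by rw [h g hg x, map_zero])
  exact ⟨C, hC1, hC2⟩

end Tri

/-- the Z-indexed filtration data -/
structure QF (k : Type u) [Field k] (V : Type u) [AddCommGroup V] [Module k V] where
  F : ℤ → Fin 3 → Submodule k V
  mono : ∀ i j, F i j ≤ F (i + 1) j
  sh : ∀ i j, F i j ≤ F (i + 2) (j + 1)
  bot : ∃ a, ∀ j, F a j = ⊥
  top : ∃ b, ∀ j, F b j = ⊤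

namespace QF

theorem mono' (D : QF k V) {a b : ℤ} (h : a ≤ b) (j : Fin 3) : D.F a j ≤ D.F b j :=
  monotone_int_of_le_succ (f := fun i => D.F i j) (fun i => D.mono i j) h

def shift (D : QF k V) (n : ℤ) : QF k V where
  F i j := D.F (i + n) j
  mono i j := by
    have := D.mono (i + n) j
    rwa [show i + n + 1 = i + 1 + n by ring] at this
  sh i j := by
    have := D.sh (i + n) j
    rwa [show i + n + 2 = i + 2 + n by ring] at this
  bot := by obtain ⟨a, h⟩ := D.bot; exact ⟨a - n, by simpa using h⟩
  top := by obtain ⟨a, h⟩ := D.top; exact ⟨a - n, by simpa using h⟩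

def Spl (D : QF k V) (A B : Submodule k V) : Prop :=
  IsCompl A B ∧ ∀ i j, D.F i j ≤ (D.F i j ⊓ A) ⊔ (D.F i j ⊓ B)

def Indec (D : QF k V) : Prop := Nontrivial V ∧ ∀ A B, D.Spl A B → A = ⊥ ∨ B = ⊥

theorem Indec.shift {D : QF k V} (h : D.Indec) (n : ℤ) : (D.shift n).Indec := by
  refine ⟨h.1, fun A B hAB => h.2 A B ⟨hAB.1, fun i j => ?_⟩⟩
  have := hAB.2 (i - n) j
  simpa [QF.shift] using this

noncomputable def g (D : QF k V) (i : ℤ) : ℤ := d (D.F i 0) + d (D.F i 2) - 2 * d (D.F i 1)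

noncomputable def f (D : QF k V) : ℤ := ∑ᶠ i, D.g i

theorem f_shift (D : QF k V) (n : ℤ) : (D.shift n).f = D.f := by
  unfold f
  exact finsum_comp_equiv (f := D.g) (Equiv.addRight n)

theorem g_bot {D : QF k V} {i : ℤ} (h : ∀ j, D.F i j = ⊥) : D.g i = 0 := by simp [g, h]
theorem g_top {D : QF k V} {i : ℤ} (h : ∀ j, D.F i j = ⊤) : D.g i = 0 := by simp [g, h]; ring

theorem f_eq {D : QF k V} {a b : ℤ} (ha : ∀ j, D.F a j = ⊥) (hb : ∀ j, D.F b j = ⊤) :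
    D.f = ∑ i ∈ Finset.Ioo a b, D.g i := by
  unfold f
  apply finsum_eq_sum_of_support_subset
  intro i hi
  rw [Finset.coe_Ioo]
  constructor
  · by_contra h
    push Not at h
    exact hi (g_bot fun j => by rw [eq_bot_iff, ← ha j]; exact D.mono' h j)
  · by_contra h
    push Not at h
    exact hi (g_top fun j => by rw [eq_top_iff, ← hb j]; exact D.mono' h j)

def tri (D : QF k V) : Tri k V where
  F := ![D.F 1, D.F 2, D.F 3]
  h01 j := D.mono' (by norm_num : (1:ℤ) ≤ 2) j
  h12 j := D.mono' (by norm_num : (2:ℤ) ≤ 3) j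
  h02 j := D.sh 1 j

/-- high cut -/
def Hi (D : QF k V) (la mu : ℤ) : Prop :=
  (∀ j, D.F 4 j = ⊤) ∧ ∀ W, (∀ j, D.F 0 j ≤ W) → W ≠ ⊤ → D.tri.L la mu W < D.tri.L la mu ⊤

def Lo (D : QF k V) (la mu : ℤ) : Prop :=
  (∀ j, D.F 0 j = ⊥) ∧ ∀ W, (∀ j, W ≤ D.F 4 j) → D.tri.L la mu W ≤ 0

theorem spl_of_window {D : QF k V} {X C : Submodule k V} (h : D.tri.Spl X C) (h0 : ∀ j, D.F 0 j ≤ X)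
    (h4 : ∀ j, X ≤ D.F 4 j) : D.Spl X C := by
  refine ⟨h.1, fun i j => ?_⟩
  by_cases hi : i ≤ 0
  · refine le_trans ?_ le_sup_left
    exact le_inf le_rfl ((D.mono' hi j).trans (h0 j))
  by_cases hi4 : 4 ≤ i
  · have hX : X ≤ D.F i j := (h4 j).trans (D.mono' hi4 j)
    rw [inf_eq_right.2 hX, inf_comm, ← sup_inf_assoc_of_le _ hX, h.1.sup_eq_top, top_inf_eq]
  · have : i = 1 ∨ i = 2 ∨ i = 3 := by omega
    rcases this with rfl | rfl | rfl
    · exact h.2 0 j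
    · exact h.2 1 j
    · exact h.2 2 j

theorem F04 (D : QF k V) (j l : Fin 3) : D.F 0 j ≤ D.F 4 l := by
  rcases jall j l with rfl | rfl | rfl
  · exact D.mono' (by norm_num) _
  · exact (D.sh 0 j).trans (D.mono' (by norm_num) _)
  · have := (D.sh 0 j).trans (D.sh (0+2) (j+1))
    rw [j11] at this
    exact this

theorem cut {la mu : ℤ} (hla : 1 ≤ la) (hmu : 0 ≤ mu) {D : QF k V} (hI : D.Indec) : D.Hi la mu ∨ D.Lo la mu := by
  obtain ⟨X, ⟨hX0, hX4⟩, hmax, hmin⟩ := LL_max' (fun p : Fin 3 × Fin 3 => D.tri.F p.1 p.2)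
    (fun p => cw la mu p.1) (fun _ => cw_nonneg hla hmu _) (3 * (la + mu))
    (fun W => (∀ j, D.F 0 j ≤ W) ∧ ∀ j, W ≤ D.F 4 j)
    ⟨⨆ j, D.F 0 j, fun j => le_iSup (fun j => D.F 0 j) j, fun l => iSup_le fun j => D.F04 j l⟩
  change ∀ W', _ → D.tri.L la mu W' ≤ D.tri.L la mu X at hmax
  change ∀ W', _ → W' < X → D.tri.L la mu W' < D.tri.L la mu X at hmin
  have hlow : (D.tri.quot X).LowC la mu := by
    intro W hW
    rw [Tri.L_quot]
    have := hmax (W.comap X.mkQ) ⟨fun j => (hX0 j).trans (Submodule.le_comap_mkQ X W), fun j x hx => ?_⟩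
    · omega
    · have h1 := hW j hx
      change X.mkQ x ∈ (D.F 3 j).map X.mkQ ⊔ (D.F 2 (j+2)).map X.mkQ at h1
      rw [← Submodule.map_sup, ← Submodule.mem_comap, Submodule.comap_map_mkQ] at h1
      refine (sup_le (hX4 j) (sup_le (D.mono' (by norm_num) j) ?_)) h1
      have := D.sh 2 (j+2)
      rw [j21] at this; exact this
  have ha := hlow.adm hla hmu
  obtain ⟨C, hC⟩ := D.tri.split_zero X ha (by
    intro g hg x
    have h1 := Tri.L_image hla hmu hg ⊤
    have h2 := Tri.T2 hla hmu hlow ((⊤ : Submodule k X).map g)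
    rw [top_inf_eq] at h1
    rw [Tri.L_sub, Tri.L_sub, Submodule.map_top, Submodule.range_subtype] at h1
    have h3 : (LinearMap.ker g).map X.subtype = X := by
      by_contra hne
      have := hmin ((LinearMap.ker g).map X.subtype) ⟨fun j x hx => ?_, fun j => (Submodule.map_subtype_le X _).trans (hX4 j)⟩
        (lt_of_le_of_ne (Submodule.map_subtype_le X _) hne)
      · omega
      · refine ⟨⟨x, hX0 j hx⟩, ?_, rfl⟩
        rw [SetLike.mem_coe, LinearMap.mem_ker]
        apply Tri.Adm.zero ha.tau (j := j)
        · exact hg 0 j _ (D.mono' (by norm_num : (0:ℤ) ≤ 1) j hx)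
        · exact hg 1 (j+1) _ (D.sh 0 j hx)
    have : x.1 ∈ (LinearMap.ker g).map X.subtype := by rw [h3]; exact x.2
    obtain ⟨y, hy, hyx⟩ := this
    have : y = x := Subtype.ext hyx
    rw [← this]; exact hy)
  have hspl := spl_of_window hC hX0 hX4
  rcases hI.2 X C hspl with h | h
  · right
    refine ⟨fun j => by rw [eq_bot_iff, ← h]; exact hX0 j, fun W hW => ?_⟩
    have := hmax W ⟨fun j => (hX0 j).trans (by rw [h]; exact bot_le), hW⟩
    rw [h, Tri.L_bot] at this; exact this
  · left
    have hX : X = ⊤ := by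
      have := hspl.1.sup_eq_top; rwa [h, sup_bot_eq] at this
    have h4 : ∀ j, D.F 4 j = ⊤ := fun j => by rw [eq_top_iff, ← hX]; exact hX4 j
    refine ⟨h4, fun W hW hne => ?_⟩
    have := hmin W ⟨hW, fun j => by rw [h4 j]; exact le_top⟩ (by rw [hX]; exact lt_top_iff_ne_top.2 hne)
    rwa [hX] at this

end QF
end St6

set_option linter.unusedSectionVars false
set_option linter.unusedVariables false
namespace St6
open Module Submodule

variable {k : Type u} [Field k] {V : Type u} [AddCommGroup V] [Module k V] [FiniteDimensional k V]
  {V' : Type u} [AddCommGroup V'] [Module k V'] [FiniteDimensional k V']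

theorem d_inf_diff (A B W : Submodule k V) : d (A ⊓ W) - d (A ⊓ (W ⊓ B)) ≤ d W - d (W ⊓ B) := by
  have h := d_sup_inf (A ⊓ W) (W ⊓ B)
  have e : A ⊓ W ⊓ (W ⊓ B) = A ⊓ (W ⊓ B) := by
    apply le_antisymm
    · exact le_inf (inf_le_left.trans inf_le_left) inf_le_right
    · exact le_inf (le_inf inf_le_left (inf_le_right.trans inf_le_left)) inf_le_right
  rw [e] at h
  have := d_mono (show A ⊓ W ⊔ W ⊓ B ≤ W from sup_le inf_le_right inf_le_left)
  omega

namespace QF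

theorem tri_L10 (D : QF k V) (W : Submodule k V) :
    D.tri.L 1 0 W = ∑ j, (d (D.F 2 j ⊓ W) + d (D.F 3 j ⊓ W)) - 3 * d W := by
  rw [Tri.L_expand]; simp [tri]

theorem tri_L_shift (D : QF k V) (la mu : ℤ) (W : Submodule k V) :
    (D.shift 1).tri.L la mu W = la * (D.shift 1).tri.L 1 0 W + mu * D.tri.L 1 0 W := by
  rw [tri_L10, Tri.L_expand, tri_L10]
  change ∑ j, (mu * d (D.F 2 j ⊓ W) + (la + mu) * d (D.F 3 j ⊓ W) + la * d (D.F 4 j ⊓ W)) - _ =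
    la * (∑ j, (d (D.F 3 j ⊓ W) + d (D.F 4 j ⊓ W)) - _) + _
  simp only [Fin.sum_univ_three]
  ring

theorem exists_norm {D : QF k V} (hI : D.Indec) : ∃ n, (D.shift n).Lo 1 0 ∧ (D.shift (n+1)).Hi 1 0 := by
  have := hI.1
  have hbt : (⊥ : Submodule k V) ≠ ⊤ := bot_ne_top
  obtain ⟨a, ha⟩ := D.bot
  obtain ⟨b, hb⟩ := D.top
  obtain ⟨n, hn, hmin⟩ := Int.exists_least_of_bdd (P := fun n => (D.shift n).Hi 1 0) ⟨a - 4, fun n hn => by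
    by_contra hlt
    push Not at hlt
    have h1 := hn.1 0
    have h2 : D.F (4 + n) 0 ≤ D.F a 0 := D.mono' (by omega) 0
    rw [ha 0] at h2
    change D.F (4 + n) 0 = ⊤ at h1
    rw [h1] at h2
    exact hbt (le_antisymm bot_le h2)⟩ ⟨b, by
    rcases cut (le_refl 1) (le_refl 0) (hI.shift b) with h | h
    · exact h
    · exfalso
      have h1 := h.1 0
      change D.F (0 + b) 0 = ⊥ at h1
      rw [zero_add, hb 0] at h1
      exact hbt h1.symm⟩
  refine ⟨n - 1, ?_, by rw [sub_add_cancel]; exact hn⟩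
  rcases cut (le_refl 1) (le_refl 0) (hI.shift (n-1)) with h | h
  · have := hmin _ h; omega
  · exact h

theorem cut_low {D : QF k V} (h5 : ∀ j, D.F 5 j = ⊤) (hlo : D.Lo 1 0) (W : Submodule k V) : D.tri.L 1 0 W ≤ 0 := by
  have step : ∀ W j, D.tri.L 1 0 W ≤ D.tri.L 1 0 (W ⊓ D.F 4 j) := by
    intro W j
    rw [tri_L10, tri_L10, sum3 j, sum3 j]
    have z : ∀ A : Submodule k V, A ≤ D.F 4 j → d (A ⊓ (W ⊓ D.F 4 j)) = d (A ⊓ W) := fun A hA => by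
      rw [inf_left_comm, inf_eq_left.2 hA, inf_comm]
    have s1 := D.sh 2 (j+2)
    rw [j21] at s1
    rw [z _ (D.mono' (by norm_num) j), z _ (D.mono' (by norm_num) j), z _ s1]
    have a1 := d_inf_diff (D.F 2 (j+1)) (D.F 4 j) W
    have a2 := d_inf_diff (D.F 3 (j+1)) (D.F 4 j) W
    have a3 := d_inf_diff (D.F 3 (j+2)) (D.F 4 j) W
    omega
  refine (step W 0).trans ((step _ 1).trans ((step _ 2).trans (hlo.2 _ fun j => ?_)))
  fin_cases j
  · exact inf_le_left.trans (inf_le_left.trans inf_le_right)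
  · exact inf_le_left.trans inf_le_right
  · exact inf_le_right

theorem f1_crit {D : QF k V} (h : ∀ W, D.tri.L 1 0 W ≤ 0) : 0 ≤ D.tri.L 1 0 (D.F 1 0 ⊔ D.F 1 1 ⊔ D.F 1 2) := by
  have a : ∀ j, 0 ≤ D.tri.L 1 0 (D.F 1 j) := by
    intro j
    rw [tri_L10, sum3 j]
    rw [inf_eq_right.2 (D.mono' (by norm_num : (1:ℤ) ≤ 2) j), inf_eq_right.2 (D.mono' (by norm_num : (1:ℤ) ≤ 3) j),
      inf_eq_right.2 (show D.F 1 j ≤ D.F 3 (j+1) from D.sh 1 j)]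
    have := d_nonneg (D.F 2 (j+1) ⊓ D.F 1 j)
    have := d_nonneg (D.F 2 (j+2) ⊓ D.F 1 j)
    have := d_nonneg (D.F 3 (j+2) ⊓ D.F 1 j)
    omega
  have b : ∀ A B, 0 ≤ D.tri.L 1 0 A → 0 ≤ D.tri.L 1 0 B → 0 ≤ D.tri.L 1 0 (A ⊔ B) := by
    intro A B hA hB
    have := D.tri.L_super (le_refl 1) (le_refl 0) A B
    have := h (A ⊓ B)
    omega
  exact b _ _ (b _ _ (a 0) (a 1)) (a 2)

theorem tri_indec {D : QF k V} (hI : D.Indec) (h0 : ∀ j, D.F 0 j = ⊥) (h4 : ∀ j, D.F 4 j = ⊤) : D.tri.Indec :=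
  ⟨hI.1, fun A B h => hI.2 A B (spl_of_window h (fun j => by rw [h0]; exact bot_le) (fun j => by rw [h4]; exact le_top))⟩

theorem tri_f {D : QF k V} (h0 : ∀ j, D.F 0 j = ⊥) (h4 : ∀ j, D.F 4 j = ⊤) : fC D.tri.cl = D.f := by
  rw [f_eq h0 h4, show Finset.Ioo (0:ℤ) 4 = {1, 2, 3} by decide]
  simp only [fC, Fin.sum_univ_three, Tri.cl_snd]
  rw [Finset.sum_insert (by simp), Finset.sum_insert (by simp), Finset.sum_singleton]
  simp only [g]
  change (d (D.F 1 0) + _ - _) + (d (D.F 2 0) + d (D.F 2 2) - 2 * d (D.F 2 1)) + (d (D.F 3 0) + d (D.F 3 2) - 2 * d (D.F 3 1)) = _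
  change (d (D.F 1 0) + d (D.F 1 2) - 2 * d (D.F 1 1)) + _ + _ = _
  ring

theorem caseI {D : QF k V} (hI : D.Indec) (hlo : D.Lo 1 0) (hhi : (D.shift 1).Hi 1 0) (hlt : D.tri.L 1 0 ⊤ < 0) :
    |D.f| ≤ 6 := by
  have h5 : ∀ j, D.F 5 j = ⊤ := hhi.1
  have hle := cut_low h5 hlo
  have hF1 : ∀ j, D.F 1 j = ⊥ := by
    by_contra hne
    set W := D.F 1 0 ⊔ D.F 1 1 ⊔ D.F 1 2 with hW
    have hW0 := f1_crit hle
    have hWt : W ≠ ⊤ := fun h => by rw [← hW, h] at hW0; omega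
    have hWle : ∀ j, (D.shift 1).F 0 j ≤ W := by
      intro j
      fin_cases j
      · exact le_sup_left.trans le_sup_left
      · exact le_sup_right.trans le_sup_left
      · exact le_sup_right
    have hall : ∀ mu, 0 ≤ mu → (D.shift 1).tri.L 1 mu W < (D.shift 1).tri.L 1 mu ⊤ := by
      intro mu hmu
      rcases cut (le_refl 1) hmu (hI.shift 1) with h | h
      · exact h.2 W hWle hWt
      · exact absurd h.1 hne
    set c := (D.shift 1).tri.L 1 0 ⊤ - (D.shift 1).tri.L 1 0 W with hc
    have h1 := hall 0 le_rfl
    have h2 := hall c (by omega)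
    rw [tri_L_shift, tri_L_shift (W := ⊤)] at h2
    nlinarith
  have := hI.1
  have hr := hhi.2 ⊥ (fun j => le_of_eq (hF1 j)) bot_ne_top
  rw [Tri.L_bot] at hr
  have hlo2 : (D.shift 1).Lo (-D.tri.L 1 0 ⊤) ((D.shift 1).tri.L 1 0 ⊤) := by
    rcases cut (by omega : 1 ≤ -D.tri.L 1 0 ⊤) hr.le (hI.shift 1) with h | h
    · have h2 := h.2 ⊥ (fun j => le_of_eq (hF1 j)) bot_ne_top
      rw [Tri.L_bot, tri_L_shift] at h2
      exfalso; nlinarith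
    · exact h
  have hG : (D.shift 1).tri.Good (-D.tri.L 1 0 ⊤) ((D.shift 1).tri.L 1 0 ⊤) :=
    { top := by rw [tri_L_shift]; ring
      le := fun W => hlo2.2 W fun j => by rw [hhi.1 j]; exact le_top
      z0 := fun h => by omega
      z1 := fun h => by omega }
  have := Tri.good_bound (by omega) hr.le hG (tri_indec (hI.shift 1) hlo2.1 hhi.1)
  rwa [tri_f hlo2.1 hhi.1, f_shift] at this

theorem dich {D : QF k V} (hI : D.Indec) : |D.f| ≤ 6 ∨ ∃ D' : QF k V, D'.Indec ∧ D'.f = D.f ∧ (∀ j, D'.F 0 j = ⊥) ∧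
    (∀ j, D'.F 5 j = ⊤) ∧ (∀ W, D'.tri.L 1 0 W ≤ 0) ∧ D'.tri.L 1 0 ⊤ = 0 := by
  obtain ⟨n, hlo, hhi⟩ := exists_norm hI
  have hI' := hI.shift n
  have e : (D.shift n).shift 1 = D.shift (n+1) := by
    unfold QF.shift; congr 1; funext i j; change D.F (i + 1 + n) j = D.F (i + (n + 1)) j; congr 1; ring
  rw [← e] at hhi
  have hle := cut_low hhi.1 hlo
  rcases (hle ⊤).lt_or_eq with h | h
  · left
    rw [← f_shift D n]; exact caseI hI' hlo hhi h
  · right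
    exact ⟨D.shift n, hI', f_shift D n, hlo.1, hhi.1, hle, h⟩

end QF
end St6

set_option linter.unusedSectionVars false
set_option linter.unusedVariables false
namespace St6
open Module Submodule

variable {k : Type u} [Field k] {V : Type u} [AddCommGroup V] [Module k V] [FiniteDimensional k V]
  {V' : Type u} [AddCommGroup V'] [Module k V'] [FiniteDimensional k V']

theorem le_split_left {X C F : Submodule k V} (h : F ≤ X) : F ≤ (F ⊓ X) ⊔ (F ⊓ C) :=
  le_trans (le_inf le_rfl h) le_sup_left
theorem le_split_right {X C F : Submodule k V} (h : F ≤ C) : F ≤ (F ⊓ X) ⊔ (F ⊓ C) :=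
  le_trans (le_inf le_rfl h) le_sup_right
theorem split_of_ge {X C F : Submodule k V} (hc : X ⊔ C = ⊤) (h : X ≤ F) : F ≤ (F ⊓ X) ⊔ (F ⊓ C) := by
  rw [inf_eq_right.2 h, inf_comm, ← sup_inf_assoc_of_le _ h, hc, top_inf_eq]
theorem split_of_ge' {X C F : Submodule k V} (hc : X ⊔ C = ⊤) (h : C ≤ F) : F ≤ (F ⊓ X) ⊔ (F ⊓ C) := by
  rw [sup_comm]; exact split_of_ge (by rw [sup_comm]; exact hc) h

namespace QF

/-- coarse window -/
def tc (D : QF k V) : Tri k V where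
  F := ![fun _ => ⊥, D.F 2, D.F 3]
  h01 j := bot_le
  h12 j := D.mono' (by norm_num : (2:ℤ) ≤ 3) j
  h02 j := bot_le

theorem tc_L (D : QF k V) (W : Submodule k V) : D.tc.L 1 0 W = D.tri.L 1 0 W := by
  rw [tri_L10, Tri.L_expand]; simp [tc]

/-- splitting criterion when F 0 = 0 and F 5 = all -/
theorem spl5 {D : QF k V} (h0 : ∀ j, D.F 0 j = ⊥) (h5 : ∀ j, D.F 5 j = ⊤) {X C : Submodule k V} (hc : IsCompl X C)
    (h1 : ∀ j, D.F 1 j ≤ (D.F 1 j ⊓ X) ⊔ (D.F 1 j ⊓ C)) (h2 : ∀ j, D.F 2 j ≤ (D.F 2 j ⊓ X) ⊔ (D.F 2 j ⊓ C))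
    (h3 : ∀ j, D.F 3 j ≤ (D.F 3 j ⊓ X) ⊔ (D.F 3 j ⊓ C)) (h4 : ∀ j, D.F 4 j ≤ (D.F 4 j ⊓ X) ⊔ (D.F 4 j ⊓ C)) :
    D.Spl X C := by
  refine ⟨hc, fun i j => ?_⟩
  by_cases hi : i ≤ 0
  · apply le_split_left
    refine (D.mono' hi j).trans ?_
    rw [h0]; exact bot_le
  by_cases hi5 : 5 ≤ i
  · apply split_of_ge hc.sup_eq_top
    refine le_trans ?_ (D.mono' hi5 j)
    rw [h5]; exact le_top
  · have : i = 1 ∨ i = 2 ∨ i = 3 ∨ i = 4 := by omega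
    rcases this with rfl | rfl | rfl | rfl
    exacts [h1 j, h2 j, h3 j, h4 j]

/-- purity condition -/
def PC (D : QF k V) (W : Submodule k V) : Prop := ∀ j, (D.F 2 j ⊔ W) ⊓ (D.F 3 (j+1) ⊔ W) ≤ W

theorem caseII_split {D : QF k V} (hI : D.Indec) (h0 : ∀ j, D.F 0 j = ⊥) (h5 : ∀ j, D.F 5 j = ⊤)
    (hle : ∀ W, D.tri.L 1 0 W ≤ 0) (ht : D.tri.L 1 0 ⊤ = 0) :
    |D.f| ≤ 6 ∨ ∀ W, D.tri.L 1 0 W = 0 → D.PC W → W = ⊤ := by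
  obtain ⟨X, ⟨hXc, hXp⟩, hmax⟩ := exists_max (fun W : Submodule k V => D.tri.L 1 0 W = 0 ∧ D.PC W)
    (fun W => - d W) 0 (fun W _ => by have := d_nonneg W; omega) ⟨⊤, ht, fun j => le_top⟩
  have hG : (D.tc.quot X).Good 1 0 :=
    { top := by rw [Tri.L_quot, tc_L, tc_L, Submodule.comap_top, ht, hXc, sub_zero]
      le := fun W => by rw [Tri.L_quot, tc_L, tc_L, hXc, sub_zero]; exact hle _
      z0 := fun _ j => by
        change (⊥ : Submodule k V).map X.mkQ = ⊥
        exact Submodule.map_bot _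
      z1 := fun _ j => by
        change (D.F 2 j).map X.mkQ ⊓ (D.F 3 (j+1)).map X.mkQ = ⊥
        rw [eq_bot_iff]
        rintro _ ⟨⟨a, ha, rfl⟩, b, hb, hab⟩
        have h1 : a ∈ D.F 3 (j+1) ⊔ X := by
          rw [sup_comm, ← Submodule.comap_map_mkQ]
          exact ⟨b, hb, hab⟩
        have h2 := hXp j ⟨Submodule.mem_sup_left ha, h1⟩
        rw [Submodule.mem_bot]; exact mkQ_zero h2 }
  obtain ⟨C, hC⟩ := D.tc.split_zero X (hG.adm le_rfl le_rfl) (by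
    intro g hg x
    have hτ := hG.tau le_rfl le_rfl
    have hk := (Tri.ker_crit (le_refl 1) (le_refl 0) (fun W => by rw [Tri.L_sub, tc_L]; exact hle _) hτ.le hg
      (A := ⊤) (by rw [Tri.L_sub, tc_L, Submodule.map_top, Submodule.range_subtype, hXc])).1
    rw [top_inf_eq, Tri.L_sub, tc_L] at hk
    set K := (LinearMap.ker g).map X.subtype with hK
    have hKX : K ≤ X := Submodule.map_subtype_le X _
    have hpc : D.PC K := by
      intro j z hz
      have hzX : z ∈ X := hXp j ⟨sup_le_sup_left hKX _ hz.1, sup_le_sup_left hKX _ hz.2⟩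
      obtain ⟨a, ha, k1, hk1, e1⟩ := Submodule.mem_sup.1 hz.1
      obtain ⟨b, hb, k2, hk2, e2⟩ := Submodule.mem_sup.1 hz.2
      obtain ⟨k1', hk1', rfl⟩ := hk1
      obtain ⟨k2', hk2', rfl⟩ := hk2
      have g1 : g k1' = 0 := hk1'
      have g2 : g k2' = 0 := hk2'
      refine ⟨⟨z, hzX⟩, ?_, rfl⟩
      have aX : a ∈ X := by
        have : a = z - k1'.1 := eq_sub_of_add_eq e1
        rw [this]; exact X.sub_mem hzX k1'.2
      have bX : b ∈ X := by
        have : b = z - k2'.1 := eq_sub_of_add_eq e2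
        rw [this]; exact X.sub_mem hzX k2'.2
      have ea : (⟨z, hzX⟩ : X) = ⟨a, aX⟩ + k1' := Subtype.ext e1.symm
      have eb : (⟨z, hzX⟩ : X) = ⟨b, bX⟩ + k2' := Subtype.ext e2.symm
      have m1 : g ⟨z, hzX⟩ ∈ (D.tc.quot X).tau.F 1 j := by
        rw [ea, map_add, g1, add_zero]; exact hg 1 j _ ha
      have m2 : g ⟨z, hzX⟩ ∈ (D.tc.quot X).tau.F 2 (j+1) := by
        rw [eb, map_add, g2, add_zero]; exact hg 2 (j+1) _ hb
      have : g ⟨z, hzX⟩ ∈ (D.tc.quot X).tau.F 1 j ⊓ (D.tc.quot X).tau.F 2 (j+1) := ⟨m1, m2⟩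
      rw [hτ.z1 rfl j] at this
      exact this
    have hKe : K = X := eq_of_le_of_d hKX (by have := hmax K ⟨hk, hpc⟩; omega)
    have : x.1 ∈ K := by rw [hKe]; exact x.2
    obtain ⟨y, hy, hyx⟩ := this
    have : y = x := Subtype.ext hyx
    rw [← this]; exact hy)
  have hCF : ∀ j, C ≤ D.F 4 j := by
    intro j
    have hcm := hG.compl le_rfl rfl (j+2)
    rw [j21] at hcm
    have h1 : (D.F 2 (j+2)).map X.mkQ ⊔ (D.F 3 j).map X.mkQ = ⊤ := by
      apply eq_of_le_of_d le_top
      have h2 := d_sup_inf ((D.F 2 (j+2)).map X.mkQ) ((D.F 3 j).map X.mkQ)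
      have h3 := hG.z1 rfl (j+2)
      rw [j21] at h3
      change (D.F 2 (j+2)).map X.mkQ ⊓ (D.F 3 j).map X.mkQ = ⊥ at h3
      change d ((D.F 2 (j+2)).map X.mkQ) + d ((D.F 3 j).map X.mkQ) = _ at hcm
      rw [h3, d_bot] at h2
      rw [d_top]; omega
    rw [← Submodule.map_sup] at h1
    have h2 : X ⊔ (D.F 2 (j+2) ⊔ D.F 3 j) = ⊤ := by
      rw [← Submodule.comap_map_mkQ, h1, Submodule.comap_top]
    have hsh := D.sh 2 (j+2)
    rw [j21] at hsh
    have h3 : X ⊔ (D.F 4 j ⊓ C) = ⊤ := by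
      rw [eq_top_iff, ← h2]
      refine sup_le le_sup_left (sup_le ?_ ?_)
      · refine (hC.2 1 (j+2)).trans (sup_le (inf_le_right.trans le_sup_left) ?_)
        exact le_trans (inf_le_inf_right _ hsh) le_sup_right
      · refine (hC.2 2 j).trans (sup_le (inf_le_right.trans le_sup_left) ?_)
        exact le_trans (inf_le_inf_right _ (D.mono' (by norm_num : (3:ℤ) ≤ 4) j)) le_sup_right
    have h4 : D.F 4 j ⊓ C = C := by
      apply eq_of_le_of_inf_le_of_sup_le (z := X) inf_le_right
      · rw [inf_comm C, hC.1.inf_eq_bot]; exact bot_le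
      · rw [sup_comm (D.F 4 j ⊓ C), h3]; exact le_top
    rw [← h4]; exact inf_le_left
  have hF1 : ∀ j, D.F 1 j ≤ X := fun j => by
    refine le_trans ?_ (hXp j)
    exact le_inf ((D.mono' (by norm_num : (1:ℤ) ≤ 2) j).trans le_sup_left)
      (le_trans (show D.F 1 j ≤ D.F 3 (j+1) from D.sh 1 j) le_sup_left)
  have hspl : D.Spl X C := spl5 h0 h5 hC.1 (fun j => le_split_left (hF1 j)) (hC.2 1) (hC.2 2)
    (fun j => split_of_ge' hC.1.sup_eq_top (hCF j))
  rcases hI.2 X C hspl with h | h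
  · left
    have hCt : C = ⊤ := by have := hC.1.sup_eq_top; rwa [h, bot_sup_eq] at this
    have h4 : ∀ j, D.F 4 j = ⊤ := fun j => by rw [eq_top_iff, ← hCt]; exact hCF j
    have hG' : D.tri.Good 1 0 :=
      { top := ht
        le := hle
        z0 := fun _ j => by rw [eq_bot_iff, ← h]; exact hF1 j
        z1 := fun _ j => by
          have := hXp j
          rw [h, sup_bot_eq, sup_bot_eq] at this
          exact eq_bot_iff.2 this }
    have := Tri.good_bound le_rfl le_rfl hG' (tri_indec hI h0 h4)
    rwa [tri_f h0 h4] at this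
  · right
    intro W hW hp
    have hXt : X = ⊤ := by have := hC.1.sup_eq_top; rwa [h, sup_bot_eq] at this
    apply eq_of_le_of_d le_top
    have := hmax W ⟨hW, hp⟩
    rw [hXt] at this; omega

theorem f5 {D : QF k V} (h0 : ∀ j, D.F 0 j = ⊥) (h5 : ∀ j, D.F 5 j = ⊤) : D.f = D.g 1 + D.g 2 + D.g 3 + D.g 4 := by
  rw [f_eq h0 h5, show Finset.Ioo (0:ℤ) 5 = {1, 2, 3, 4} by decide, Finset.sum_insert (by simp),
    Finset.sum_insert (by simp), Finset.sum_insert (by simp), Finset.sum_singleton]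
  ring

theorem special {D : QF k V} (hI : D.Indec) (h0 : ∀ j, D.F 0 j = ⊥) (h5 : ∀ j, D.F 5 j = ⊤) :
    |D.f| ≤ 6 ∨ ∀ j, D.F 1 j ≤ D.F 4 (j+2) := by
  by_cases hall : ∀ j, D.F 1 j ≤ D.F 4 (j+2)
  · exact Or.inr hall
  left
  push Not at hall
  obtain ⟨j, hj⟩ := hall
  obtain ⟨e, he, hne⟩ := SetLike.not_le_iff_exists.1 hj
  obtain ⟨f, hf0, hf⟩ := Submodule.exists_le_ker_of_notMem hne
  have he0 : e ≠ 0 := fun h => hf0 (by rw [h, map_zero])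
  have hc : IsCompl (k ∙ e) (LinearMap.ker f) := by
    rw [isCompl_iff, disjoint_iff, codisjoint_iff]
    constructor
    · rw [eq_bot_iff]
      rintro x ⟨hx, hx'⟩
      obtain ⟨c, rfl⟩ := Submodule.mem_span_singleton.1 hx
      have : c * f e = 0 := by simpa using hx'
      rcases mul_eq_zero.1 this with h | h
      · simp [h]
      · exact absurd h hf0
    · rw [eq_top_iff]
      intro x _
      refine Submodule.mem_sup.2 ⟨(f x / f e) • e, Submodule.smul_mem _ _ (Submodule.mem_span_singleton_self e),
        x - (f x / f e) • e, ?_, by abel⟩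
      rw [LinearMap.mem_ker, map_sub, map_smul, smul_eq_mul, div_mul_cancel₀ _ hf0, sub_self]
  have spanle : ∀ {F : Submodule k V}, e ∈ F → (k ∙ e) ≤ F := fun h => (Submodule.span_singleton_le_iff_mem _ _).2 h
  have hge : ∀ {F : Submodule k V}, e ∈ F → F ≤ (F ⊓ (k ∙ e)) ⊔ (F ⊓ LinearMap.ker f) := fun h =>
    split_of_ge hc.sup_eq_top (spanle h)
  have mA : ∀ i : ℤ, 1 ≤ i → e ∈ D.F i j := fun i hi => D.mono' hi j he
  have mB : ∀ i : ℤ, 3 ≤ i → e ∈ D.F i (j+1) := fun i hi => D.mono' hi (j+1) (D.sh 1 j he)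
  have mB' : ∀ i : ℤ, i ≤ 2 → D.F i (j+1) ≤ LinearMap.ker f := fun i hi => by
    refine le_trans ?_ hf
    refine (D.mono' hi _).trans ?_
    have := D.sh 2 (j+1)
    rw [j11] at this; exact this
  have mC : ∀ i : ℤ, i ≤ 4 → D.F i (j+2) ≤ LinearMap.ker f := fun i hi => (D.mono' hi _).trans hf
  have hspl : D.Spl (k ∙ e) (LinearMap.ker f) := by
    apply spl5 h0 h5 hc
    · intro l
      rcases jall j l with rfl | rfl | rfl
      · exact hge (mA _ (by norm_num))
      · exact le_split_right (mB' _ (by norm_num))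
      · exact le_split_right (mC _ (by norm_num))
    · intro l
      rcases jall j l with rfl | rfl | rfl
      · exact hge (mA _ (by norm_num))
      · exact le_split_right (mB' _ (by norm_num))
      · exact le_split_right (mC _ (by norm_num))
    · intro l
      rcases jall j l with rfl | rfl | rfl
      · exact hge (mA _ (by norm_num))
      · exact hge (mB _ (by norm_num))
      · exact le_split_right (mC _ (by norm_num))
    · intro l
      rcases jall j l with rfl | rfl | rfl
      · exact hge (mA _ (by norm_num))
      · exact hge (mB _ (by norm_num))
      · exact le_split_right (mC _ (by norm_num))
  have hk : LinearMap.ker f = ⊥ := by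
    rcases hI.2 _ _ hspl with h | h
    · exfalso; apply he0; simpa using h
    · exact h
  have hst : (k ∙ e) = ⊤ := by
    have := hc.sup_eq_top; rwa [hk, sup_bot_eq] at this
  have hv : d (⊤ : Submodule k V) = 1 := by rw [← hst]; exact d_span_singleton he0
  have dA : ∀ i : ℤ, 1 ≤ i → d (D.F i j) = 1 := fun i hi => by
    rw [← hv]; congr 1; rw [eq_top_iff, ← hst]; exact spanle (mA i hi)
  have dB : ∀ i : ℤ, 3 ≤ i → d (D.F i (j+1)) = 1 := fun i hi => by
    rw [← hv]; congr 1; rw [eq_top_iff, ← hst]; exact spanle (mB i hi)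
  have dB' : ∀ i : ℤ, i ≤ 2 → d (D.F i (j+1)) = 0 := fun i hi => by
    have := mB' i hi; rw [hk, le_bot_iff] at this; rw [this, d_bot]
  have dC : ∀ i : ℤ, i ≤ 4 → d (D.F i (j+2)) = 0 := fun i hi => by
    have := mC i hi; rw [hk, le_bot_iff] at this; rw [this, d_bot]
  rw [f5 h0 h5]
  unfold g
  have a1 := dA 1 (by norm_num); have a2 := dA 2 (by norm_num); have a3 := dA 3 (by norm_num); have a4 := dA 4 (by norm_num)
  have b1 := dB' 1 (by norm_num); have b2 := dB' 2 (by norm_num); have b3 := dB 3 (by norm_num); have b4 := dB 4 (by norm_num)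
  have c1 := dC 1 (by norm_num); have c2 := dC 2 (by norm_num); have c3 := dC 3 (by norm_num); have c4 := dC 4 (by norm_num)
  have h012 : ∀ j : Fin 3, j = 0 ∨ j = 1 ∨ j = 2 := by decide
  have := h012 j
  rw [abs_le]
  rcases this with rfl | rfl | rfl
  · simp only [zero_add] at *; omega
  · rw [show (1:Fin 3) + 1 = 2 from rfl] at *; rw [show (1:Fin 3) + 2 = 0 from rfl] at *; omega
  · rw [show (2:Fin 3) + 1 = 0 from rfl] at *; rw [show (2:Fin 3) + 2 = 1 from rfl] at *; omega

end QF
end St6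

set_option linter.unusedSectionVars false
set_option linter.unusedVariables false
namespace St6
open Module Submodule

variable {k : Type u} [Field k] {V : Type u} [AddCommGroup V] [Module k V] [FiniteDimensional k V]
  {V' : Type u} [AddCommGroup V'] [Module k V'] [FiniteDimensional k V']

theorem mem_iSup3 {P : Fin 3 → Submodule k V} (j : Fin 3) {x : V} (hx : x ∈ ⨆ j, P j) :
    ∃ a ∈ P j, ∃ b ∈ P (j+1), ∃ c ∈ P (j+2), x = a + b + c := by
  have h : (⨆ j, P j) ≤ P j ⊔ P (j+1) ⊔ P (j+2) := by
    apply iSup_le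
    intro l
    rcases jall j l with rfl | rfl | rfl
    · exact le_sup_left.trans le_sup_left
    · exact le_sup_right.trans le_sup_left
    · exact le_sup_right
  obtain ⟨y, hy, c, hc, e⟩ := Submodule.mem_sup.1 (h hx)
  obtain ⟨a, ha, b, hb, e'⟩ := Submodule.mem_sup.1 hy
  exact ⟨a, ha, b, hb, c, hc, by rw [e', e]⟩

namespace QF

structure Phi (D : QF k V) (W : Submodule k V) : Prop where
  p1 : W ≤ ⨆ j, D.F 2 j ⊓ W
  p2 : d W = ∑ j, d (D.F 2 j ⊓ W)
  p3 : ∀ j, d (D.F 3 j ⊓ W) = d (D.F 2 j ⊓ W) + d (D.F 2 (j+2) ⊓ W)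
  p4 : ∀ l, D.F 2 l ⊓ D.F 3 (l+2) ⊓ W = ⊥
  p5 : ∀ U : Submodule k V, (∀ j, ∀ e ∈ D.F 2 j, ∀ e' ∈ D.F 2 (j+2), e + e' ∈ D.F 3 (j+1) → e' ∈ U → e ∈ U) → W ≤ U

theorem phi_bot (D : QF k V) : D.Phi ⊥ where
  p1 := bot_le
  p2 := by simp
  p3 j := by simp
  p4 l := by simp
  p5 U _ := bot_le

theorem phi_step {D : QF k V} (hle : ∀ W, D.tri.L 1 0 W ≤ 0)
    (hpc : ∀ W, D.tri.L 1 0 W = 0 → D.PC W → W = ⊤) {W : Submodule k V} (h : D.Phi W) (hW : W ≠ ⊤) :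
    ∃ W', D.Phi W' ∧ d W < d W' := by
  have hsB : ∑ j, d (D.F 3 j ⊓ W) = 2 * ∑ j, d (D.F 2 j ⊓ W) := by
    rw [sum3 0, sum3 0, h.p3, h.p3, h.p3, j12, j22]; ring
  have hc : D.tri.L 1 0 W = 0 := by
    rw [tri_L10, Finset.sum_add_distrib, hsB, h.p2]; ring
  have hnp : ¬ D.PC W := fun hp => hW (hpc W hc hp)
  unfold PC at hnp
  push Not at hnp
  obtain ⟨j, hj⟩ := hnp
  obtain ⟨x, ⟨hx1, hx2⟩, hxW⟩ := SetLike.not_le_iff_exists.1 hj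
  obtain ⟨a, ha, w, hw, ea⟩ := Submodule.mem_sup.1 hx1
  obtain ⟨b, hb, w', hw', eb⟩ := Submodule.mem_sup.1 hx2
  obtain ⟨y0, hy0, y1, hy1, y2, hy2, ey⟩ := mem_iSup3 j (h.p1 (W.sub_mem hw hw'))
  have haW : a ∉ W := fun h' => hxW (by rw [← ea]; exact W.add_mem h' hw)
  obtain ⟨e, he, heW, e', he', he'W, hB⟩ : ∃ e ∈ D.F 2 j, e ∉ W ∧ ∃ e' ∈ D.F 2 (j+2), e' ∈ W ∧ e + e' ∈ D.F 3 (j+1) := by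
    refine ⟨a + y0, add_mem ha hy0.1, fun h' => haW ?_, y2, hy2.1, hy2.2, ?_⟩
    · have := W.sub_mem h' hy0.2; rwa [add_sub_cancel_right] at this
    · have hy1B : y1 ∈ D.F 3 (j+1) := D.mono' (by norm_num : (2:ℤ) ≤ 3) _ hy1.1
      have e1 : a + y0 + y2 = b - y1 := by
        have h1 : a + (w - w') = b := by
          have : a + w = b + w' := ea.trans eb.symm
          rw [← add_sub_assoc, this, add_sub_cancel_right]
        rw [← h1, ey]; abel
      rw [e1]; exact sub_mem hb hy1B
  set W' := W ⊔ (k ∙ e) with hW'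
  have hWW' : W ≤ W' := le_sup_left
  have heW' : e ∈ W' := Submodule.mem_sup_right (Submodule.mem_span_singleton_self e)
  have he'W' : e' ∈ W' := hWW' he'W
  have hd' : d W' ≤ d W + 1 := by
    have hs := d_sup_inf W (k ∙ e)
    rw [← hW'] at hs
    have h1 : d (k ∙ e) = 1 := d_span_singleton (fun h0 => heW (by rw [h0]; exact zero_mem _))
    have := d_nonneg (W ⊓ (k ∙ e))
    omega
  have hlt : d W < d W' := d_lt (lt_of_le_of_ne hWW' fun h' => heW (by rw [h']; exact heW'))
  have up : ∀ {F : Submodule k V} {z : V}, z ∈ F → z ∈ W' → z ∉ W → d (F ⊓ W) < d (F ⊓ W') := fun {F z} h1 h2 h3 =>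
    d_lt (lt_of_le_of_ne (inf_le_inf_left _ hWW') fun h' => h3 (by
      have : z ∈ F ⊓ W := by rw [h']; exact ⟨h1, h2⟩
      exact this.2))
  have mo : ∀ F : Submodule k V, d (F ⊓ W) ≤ d (F ⊓ W') := fun F => d_mono (inf_le_inf_left _ hWW')
  have uA := up he heW' heW
  have uB := up (D.mono' (by norm_num : (2:ℤ) ≤ 3) _ he) heW' heW
  have uB1 := up hB (add_mem heW' he'W') (fun h' => heW (by
    have := W.sub_mem h' he'W; rwa [add_sub_cancel_right] at this))
  have mA1 := mo (D.F 2 (j+1)); have mA2 := mo (D.F 2 (j+2)); have mB2 := mo (D.F 3 (j+2))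
  have hL := hle W'
  rw [tri_L10, sum3 j] at hL
  rw [tri_L10, sum3 j] at hc
  have p2 := h.p2
  rw [sum3 j] at p2
  have q0 := h.p3 j; have q1 := h.p3 (j+1); have q2 := h.p3 (j+2)
  rw [j12] at q1; rw [j22] at q2
  have eA : d (D.F 2 j ⊓ W') = d (D.F 2 j ⊓ W) + 1 := by omega
  have eA1 : d (D.F 2 (j+1) ⊓ W') = d (D.F 2 (j+1) ⊓ W) := by omega
  have eA2 : d (D.F 2 (j+2) ⊓ W') = d (D.F 2 (j+2) ⊓ W) := by omega
  have eB : d (D.F 3 j ⊓ W') = d (D.F 3 j ⊓ W) + 1 := by omega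
  have eB1 : d (D.F 3 (j+1) ⊓ W') = d (D.F 3 (j+1) ⊓ W) + 1 := by omega
  have eB2 : d (D.F 3 (j+2) ⊓ W') = d (D.F 3 (j+2) ⊓ W) := by omega
  refine ⟨W', ⟨?_, ?_, ?_, ?_, ?_⟩, hlt⟩
  · apply sup_le
    · exact h.p1.trans (iSup_mono fun l => inf_le_inf_left _ hWW')
    · rw [Submodule.span_singleton_le_iff_mem]
      exact (le_iSup (fun l => D.F 2 l ⊓ W') j) ⟨he, heW'⟩
  · rw [sum3 j]; omega
  · intro l
    rcases jall j l with rfl | rfl | rfl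
    · omega
    · rw [j12]; omega
    · rw [j22]; omega
  · intro l
    rw [eq_bot_iff]
    rintro z ⟨⟨hz1, hz2⟩, hz3⟩
    by_cases hzW : z ∈ W
    · rw [← h.p4 l]; exact ⟨⟨hz1, hz2⟩, hzW⟩
    · exfalso
      have u1 := up hz1 hz3 hzW
      have u2 := up hz2 hz3 hzW
      rcases jall j l with rfl | rfl | rfl
      · omega
      · omega
      · omega
  · intro U hU
    have hWU := h.p5 U hU
    apply sup_le hWU
    rw [Submodule.span_singleton_le_iff_mem]
    exact hU j e he e' he' hB (hWU he'W)

theorem phi_top {D : QF k V} (hle : ∀ W, D.tri.L 1 0 W ≤ 0)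
    (hpc : ∀ W, D.tri.L 1 0 W = 0 → D.PC W → W = ⊤) : D.Phi ⊤ := by
  obtain ⟨W, hW, hmax⟩ := exists_max (fun W : Submodule k V => D.Phi W) (fun W => d W) (finrank k V)
    (fun W _ => by rw [← d_top]; exact d_mono le_top) ⟨⊥, D.phi_bot⟩
  by_cases h : W = ⊤
  · rwa [h] at hW
  · obtain ⟨W', h1, h2⟩ := phi_step hle hpc hW h
    have := hmax W' h1
    omega

structure NG (D : QF k V) where
  P : Fin 3 → V →ₗ[k] V
  N : V →ₗ[k] V
  Pmem : ∀ j v, P j v ∈ D.F 2 j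
  Pid : ∀ j, ∀ v ∈ D.F 2 j, P j v = v
  Pz1 : ∀ j, ∀ v ∈ D.F 2 j, P (j+1) v = 0
  Pz2 : ∀ j, ∀ v ∈ D.F 2 j, P (j+2) v = 0
  Psum : ∀ j v, P j v + P (j+1) v + P (j+2) v = v
  Nmem : ∀ j, ∀ v ∈ D.F 2 j, N v ∈ D.F 2 (j+2)
  B : ∀ j v, v ∈ D.F 3 (j+1) ↔ P (j+2) v = N (P j v)
  nil : ∃ n, N ^ n = 0
  dB : ∀ j, d (D.F 3 j) = d (D.F 2 j) + d (D.F 2 (j+2))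

theorem NG.exists {D : QF k V} (h : D.Phi ⊤) : Nonempty D.NG := by
  have p2 := h.p2
  simp only [inf_top_eq] at p2
  have p3 : ∀ j, d (D.F 3 j) = d (D.F 2 j) + d (D.F 2 (j+2)) := fun j => by
    have := h.p3 j; simpa only [inf_top_eq] using this
  have p4 : ∀ l, D.F 2 l ⊓ D.F 3 (l+2) = ⊥ := fun j => by
    have := h.p4 j; simpa only [inf_top_eq] using this
  have p1 : ∀ j v, ∃ a ∈ D.F 2 j, ∃ b ∈ D.F 2 (j+1), ∃ c ∈ D.F 2 (j+2), v = a + b + c := fun j v => by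
    have := mem_iSup3 j (h.p1 (Submodule.mem_top : v ∈ (⊤ : Submodule k V)))
    simpa only [inf_top_eq] using this
  have cA : ∀ j, IsCompl (D.F 2 j) (D.F 2 (j+1) ⊔ D.F 2 (j+2)) := by
    intro j
    have hs : D.F 2 j ⊔ (D.F 2 (j+1) ⊔ D.F 2 (j+2)) = ⊤ := by
      rw [eq_top_iff]
      intro v _
      obtain ⟨a, ha, b, hb, c, hc, e⟩ := p1 j v
      rw [e, add_assoc]
      exact Submodule.add_mem_sup ha (Submodule.add_mem_sup hb hc)
    have h1 := d_sup_inf (D.F 2 j) (D.F 2 (j+1) ⊔ D.F 2 (j+2))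
    have h2 := d_sup_inf (D.F 2 (j+1)) (D.F 2 (j+2))
    have h3 := d_nonneg (D.F 2 (j+1) ⊓ D.F 2 (j+2))
    rw [hs, p2, sum3 j] at h1
    exact IsCompl.of_eq (d_eq_zero (by omega)) hs
  have cB : ∀ j, IsCompl (D.F 2 j) (D.F 3 (j+2)) := by
    intro j
    have h1 := d_sup_inf (D.F 2 j) (D.F 3 (j+2))
    rw [p4, d_bot, p3, j22] at h1
    rw [sum3 j] at p2
    exact IsCompl.of_eq (p4 j) (eq_of_le_of_d le_top (by omega))
  let P : Fin 3 → V →ₗ[k] V := fun j => (D.F 2 j).projection _ (cA j)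
  let Q : Fin 3 → V →ₗ[k] V := fun j => (D.F 2 j).projection _ (cB j)
  have Pmem : ∀ j v, P j v ∈ D.F 2 j := fun j v => Submodule.projection_apply_mem (cA j) v
  have Qmem : ∀ j v, Q j v ∈ D.F 2 j := fun j v => Submodule.projection_apply_mem (cB j) v
  have Pid : ∀ j, ∀ v ∈ D.F 2 j, P j v = v := fun j v hv => Submodule.projection_apply_of_mem_left (cA j) hv
  have Qid : ∀ j, ∀ v ∈ D.F 2 j, Q j v = v := fun j v hv => Submodule.projection_apply_of_mem_left (cB j) hv
  have Qz : ∀ j v, Q j v = 0 ↔ v ∈ D.F 3 (j+2) := fun j v => Submodule.projection_apply_eq_zero_iff (cB j)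
  have Pz1 : ∀ j, ∀ v ∈ D.F 2 j, P (j+1) v = 0 := fun j v hv => by
    rw [show P (j+1) v = (D.F 2 (j+1)).projection _ (cA (j+1)) v from rfl, Submodule.projection_apply_eq_zero_iff]
    apply Submodule.mem_sup_right; rwa [j12]
  have Pz2 : ∀ j, ∀ v ∈ D.F 2 j, P (j+2) v = 0 := fun j v hv => by
    rw [show P (j+2) v = (D.F 2 (j+2)).projection _ (cA (j+2)) v from rfl, Submodule.projection_apply_eq_zero_iff]
    apply Submodule.mem_sup_left; rwa [j21]
  have Psum : ∀ j v, P j v + P (j+1) v + P (j+2) v = v := by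
    intro j v
    obtain ⟨a, ha, b, hb, c, hc, e⟩ := p1 j v
    have b1 := Pz1 _ b hb; have b2 := Pz2 _ b hb
    have c1 := Pz1 _ c hc; have c2 := Pz2 _ c hc
    rw [j11] at b1; rw [j12] at b2; rw [j21] at c1; rw [j22] at c2
    rw [e, map_add, map_add, map_add, map_add, map_add, map_add, Pid _ a ha, Pz1 _ a ha, Pz2 _ a ha,
      Pid _ b hb, Pid _ c hc, b1, b2, c1, c2]
    abel
  let N : V →ₗ[k] V := - ∑ j, Q (j+2) ∘ₗ P j
  have Nv : ∀ j, ∀ v ∈ D.F 2 j, N v = - Q (j+2) v := by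
    intro j v hv
    have : ∀ l, l ≠ j → (Q (l+2) ∘ₗ P l) v = 0 := by
      intro l hl
      rw [LinearMap.comp_apply]
      rcases jall j l with rfl | rfl | rfl
      · exact absurd rfl hl
      · rw [Pz1 _ v hv, map_zero]
      · rw [Pz2 _ v hv, map_zero]
    change (- ∑ j, Q (j+2) ∘ₗ P j) v = _
    rw [LinearMap.neg_apply, LinearMap.sum_apply, Finset.sum_eq_single j (fun l _ hl => this l hl) (by simp),
      LinearMap.comp_apply, Pid _ v hv]
  have hB : ∀ j v, v ∈ D.F 3 (j+1) ↔ P (j+2) v = N (P j v) := by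
    intro j v
    rw [Nv j _ (Pmem j v)]
    have hq := Qz (j+2) v
    rw [j22] at hq
    rw [← hq]
    have h1 : Q (j+2) (P (j+1) v) = 0 := by
      rw [Qz, j22]; exact D.mono' (by norm_num : (2:ℤ) ≤ 3) _ (Pmem (j+1) v)
    have h2 : Q (j+2) v = Q (j+2) (P j v) + P (j+2) v := by
      conv_lhs => rw [← Psum j v]
      rw [map_add, map_add, h1, Qid _ _ (Pmem _ v), add_zero]
    rw [h2, add_eq_zero_iff_eq_neg, ← neg_eq_iff_eq_neg, eq_comm]
  refine ⟨⟨P, N, Pmem, Pid, Pz1, Pz2, Psum, ?_, hB, ?_, p3⟩⟩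
  · intro j v hv
    rw [Nv j v hv]; exact neg_mem (Qmem _ _)
  · refine ⟨finrank k V, ?_⟩
    have : (⊤ : Submodule k V) ≤ LinearMap.ker (N ^ finrank k V) := by
      apply h.p5
      intro j e he e' he' hee h0
      have h1 := (hB j _).1 hee
      have z := Pz1 _ e' he'
      rw [j21] at z
      rw [map_add, map_add, Pz2 _ e he, Pid _ e he, z, Pid _ e' he', zero_add, add_zero] at h1
      rw [← Module.End.ker_pow_eq_ker_pow_finrank_of_le (Nat.le_succ (finrank k V)), LinearMap.mem_ker,
        Nat.succ_eq_add_one, pow_succ, Module.End.mul_apply, ← h1]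
      exact h0
    ext v
    exact this (Submodule.mem_top)

end QF
end St6

set_option linter.unusedSectionVars false
set_option linter.unusedVariables false
namespace St6
open Module Submodule

variable {k : Type u} [Field k] {V : Type u} [AddCommGroup V] [Module k V] [FiniteDimensional k V]
  {V' : Type u} [AddCommGroup V'] [Module k V'] [FiniteDimensional k V']

def sft (j : Fin 3) : Fin 3 := j + 2
def dg (j : Fin 3) (n : ℕ) : Fin 3 := sft^[n] j

theorem sft_inj : Function.Injective sft := by decide
theorem dg_inj (n : ℕ) {a b : Fin 3} (h : dg a n = dg b n) : a = b := sft_inj.iterate n h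
theorem dg_add (j : Fin 3) (a b : ℕ) : dg (dg j a) b = dg j (a + b) := by
  unfold dg; rw [← Function.iterate_add_apply, add_comm]
theorem dg_succ (j : Fin 3) (n : ℕ) : dg j (n+1) = dg j n + 2 := by
  unfold dg; rw [Function.iterate_succ_apply']; rfl
theorem dg_zero (j : Fin 3) : dg j 0 = j := rfl

/-- linear independence of a nilpotent string -/
theorem string_indep {N : V →ₗ[k] V} {m : ℕ} (hN : N ^ (m+1) = 0) {e : V} (he : (N ^ m) e ≠ 0) (c : ℕ → k)
    (hc : ∑ i ∈ Finset.range (m+1), c i • (N ^ i) e = 0) : ∀ i, i ≤ m → c i = 0 := by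
  intro i
  induction i using Nat.strong_induction_on with
  | _ i ih =>
    intro hi
    have h1 : (N ^ (m - i)) (∑ i ∈ Finset.range (m+1), c i • (N ^ i) e) = 0 := by rw [hc, map_zero]
    rw [map_sum, Finset.sum_eq_single i] at h1
    · rw [map_smul, ← Module.End.mul_apply, ← pow_add, Nat.sub_add_cancel hi] at h1
      exact (smul_eq_zero.1 h1).resolve_right he
    · intro b hb hbi
      rw [Finset.mem_range] at hb
      rcases lt_or_gt_of_ne hbi with h | h
      · rw [ih b h (by omega), zero_smul, map_zero]
      · rw [map_smul, ← Module.End.mul_apply, ← pow_add, show m - i + b = (m - i + b - (m+1)) + (m+1) by omega, pow_add,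
          hN, mul_zero, LinearMap.zero_apply, smul_zero]
    · intro h; exact absurd (Finset.mem_range.2 (by omega)) h

theorem spl_of_idem {F : Submodule k V} {p : V →ₗ[k] V} (hp : ∀ v, p (p v) = p v) (hF : ∀ v ∈ F, p v ∈ F) :
    F ≤ (F ⊓ LinearMap.range p) ⊔ (F ⊓ LinearMap.ker p) := by
  intro v hv
  refine Submodule.mem_sup.2 ⟨p v, ⟨hF v hv, ⟨v, rfl⟩⟩, v - p v, ⟨sub_mem hv (hF v hv), ?_⟩, by abel⟩
  change p (v - p v) = 0
  rw [map_sub, hp, sub_self]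

theorem compl_of_idem {p : V →ₗ[k] V} (hp : ∀ v, p (p v) = p v) : IsCompl (LinearMap.range p) (LinearMap.ker p) := by
  apply IsCompl.of_eq
  · rw [eq_bot_iff]
    rintro _ ⟨⟨v, rfl⟩, h⟩
    have h' : p (p v) = 0 := h
    rw [hp] at h'
    rw [h']; exact zero_mem _
  · rw [eq_top_iff]
    intro v hv
    have := spl_of_idem (F := ⊤) hp (fun _ _ => Submodule.mem_top) hv
    rwa [top_inf_eq, top_inf_eq] at this

namespace QF
namespace NG
variable {D : QF k V} (G : D.NG)

theorem Pne {j l : Fin 3} {v : V} (hv : v ∈ D.F 2 j) (h : l ≠ j) : G.P l v = 0 := by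
  rcases jall j l with rfl | rfl | rfl
  · exact absurd rfl h
  · exact G.Pz1 _ v hv
  · exact G.Pz2 _ v hv

theorem PN (j : Fin 3) (v : V) : G.P (j+2) (G.N v) = G.N (G.P j v) := by
  have h0 := G.Nmem _ _ (G.Pmem j v)
  have h1 := G.Nmem _ _ (G.Pmem (j+1) v)
  have h2 := G.Nmem _ _ (G.Pmem (j+2) v)
  rw [j12] at h1; rw [j22] at h2
  have z1 := G.Pz2 _ _ h1
  have z2 := G.Pz1 _ _ h2
  rw [j11] at z2
  conv_lhs => rw [← G.Psum j v]
  rw [map_add, map_add, map_add, map_add, z1, z2, G.Pid _ _ h0, add_zero, add_zero]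

theorem PN' (j : Fin 3) (v : V) : G.P j (G.N v) = G.N (G.P (j+1) v) := by
  have := G.PN (j+1) v; rwa [j12] at this

theorem PNp (j : Fin 3) (n : ℕ) (v : V) : G.P (dg j n) ((G.N ^ n) v) = (G.N ^ n) (G.P j v) := by
  induction n with
  | zero => rfl
  | succ n ih => rw [pow_succ', Module.End.mul_apply, Module.End.mul_apply, dg_succ, G.PN, ih]

theorem Npmem {j : Fin 3} {v : V} (hv : v ∈ D.F 2 j) (n : ℕ) : (G.N ^ n) v ∈ D.F 2 (dg j n) := by
  rw [← G.Pid j v hv, ← G.PNp]; exact G.Pmem _ _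

theorem N1 {j : Fin 3} {v : V} (hv : v ∈ D.F 1 j) : G.N v = 0 := by
  have h2 : v ∈ D.F 2 j := D.mono' (by norm_num : (1:ℤ) ≤ 2) j hv
  have h3 := (G.B j v).1 (D.sh 1 j hv)
  rw [G.Pid j v h2, G.Pz2 j v h2] at h3
  exact h3.symm

theorem A4 (j : Fin 3) : D.F 2 j ≤ D.F 4 j := D.mono' (by norm_num) j
theorem A4' (j : Fin 3) : D.F 2 (j+2) ≤ D.F 4 j := by
  have := D.sh 2 (j+2); rw [j21] at this; exact this

theorem F4 (j : Fin 3) (v : V) : v ∈ D.F 4 j ↔ G.P (j+1) v ∈ D.F 4 j := by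
  have h0 := A4 j (G.Pmem j v)
  have h2 := A4' j (G.Pmem (j+2) v)
  constructor
  · intro h
    have e : G.P (j+1) v = v - G.P j v - G.P (j+2) v := by
      conv_rhs => rw [← G.Psum j v]
      simp only [map_add]
      have e1 := G.Psum j v
      rw [← map_add, ← map_add, ← map_add, ← map_add, e1]
      refine Eq.trans ?_ (congrArg (fun z => z - G.P j v - G.P (j+2) v) e1)
      abel
    rw [e]; exact sub_mem (sub_mem h h0) h2
  · intro h
    rw [← G.Psum j v]; exact add_mem (add_mem h0 h) h2

theorem N4 {j : Fin 3} {w : V} (hw : w ∈ D.F 2 (j+1)) : G.N w ∈ D.F 4 (j+2) := by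
  have hN := G.Nmem _ w hw
  have hB : w + G.N w ∈ D.F 3 (j+1+1) := by
    rw [G.B, map_add, map_add, map_add, G.Pid _ _ hw, G.Pz2 _ _ hw, G.Pid _ _ hN]
    have := G.Pz1 _ _ hN
    rw [j21] at this
    rw [this, zero_add, map_zero, add_zero]
  rw [j11] at hB
  have h4 := D.mono' (by norm_num : (3:ℤ) ≤ 4) _ hB
  have h4' : w ∈ D.F 4 (j+2) := by
    have := D.sh 2 (j+1) hw; rw [j11] at this; exact this
  have := sub_mem h4 h4'
  rwa [add_sub_cancel_left] at this

theorem NP4 (j : Fin 3) (v : V) : G.P j (G.N v) ∈ D.F 4 (j+2) := by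
  rw [G.PN']; exact G.N4 (G.Pmem _ _)

theorem string (hI : D.Indec) (h0 : ∀ j, D.F 0 j = ⊥) (h5 : ∀ j, D.F 5 j = ⊤)
    {m : ℕ} (hN : G.N ^ (m+1) = 0) {j0 : Fin 3} {e : V} (he : e ∈ D.F 2 j0)
    (φ : V →ₗ[k] k) (hφ1 : φ ((G.N ^ m) e) = 1) (hφ0 : ∀ i, i < m → φ ((G.N ^ i) e) = 0)
    (hφP : ∀ v, φ (G.P (dg j0 m) v) = φ v)
    (hK : (∀ j, ∀ v ∈ D.F 1 j, φ v = 0) ∨ (G.N ^ m) e ∈ D.F 1 (dg j0 m))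
    (hH : e ∈ D.F 4 (j0+2) ∨ ∀ j, ∀ v ∈ D.F 2 j, v ∈ D.F 4 (j+2) → φ ((G.N ^ m) v) = 0) (v : V) :
    v = ∑ i ∈ Finset.range (m+1), φ ((G.N ^ (m - i)) v) • (G.N ^ i) e := by
  have hNz : ∀ n, m < n → ∀ v, (G.N ^ n) v = 0 := fun n hn v => by
    rw [show n = (n - (m+1)) + (m+1) by omega, pow_add, hN, mul_zero, LinearMap.zero_apply]
  let π : V →ₗ[k] V := ∑ i ∈ Finset.range (m+1), (φ ∘ₗ (G.N ^ (m-i))).smulRight ((G.N ^ i) e)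
  have hπ : ∀ v, π v = ∑ i ∈ Finset.range (m+1), φ ((G.N ^ (m - i)) v) • (G.N ^ i) e := fun v => by
    simp [π, LinearMap.sum_apply]
  have πN : ∀ v, π (G.N v) = G.N (π v) := by
    intro v
    rw [hπ, hπ, map_sum, Finset.sum_range_succ', Finset.sum_range_succ, map_smul]
    rw [← Module.End.mul_apply, ← pow_succ, Nat.sub_zero, hN, ← Module.End.mul_apply, ← pow_succ', hN,
      LinearMap.zero_apply, map_zero, zero_smul, LinearMap.zero_apply, smul_zero]
    congr 1
    apply Finset.sum_congr rfl
    intro i hi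
    rw [Finset.mem_range] at hi
    rw [map_smul, ← Module.End.mul_apply, ← pow_succ, ← Module.End.mul_apply, ← pow_succ',
      show m - (i+1) + 1 = m - i by omega]
  have πP : ∀ j v, π (G.P j v) = G.P j (π v) := by
    intro j v
    rw [hπ, hπ, map_sum]
    apply Finset.sum_congr rfl
    intro i hi
    rw [Finset.mem_range] at hi
    rw [map_smul]
    have hl : dg (dg j0 i) (m - i) = dg j0 m := by rw [dg_add]; congr 1; omega
    by_cases hj : j = dg j0 i
    · rw [hj, G.Pid _ _ (G.Npmem he i), ← G.PNp, hl, hφP]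
    · rw [G.Pne (G.Npmem he i) hj, smul_zero, ← hφP, G.Pne (G.Npmem (G.Pmem j v) (m-i)), map_zero, zero_smul]
      intro h
      rw [← hl] at h
      exact hj (dg_inj _ h).symm
  have πe : π e = e := by
    rw [hπ, Finset.sum_eq_single 0]
    · rw [Nat.sub_zero, hφ1, one_smul]; rfl
    · intro i hi h
      rw [Finset.mem_range] at hi
      rw [hφ0 _ (by omega), zero_smul]
    · intro h; exact absurd (Finset.mem_range.2 (by omega)) h
  have πNe : ∀ i, π ((G.N ^ i) e) = (G.N ^ i) e := by
    intro i
    induction i with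
    | zero => exact πe
    | succ i ih => rw [pow_succ', Module.End.mul_apply, πN, ih]
  have πid : ∀ v, π (π v) = π v := by
    intro v
    conv_lhs => rw [hπ v]
    rw [map_sum, hπ v]
    apply Finset.sum_congr rfl
    intro i _
    rw [map_smul, πNe]
  have m2 : ∀ j, ∀ v ∈ D.F 2 j, π v ∈ D.F 2 j := fun j v hv => by
    rw [← G.Pid j v hv, πP]; exact G.Pmem _ _
  have m1 : ∀ j, ∀ v ∈ D.F 1 j, π v ∈ D.F 1 j := fun j v hv => by
    have hv2 : v ∈ D.F 2 j := D.mono' (by norm_num : (1:ℤ) ≤ 2) j hv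
    have hz := G.N1 hv
    have e1 : π v = φ v • (G.N ^ m) e := by
      rw [hπ, Finset.sum_eq_single m]
      · rw [Nat.sub_self]; rfl
      · intro i hi h
        rw [Finset.mem_range] at hi
        rw [show m - i = (m - i - 1) + 1 by omega, pow_succ, Module.End.mul_apply, hz, map_zero, map_zero, zero_smul]
      · intro h; exact absurd (Finset.mem_range.2 (by omega)) h
    rw [e1]
    rcases hK with h | h
    · rw [h j v hv, zero_smul]; exact zero_mem _
    · by_cases hj : dg j0 m = j
      · rw [hj] at h; exact Submodule.smul_mem _ _ h
      · rw [← hφP, G.Pne hv2 hj, map_zero, zero_smul]; exact zero_mem _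
  have m3 : ∀ j, ∀ v ∈ D.F 3 j, π v ∈ D.F 3 j := fun j v hv => by
    have h1 := (G.B (j+2) v)
    have h2 := (G.B (j+2) (π v))
    rw [j21] at h1 h2
    rw [h2, ← πP, ← πP, ← πN, h1.1 hv]
  have m4a : ∀ l, ∀ u ∈ D.F 2 l, u ∈ D.F 4 (l+2) → π u ∈ D.F 4 (l+2) := by
    intro l u hu hu4
    rw [← G.Pid l u hu, πP, hπ, map_sum]
    apply Submodule.sum_mem
    intro i hi
    rw [map_smul]
    rcases i with _ | i
    · rw [pow_zero, Module.End.one_apply, Nat.sub_zero]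
      rcases hH with h | h
      · by_cases hl : l = j0
        · rw [hl, G.Pid _ _ he]; exact Submodule.smul_mem _ _ h
        · rw [G.Pne he hl, smul_zero]; exact zero_mem _
      · rw [h l u hu hu4, zero_smul]; exact zero_mem _
    · rw [pow_succ', Module.End.mul_apply]
      exact Submodule.smul_mem _ _ (G.NP4 _ _)
  have m4 : ∀ j, ∀ v ∈ D.F 4 j, π v ∈ D.F 4 j := fun j v hv => by
    rw [G.F4, ← πP]
    have h := m4a (j+1) (G.P (j+1) v) (G.Pmem _ _)
    rw [j12] at h
    exact h ((G.F4 j v).1 hv)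
  have hs : D.Spl (LinearMap.range π) (LinearMap.ker π) :=
    spl5 h0 h5 (compl_of_idem πid) (fun j => spl_of_idem πid (m1 j)) (fun j => spl_of_idem πid (m2 j))
      (fun j => spl_of_idem πid (m3 j)) (fun j => spl_of_idem πid (m4 j))
  have hk : LinearMap.ker π = ⊥ := by
    rcases hI.2 _ _ hs with h | h
    · exfalso
      have : e ∈ LinearMap.range π := ⟨e, πe⟩
      rw [h, Submodule.mem_bot] at this
      rw [this, map_zero, map_zero] at hφ1
      exact zero_ne_one hφ1
    · exact h
  have := LinearMap.ker_eq_bot.1 hk (πid v)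
  rw [hπ] at this
  exact this.symm

end NG
end QF
end St6

set_option linter.unusedSectionVars false
set_option linter.unusedVariables false
namespace St6
open Module Submodule

variable {k : Type u} [Field k] {V : Type u} [AddCommGroup V] [Module k V] [FiniteDimensional k V]
  {V' : Type u} [AddCommGroup V'] [Module k V'] [FiniteDimensional k V']

theorem num18 (k1 a b c4 h n c : Fin 3 → ℤ) (l j0 : Fin 3) (x : ∀ j, c4 j = a j + a (j+2) + h (j+1))
    (y : ∀ j, b j = a j + a (j+2)) (dm : ∀ j, n j = a (j+1) - c (j+1)) (hh : ∀ j, n j ≤ h j) (hh' : ∀ j, h j ≤ a j)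
    (hn : ∀ j, a j = n j + if j = j0 then 1 else 0) (hc : ∀ j, c j = if j = l then 1 else 0)
    (k0 : ∀ j, j ≠ l → k1 j = 0) (kl : k1 l ≤ 1) (kn : 0 ≤ k1 l) :
    |k1 0 + k1 2 - 2 * k1 1 + (a 0 + a 2 - 2 * a 1) + (b 0 + b 2 - 2 * b 1) + (c4 0 + c4 2 - 2 * c4 1)| ≤ 6 := by
  have hk : ∀ j, k1 j = if j = l then k1 l else 0 := fun j => by
    split_ifs with h
    · rw [h]
    · exact k0 j h
  generalize k1 l = kk at *
  rw [Fin.forall_fin_succ, Fin.forall_fin_succ, Fin.forall_fin_succ] at x y dm hh hh' hn hc hk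
  simp only [Fin.succ_zero_eq_one, Fin.succ_one_eq_two, show (0:Fin 3) + 2 = 2 from rfl, show (0:Fin 3) + 1 = 1 from rfl,
    show (1:Fin 3) + 1 = 2 from rfl, show (1:Fin 3) + 2 = 0 from rfl, show (2:Fin 3) + 1 = 0 from rfl,
    show (2:Fin 3) + 2 = 1 from rfl, show Fin.succ (Fin.succ (0 : Fin 1)) = (2 : Fin 3) from rfl,
    show Fin.succ (0 : Fin 2) = (1 : Fin 3) from rfl] at x y dm hh hh' hn hc hk
  have h012 : ∀ j : Fin 3, j = 0 ∨ j = 1 ∨ j = 2 := by decide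
  rw [abs_le]
  clear k0
  rcases h012 l with rfl | rfl | rfl <;> rcases h012 j0 with rfl | rfl | rfl
  all_goals
    simp only [show ((0:Fin 3) = 1) = False by simp, show ((0:Fin 3) = 2) = False by simp, show ((1:Fin 3) = 0) = False by simp,
      show ((1:Fin 3) = 2) = False by simp, show ((2:Fin 3) = 0) = False by simp, show ((2:Fin 3) = 1) = False by simp,
      if_true, if_false] at hn hc hk
    omega

namespace QF
namespace NG
variable {D : QF k V} (G : D.NG)

theorem exists_phi {m : ℕ} (hN : G.N ^ (m+1) = 0) {j0 : Fin 3} {e : V} (he : e ∈ D.F 2 j0)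
    (K : Submodule k V) (hK : ∀ v ∈ K, G.N v = 0) (hne : (G.N ^ m) e ∉ K) :
    ∃ φ : V →ₗ[k] k, φ ((G.N ^ m) e) = 1 ∧ (∀ i, i < m → φ ((G.N ^ i) e) = 0) ∧
      (∀ v, φ (G.P (dg j0 m) v) = φ v) ∧ ∀ v ∈ K, v ∈ D.F 2 (dg j0 m) → φ v = 0 := by
  have hz : (G.N ^ m) e ≠ 0 := fun h => hne (by rw [h]; exact zero_mem _)
  let S : Submodule k V := K ⊔ LinearMap.range (∑ i : Fin m,
    (LinearMap.proj i : (Fin m → k) →ₗ[k] k).smulRight ((G.N ^ (i : ℕ)) e))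
  have hS : (G.N ^ m) e ∉ S := by
    intro h
    obtain ⟨κ, hκ, _, ⟨c, rfl⟩, hs⟩ := Submodule.mem_sup.1 h
    simp only [LinearMap.sum_apply, LinearMap.smulRight_apply, LinearMap.proj_apply] at hs
    have h1 : G.N ((G.N ^ m) e) = 0 := by
      rw [← Module.End.mul_apply, ← pow_succ', hN]; rfl
    rw [← hs, map_add, hK κ hκ, zero_add, map_sum] at h1
    let c' : ℕ → k := fun i => if h : 0 < i ∧ i ≤ m then c ⟨i - 1, by omega⟩ else 0
    have h2 : ∑ i ∈ Finset.range (m+1), c' i • (G.N ^ i) e = 0 := by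
      rw [Finset.sum_range_succ', show c' 0 = 0 by simp [c'], zero_smul, add_zero, ← h1, Finset.sum_range]
      apply Finset.sum_congr rfl
      intro i _
      have : c' (i+1) = c i := by
        simp only [c']
        rw [dif_pos ⟨by omega, by omega⟩]
        congr 1
      rw [this, map_smul, pow_succ', Module.End.mul_apply]
    have h3 := string_indep hN hz c' h2
    have h4 : ∀ i, c i = 0 := by
      intro i
      have := h3 (i+1) (by omega)
      simp only [c'] at this
      rw [dif_pos ⟨by omega, by omega⟩] at this
      exact this
    apply hne
    have : (G.N ^ m) e = κ := by
      rw [← hs]; simp [h4]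
    rw [this]; exact hκ
  obtain ⟨f, hf0, hf⟩ := Submodule.exists_le_ker_of_notMem hS
  refine ⟨(f ((G.N ^ m) e))⁻¹ • (f ∘ₗ G.P (dg j0 m)), ?_, ?_, ?_, ?_⟩
  · rw [LinearMap.smul_apply, LinearMap.comp_apply, G.Pid _ _ (G.Npmem he m), smul_eq_mul, inv_mul_cancel₀ hf0]
  · intro i hi
    rw [LinearMap.smul_apply, LinearMap.comp_apply]
    by_cases hd : dg j0 m = dg j0 i
    · rw [hd, G.Pid _ _ (G.Npmem he i)]
      have : f ((G.N ^ i) e) = 0 := by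
        apply hf
        apply Submodule.mem_sup_right
        refine ⟨Pi.single ⟨i, hi⟩ 1, ?_⟩
        rw [LinearMap.sum_apply, Finset.sum_eq_single ⟨i, hi⟩]
        · simp
        · intro b _ hb; simp [Pi.single_eq_of_ne hb]
        · simp
      rw [this, smul_zero]
    · rw [G.Pne (G.Npmem he i) hd, map_zero, smul_zero]
  · intro v
    rw [LinearMap.smul_apply, LinearMap.comp_apply, LinearMap.smul_apply, LinearMap.comp_apply, G.Pid _ _ (G.Pmem _ _)]
  · intro v hv hv2
    rw [LinearMap.smul_apply, LinearMap.comp_apply, G.Pid _ _ hv2]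
    have : f v = 0 := hf (Submodule.mem_sup_left hv)
    rw [this, smul_zero]

theorem exists_string (G : D.NG) (hI : D.Indec) (h0 : ∀ j, D.F 0 j = ⊥) (h5 : ∀ j, D.F 5 j = ⊤) :
    ∃ (m : ℕ) (j0 : Fin 3) (e : V) (φ : V →ₗ[k] k), G.N ^ (m+1) = 0 ∧ e ∈ D.F 2 j0 ∧ φ ((G.N ^ m) e) = 1 ∧
      ∀ v, v = ∑ i ∈ Finset.range (m+1), φ ((G.N ^ (m - i)) v) • (G.N ^ i) e := by
  have := hI.1
  obtain ⟨m, hN, hm⟩ : ∃ m, G.N ^ (m+1) = 0 ∧ G.N ^ m ≠ 0 := by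
    classical
    have hn := Nat.find_spec G.nil
    have hmin := fun i => Nat.find_min G.nil (m := i)
    rcases h : Nat.find G.nil with _ | n
    · rw [h, pow_zero] at hn; exact absurd hn one_ne_zero
    · exact ⟨n, by rw [h] at hn; exact hn, hmin n (by omega)⟩
  have K1 : ∀ j, ∀ v ∈ D.F 1 j, G.N v = 0 := fun j v hv => G.N1 hv
  have kill : ∀ {l : Fin 3} {φ : V →ₗ[k] k}, (∀ v, φ (G.P l v) = φ v) → (∀ v ∈ D.F 1 l, v ∈ D.F 2 l → φ v = 0) →
      ∀ j, ∀ v ∈ D.F 1 j, φ v = 0 := by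
    intro l φ h1 h2 j v hv
    have hv2 : v ∈ D.F 2 j := D.mono' (by norm_num : (1:ℤ) ≤ 2) j hv
    by_cases hj : l = j
    · subst hj; exact h2 v hv hv2
    · rw [← h1, G.Pne hv2 hj, map_zero]
  have key : ∀ {j0 : Fin 3} {e : V} (he : e ∈ D.F 2 j0) (hne : (G.N ^ m) e ≠ 0)
      (hK : (G.N ^ m) e ∉ D.F 1 (dg j0 m) ∨ (G.N ^ m) e ∈ D.F 1 (dg j0 m))
      (hH : e ∈ D.F 4 (j0+2) ∨ (∀ j, ∀ v ∈ D.F 2 j, v ∈ D.F 4 (j+2) → (G.N ^ m) v = 0) ∨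
        ((G.N ^ m) e ∉ D.F 1 (dg j0 m) ∧ ∀ j, ∀ v ∈ D.F 2 j, v ∈ D.F 4 (j+2) → (G.N ^ m) v ∈ D.F 1 (dg j m))),
      ∃ (m : ℕ) (j0 : Fin 3) (e : V) (φ : V →ₗ[k] k), G.N ^ (m+1) = 0 ∧ e ∈ D.F 2 j0 ∧ φ ((G.N ^ m) e) = 1 ∧
      ∀ v, v = ∑ i ∈ Finset.range (m+1), φ ((G.N ^ (m - i)) v) • (G.N ^ i) e := by
    intro j0 e he hne hK hH
    by_cases hK' : (G.N ^ m) e ∈ D.F 1 (dg j0 m)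
    · obtain ⟨φ, p1, p2, p3, -⟩ := G.exists_phi hN he ⊥ (fun v hv => by rw [(Submodule.mem_bot k).1 hv, map_zero])
        (by rwa [Submodule.mem_bot])
      refine ⟨m, j0, e, φ, hN, he, p1, G.string hI h0 h5 hN he φ p1 p2 p3 (Or.inr hK') ?_⟩
      rcases hH with h | h | h
      · exact Or.inl h
      · exact Or.inr fun j v hv hv4 => by rw [h j v hv hv4, map_zero]
      · exact absurd hK' h.1
    · obtain ⟨φ, p1, p2, p3, p4⟩ := G.exists_phi hN he _ (K1 (dg j0 m)) hK'
      have hk := kill p3 p4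
      refine ⟨m, j0, e, φ, hN, he, p1, G.string hI h0 h5 hN he φ p1 p2 p3 (Or.inl hk) ?_⟩
      rcases hH with h | h | h
      · exact Or.inl h
      · exact Or.inr fun j v hv hv4 => by rw [h j v hv hv4, map_zero]
      · exact Or.inr fun j v hv hv4 => hk _ _ (h.2 j v hv hv4)
  by_cases ha : ∃ j0, ∃ e ∈ D.F 2 j0, e ∈ D.F 4 (j0+2) ∧ (G.N ^ m) e ∉ D.F 1 (dg j0 m)
  · obtain ⟨j0, e, he, h4, hn⟩ := ha
    exact key he (fun h => hn (by rw [h]; exact zero_mem _)) (Or.inl hn) (Or.inl h4)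
  push Not at ha
  by_cases hb : ∃ j0, ∃ e ∈ D.F 2 j0, (G.N ^ m) e ∉ D.F 1 (dg j0 m)
  · obtain ⟨j0, e, he, hn⟩ := hb
    exact key he (fun h => hn (by rw [h]; exact zero_mem _)) (Or.inl hn) (Or.inr (Or.inr ⟨hn, ha⟩))
  push Not at hb
  by_cases hc : ∃ j0, ∃ e ∈ D.F 2 j0, e ∈ D.F 4 (j0+2) ∧ (G.N ^ m) e ≠ 0
  · obtain ⟨j0, e, he, h4, hn⟩ := hc
    exact key he hn (Or.inr (hb _ _ he)) (Or.inl h4)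
  push Not at hc
  have hd : ∃ j0, ∃ e ∈ D.F 2 j0, (G.N ^ m) e ≠ 0 := by
    by_contra h
    push Not at h
    apply hm
    ext v
    rw [← G.Psum 0 v, map_add, map_add, h _ _ (G.Pmem _ v), h _ _ (G.Pmem _ v), h _ _ (G.Pmem _ v)]
    simp
  obtain ⟨j0, e, he, hn⟩ := hd
  exact key he hn (Or.inr (hb _ _ he)) (Or.inr (Or.inl hc))

theorem dF4 (G : D.NG) (j : Fin 3) : d (D.F 4 j) = d (D.F 2 j) + d (D.F 2 (j+2)) + d (D.F 2 (j+1) ⊓ D.F 4 j) := by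
  have h := d_map (G.P (j+1)) (D.F 4 j)
  have e1 : (D.F 4 j).map (G.P (j+1)) = D.F 2 (j+1) ⊓ D.F 4 j := by
    apply le_antisymm
    · rintro _ ⟨v, hv, rfl⟩
      exact ⟨G.Pmem _ _, (G.F4 j v).1 hv⟩
    · rintro v ⟨h1, h2⟩
      exact ⟨v, h2, G.Pid _ _ h1⟩
  have e2 : D.F 4 j ⊓ LinearMap.ker (G.P (j+1)) = D.F 2 j ⊔ D.F 2 (j+2) := by
    apply le_antisymm
    · rintro v ⟨_, h2⟩
      have h2' : G.P (j+1) v = 0 := h2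
      have := G.Psum j v
      rw [h2', add_zero] at this
      rw [← this]
      exact Submodule.add_mem_sup (G.Pmem _ _) (G.Pmem _ _)
    · apply sup_le
      · intro v hv
        exact ⟨A4 j hv, G.Pz1 _ _ hv⟩
      · intro v hv
        refine ⟨A4' j hv, ?_⟩
        have := G.Pz2 _ _ hv
        rwa [j22] at this
  have e3 : D.F 2 j ⊓ D.F 2 (j+2) = ⊥ := by
    rw [eq_bot_iff]
    rintro v ⟨h1, h2⟩
    have := G.Pid _ _ h2
    rw [G.Pz2 _ _ h1] at this
    rw [← this]; exact zero_mem _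
  have h2 := d_sup_inf (D.F 2 j) (D.F 2 (j+2))
  rw [e3, d_bot] at h2
  rw [e1, e2] at h
  omega

theorem bound (G : D.NG) (hI : D.Indec) (h0 : ∀ j, D.F 0 j = ⊥) (h5 : ∀ j, D.F 5 j = ⊤) : |D.f| ≤ 6 := by
  obtain ⟨m, j0, e, φ, hN, he, hφ, hv⟩ := G.exists_string hI h0 h5
  set l := dg j0 m with hl
  set z := (G.N ^ m) e with hz
  have hz0 : z ≠ 0 := fun h => by rw [h, map_zero] at hφ; exact zero_ne_one hφ
  have hNz : G.N z = 0 := by rw [hz, ← Module.End.mul_apply, ← pow_succ', hN]; rfl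
  have he0 : e ≠ 0 := fun h => hz0 (by rw [hz, h, map_zero])
  have hzl : z ∈ D.F 2 l := G.Npmem he m
  have hker : ∀ v, G.N v = 0 → v ∈ (k ∙ z) := by
    intro v h
    rw [hv v]
    apply Submodule.sum_mem
    intro i hi
    rw [Finset.mem_range] at hi
    by_cases him : i = m
    · rw [him]; exact Submodule.smul_mem _ _ (Submodule.mem_span_singleton_self z)
    · rw [show m - i = (m - i - 1) + 1 by omega, pow_succ, Module.End.mul_apply, h, map_zero, map_zero, zero_smul]
      exact zero_mem _
  have c1 : D.F 2 l ⊓ LinearMap.ker G.N = (k ∙ z) := by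
    apply le_antisymm
    · rintro v ⟨_, h⟩; exact hker v h
    · rw [Submodule.span_singleton_le_iff_mem]; exact ⟨hzl, hNz⟩
  have c0 : ∀ j, j ≠ l → D.F 2 j ⊓ LinearMap.ker G.N = ⊥ := by
    intro j hj
    rw [eq_bot_iff]
    rintro v ⟨h1, h2⟩
    obtain ⟨c, hc⟩ := Submodule.mem_span_singleton.1 (hker v h2)
    have := G.Pid _ _ h1
    rw [← hc, map_smul, G.Pne hzl hj, smul_zero] at this
    rw [← hc, ← this]; exact zero_mem _
  have dz : d (k ∙ z) = 1 := d_span_singleton hz0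
  have de : d (k ∙ e) = 1 := d_span_singleton he0
  have nle : ∀ j, (D.F 2 (j+1)).map G.N ≤ D.F 2 j := by
    rintro j _ ⟨v, hv, rfl⟩
    have := G.Nmem _ _ hv; rwa [j12] at this
  have nle4 : ∀ j, (D.F 2 (j+1)).map G.N ≤ D.F 2 j ⊓ D.F 4 (j+2) := by
    intro j
    refine le_inf (nle j) ?_
    rintro _ ⟨v, hv, rfl⟩
    exact G.N4 hv
  have gen : ∀ j, D.F 2 j ≤ (D.F 2 (j+1)).map G.N ⊔ (k ∙ G.P j e) := by
    intro j v h
    rw [← G.Pid j v h, hv v, map_sum]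
    apply Submodule.sum_mem
    intro i hi
    rw [map_smul]
    apply Submodule.smul_mem
    rcases i with _ | i
    · exact Submodule.mem_sup_right (Submodule.mem_span_singleton_self _)
    · apply Submodule.mem_sup_left
      rw [pow_succ', Module.End.mul_apply, G.PN']
      exact ⟨_, G.Pmem _ _, rfl⟩
  have g0 : ∀ j, j ≠ j0 → (D.F 2 (j+1)).map G.N = D.F 2 j := by
    intro j hj
    apply le_antisymm (nle j)
    have := gen j
    rwa [G.Pne he hj, Submodule.span_zero_singleton, sup_bot_eq] at this
  have g1 : d (D.F 2 j0) = d ((D.F 2 (j0+1)).map G.N) + 1 := by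
    have h1 : D.F 2 j0 = (D.F 2 (j0+1)).map G.N ⊔ (k ∙ e) := by
      apply le_antisymm
      · have := gen j0; rwa [G.Pid _ _ he] at this
      · exact sup_le (nle j0) ((Submodule.span_singleton_le_iff_mem _ _).2 he)
    have h2 : (D.F 2 (j0+1)).map G.N ⊓ (k ∙ e) = ⊥ := by
      rw [eq_bot_iff]
      rintro v ⟨⟨w, hw, rfl⟩, h⟩
      obtain ⟨c, hc⟩ := Submodule.mem_span_singleton.1 h
      have : (G.N ^ m) (c • e) = 0 := by
        rw [hc, ← Module.End.mul_apply, ← pow_succ, hN]; rfl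
      rw [map_smul] at this
      have hc0 := (smul_eq_zero.1 this).resolve_right hz0
      rw [← hc, hc0, zero_smul]; exact zero_mem _
    have h3 := d_sup_inf ((D.F 2 (j0+1)).map G.N) (k ∙ e)
    rw [← h1, h2, d_bot, de] at h3
    omega
  have k0 : ∀ j, j ≠ l → d (D.F 1 j) = 0 := by
    intro j hj
    have : D.F 1 j ≤ ⊥ := by
      rw [← c0 j hj]
      exact fun v h => ⟨D.mono' (by norm_num : (1:ℤ) ≤ 2) j h, G.N1 h⟩
    rw [le_bot_iff.1 this, d_bot]
  have k1 : d (D.F 1 l) ≤ 1 := by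
    have := d_mono (show D.F 1 l ≤ (k ∙ z) from fun v h => hker v (G.N1 h))
    rwa [dz] at this
  have k1' := d_nonneg (D.F 1 l)
  have dm := fun j => d_map G.N (D.F 2 (j+1))
  have hh := fun j => d_mono (nle4 j)
  have hh' := fun j => d_mono (inf_le_left : D.F 2 j ⊓ D.F 4 (j+2) ≤ D.F 2 j)
  rw [f5 h0 h5]
  unfold g
  refine num18 (fun j => d (D.F 1 j)) (fun j => d (D.F 2 j)) (fun j => d (D.F 3 j)) (fun j => d (D.F 4 j))
    (fun j => d (D.F 2 j ⊓ D.F 4 (j+2))) (fun j => d ((D.F 2 (j+1)).map G.N)) (fun j => d (D.F 2 j ⊓ LinearMap.ker G.N))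
    l j0 ?_ G.dB dm hh hh' (fun j => ?_) (fun j => ?_) k0 k1 k1'
  · intro j
    have := G.dF4 j
    simp only [j12]; exact this
  · split_ifs with h
    · subst h; exact g1
    · rw [g0 j h, add_zero]
  · split_ifs with h
    · subst h; rw [c1, dz]
    · rw [c0 j h, d_bot]

end NG

theorem bound {D : QF k V} (hI : D.Indec) : |D.f| ≤ 6 := by
  rcases dich hI with h | ⟨D', hI', hf, h0, h5, hle, ht⟩
  · exact h
  rw [← hf]
  rcases caseII_split hI' h0 h5 hle ht with h | hpc
  · exact h
  obtain ⟨G⟩ := NG.exists (phi_top hle hpc)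
  exact G.bound hI' h0 h5

end QF
end St6

set_option linter.unusedSectionVars false
set_option linter.unusedVariables false
namespace St6
open Module Submodule

variable {k : Type u} [Field k] {V : Type u} [AddCommGroup V] [Module k V] [FiniteDimensional k V]
  {V' : Type u} [AddCommGroup V'] [Module k V'] [FiniteDimensional k V']

theorem d_comap_subtype (F B : Submodule k V) : d (F.comap B.subtype) = d (F ⊓ B) := by
  rw [← d_map_subtype, Submodule.map_comap_subtype, inf_comm]

theorem sum_Ico_shift (h : ℤ → ℤ) (a b : ℤ) (hab : a ≤ b) :
    ∑ i ∈ Finset.Ico a b, h (i+1) = ∑ i ∈ Finset.Ico a b, h i + h b - h a := by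
  induction b, hab using Int.le_induction with
  | base => simp
  | succ b hab ih =>
    have e : Finset.Ico a (b+1) = insert b (Finset.Ico a b) := by
      ext x; simp only [Finset.mem_Ico, Finset.mem_insert]; omega
    rw [e, Finset.sum_insert (by simp), Finset.sum_insert (by simp), ih]; ring

namespace QF

def sub (D : QF k V) (B : Submodule k V) : QF k B where
  F i j := (D.F i j).comap B.subtype
  mono i j := Submodule.comap_mono (D.mono i j)
  sh i j := Submodule.comap_mono (D.sh i j)
  bot := by
    obtain ⟨a, h⟩ := D.bot
    exact ⟨a, fun j => by rw [h, Submodule.comap_bot, Submodule.ker_subtype]⟩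
  top := by
    obtain ⟨a, h⟩ := D.top
    exact ⟨a, fun j => by rw [h, Submodule.comap_top]⟩

theorem f_reg {D : QF k V} {a b : ℤ} (hab : a ≤ b) (ha : ∀ j, D.F (a+4) j = ⊥) (hb : ∀ j, D.F b j = ⊤) :
    D.f = ∑ i ∈ Finset.Ico a b, (d (D.F i 0) + d (D.F (i+4) 2) - 2 * d (D.F (i+2) 1)) := by
  have hbot : ∀ i, i ≤ a + 4 → ∀ j, D.F i j = ⊥ := fun i hi j => by
    rw [eq_bot_iff, ← ha j]; exact D.mono' hi j
  have htop : ∀ i, b ≤ i → ∀ j, D.F i j = ⊤ := fun i hi j => by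
    rw [eq_top_iff, ← hb j]; exact D.mono' hi j
  have st : ∀ (j : Fin 3) (t : ℤ), 0 ≤ t → t ≤ 3 → ∑ i ∈ Finset.Ico a b, d (D.F (i + (t+1)) j) =
      ∑ i ∈ Finset.Ico a b, d (D.F (i + t) j) + finrank k V := by
    intro j t h1 h2
    have := sum_Ico_shift (fun i => d (D.F (i + t) j)) a b hab
    rw [htop (b+t) (by omega), hbot (a+t) (by omega), d_top, d_bot, sub_zero] at this
    rw [← this]
    apply Finset.sum_congr rfl
    intro i _
    rw [show i + 1 + t = i + (t + 1) by ring]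
  have s0 := st 2 0 (by norm_num) (by norm_num)
  have s1 := st 2 1 (by norm_num) (by norm_num)
  have s2 := st 2 2 (by norm_num) (by norm_num)
  have s3 := st 2 3 (by norm_num) (by norm_num)
  have r0 := st 1 0 (by norm_num) (by norm_num)
  have r1 := st 1 1 (by norm_num) (by norm_num)
  norm_num only at s0 s1 s2 s3 r0 r1
  simp only [add_zero] at s0 r0
  have hf : D.f = ∑ i ∈ Finset.Ico a b, D.g i := by
    rw [f_eq (hbot a (by omega)) hb]
    apply Finset.sum_subset
    · intro i; simp only [Finset.mem_Ico, Finset.mem_Ioo]; omega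
    · intro i h1 h2
      apply g_bot
      apply hbot
      simp only [Finset.mem_Ico, Finset.mem_Ioo] at h1 h2
      omega
  rw [hf]
  unfold g
  rw [Finset.sum_sub_distrib, Finset.sum_add_distrib, Finset.sum_sub_distrib, Finset.sum_add_distrib,
    ← Finset.mul_sum, ← Finset.mul_sum]
  omega

theorem exists_ab (D : QF k V) : ∃ a b : ℤ, a ≤ b ∧ (∀ j, D.F (a+4) j = ⊥) ∧ ∀ j, D.F b j = ⊤ := by
  obtain ⟨a, ha⟩ := D.bot
  obtain ⟨b, hb⟩ := D.top
  refine ⟨min (a - 4) b, b, min_le_right _ _, fun j => ?_, hb⟩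
  rw [eq_bot_iff, ← ha j]
  exact D.mono' (by have := min_le_left (a-4) b; omega) j

theorem f_split {D : QF k V} {A B : Submodule k V} (h : D.Spl A B) : D.f = (D.sub A).f + (D.sub B).f := by
  obtain ⟨a, b, hab, ha, hb⟩ := D.exists_ab
  have hs : ∀ C, (∀ j, (D.sub C).F (a+4) j = ⊥) ∧ ∀ j, (D.sub C).F b j = ⊤ := fun C =>
    ⟨fun j => by change (D.F (a+4) j).comap _ = ⊥; rw [ha, Submodule.comap_bot, Submodule.ker_subtype],
      fun j => by change (D.F b j).comap _ = ⊤; rw [hb, Submodule.comap_top]⟩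
  rw [f_reg hab ha hb, f_reg hab (hs A).1 (hs A).2, f_reg hab (hs B).1 (hs B).2, ← Finset.sum_add_distrib]
  have hd : ∀ i j, d (D.F i j) = d ((D.sub A).F i j) + d ((D.sub B).F i j) := by
    intro i j
    change _ = d ((D.F i j).comap A.subtype) + d ((D.F i j).comap B.subtype)
    rw [d_comap_subtype, d_comap_subtype, ← d_sup_inf]
    have e1 : D.F i j ⊓ A ⊓ (D.F i j ⊓ B) = ⊥ := by
      rw [eq_bot_iff, ← h.1.inf_eq_bot]
      exact inf_le_inf inf_le_right inf_le_right
    rw [e1, d_bot, add_zero]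
    congr 1
    exact le_antisymm (h.2 i j) (sup_le inf_le_left inf_le_left)
  apply Finset.sum_congr rfl
  intro i _
  rw [hd i 0, hd (i+4) 2, hd (i+2) 1]; ring

def Triv (D : QF k V) (A : Submodule k V) : Prop := ∀ i, D.F (i+4) 2 ⊓ A ≤ D.F i 0

theorem f_triv {D : QF k V} {A : Submodule k V} (h : D.Triv A) : (D.sub A).f = 0 := by
  obtain ⟨a, b, hab, ha, hb⟩ := (D.sub A).exists_ab
  rw [f_reg hab ha hb]
  apply Finset.sum_eq_zero
  intro i _
  change d ((D.F i 0).comap A.subtype) + d ((D.F (i+4) 2).comap A.subtype) - 2 * d ((D.F (i+2) 1).comap A.subtype) = 0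
  rw [d_comap_subtype, d_comap_subtype, d_comap_subtype]
  have h1 := d_mono (inf_le_inf_right A (show D.F i 0 ≤ D.F (i+2) 1 from D.sh i 0))
  have s2 : D.F (i+2) 1 ≤ D.F (i+4) 2 := by
    have := D.sh (i+2) 1
    rw [show i + 2 + 2 = i + 4 by ring] at this; exact this
  have h2 := d_mono (inf_le_inf_right A s2)
  have h3 := d_mono (le_inf (h i) (inf_le_right : D.F (i+4) 2 ⊓ A ≤ A))
  omega

theorem Spl.symm {D : QF k V} {A B : Submodule k V} (h : D.Spl A B) : D.Spl B A :=
  ⟨h.1.symm, fun i j => by rw [sup_comm]; exact h.2 i j⟩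

theorem Spl.refine {D : QF k V} {A B : Submodule k V} (h : D.Spl A B) {B1 B2 : Submodule k B}
    (h' : (D.sub B).Spl B1 B2) : D.Spl (A ⊔ B1.map B.subtype) (B2.map B.subtype) := by
  have m1 : B1.map B.subtype ≤ B := Submodule.map_subtype_le B _
  have m2 : B2.map B.subtype ≤ B := Submodule.map_subtype_le B _
  have hsup : B1.map B.subtype ⊔ B2.map B.subtype = B := by
    rw [← Submodule.map_sup, h'.1.sup_eq_top, Submodule.map_top, Submodule.range_subtype]
  have hinf : B1.map B.subtype ⊓ B2.map B.subtype = ⊥ := by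
    rw [← Submodule.map_inf _ (Submodule.injective_subtype B), h'.1.inf_eq_bot, Submodule.map_bot]
  refine ⟨IsCompl.of_eq ?_ ?_, fun i j => ?_⟩
  · rw [eq_bot_iff]
    rintro x ⟨hx1, hx2⟩
    obtain ⟨a, ha, b, hb, e⟩ := Submodule.mem_sup.1 hx1
    have haB : a ∈ B := by
      have : a = x - b := eq_sub_of_add_eq e
      rw [this]; exact sub_mem (m2 hx2) (m1 hb)
    have ha0 : a ∈ A ⊓ B := ⟨ha, haB⟩
    rw [h.1.inf_eq_bot, Submodule.mem_bot] at ha0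
    rw [ha0, zero_add] at e
    rw [← hinf]
    exact ⟨by rw [← e]; exact hb, hx2⟩
  · rw [sup_assoc, hsup, h.1.sup_eq_top]
  · intro x hx
    obtain ⟨a, ha, b, hb, e⟩ := Submodule.mem_sup.1 (h.2 i j hx)
    have hb' : (⟨b, hb.2⟩ : B) ∈ (D.sub B).F i j := hb.1
    obtain ⟨b1, hb1, b2, hb2, e'⟩ := Submodule.mem_sup.1 (h'.2 i j hb')
    have e'' : (b1 : V) + b2 = b := congrArg Subtype.val e'
    have g1 : (b1 : V) ∈ D.F i j := hb1.1
    have g2 : (b2 : V) ∈ D.F i j := hb2.1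
    refine Submodule.mem_sup.2 ⟨a + b1, ⟨add_mem ha.1 g1, Submodule.add_mem_sup ha.2 ⟨b1, hb1.2, rfl⟩⟩, b2,
      ⟨g2, ⟨b2, hb2.2, rfl⟩⟩, ?_⟩
    rw [add_assoc, e'', e]

theorem Triv.sup {D : QF k V} {A B C : Submodule k V} (h : D.Spl A B) (hC : C ≤ B) (tA : D.Triv A) (tC : D.Triv C) :
    D.Triv (A ⊔ C) := by
  rintro i x ⟨hx, hx'⟩
  obtain ⟨a, ha, c, hc, e⟩ := Submodule.mem_sup.1 hx'
  obtain ⟨a', ha', b', hb', e'⟩ := Submodule.mem_sup.1 (h.2 _ _ hx)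
  have h0 : a - a' ∈ A ⊓ B := by
    refine ⟨sub_mem ha ha'.2, ?_⟩
    have : a - a' = b' - c := by
      rw [sub_eq_sub_iff_add_eq_add, e, add_comm b' a', e']
    rw [this]; exact sub_mem hb'.2 (hC hc)
  rw [h.1.inf_eq_bot, Submodule.mem_bot, sub_eq_zero] at h0
  subst h0
  have hcb : c = b' := add_left_cancel (e.trans e'.symm)
  subst hcb
  rw [← e]
  exact add_mem (tA i ⟨ha'.1, ha⟩) (tC i ⟨hb'.1, hc⟩)

theorem bound' {D : QF k V} (h : ∀ A B, D.Spl A B → D.Triv A ∨ D.Triv B) : |D.f| ≤ 6 := by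
  obtain ⟨A, ⟨tA, B, hAB⟩, hmax⟩ := exists_max (fun A : Submodule k V => D.Triv A ∧ ∃ B, D.Spl A B)
    (fun A => d A) (finrank k V) (fun W _ => by rw [← d_top]; exact d_mono le_top)
    ⟨⊥, fun i => by rw [inf_bot_eq]; exact bot_le, ⊤, IsCompl.of_eq (by simp) (by simp), fun i j => by simp⟩
  rw [f_split hAB, f_triv tA, zero_add]
  by_cases hB : B = ⊥
  · have : D.Triv B := fun i => by rw [hB, inf_bot_eq]; exact bot_le
    rw [f_triv this]; norm_num
  apply bound
  refine ⟨Submodule.nontrivial_iff_ne_bot.2 hB, fun B1 B2 h12 => ?_⟩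
  have aux : ∀ C : Submodule k B, d (A ⊔ C.map B.subtype) ≤ d A → C = ⊥ := by
    intro C hC
    have e1 : A = A ⊔ C.map B.subtype := eq_of_le_of_d le_sup_left hC
    have e2 : C.map B.subtype ≤ A ⊓ B := le_inf (by rw [e1]; exact le_sup_right) (Submodule.map_subtype_le B _)
    rw [hAB.1.inf_eq_bot, le_bot_iff] at e2
    exact Submodule.map_injective_of_injective (Submodule.injective_subtype B) (by rw [e2, Submodule.map_bot])
  have s1 := hAB.refine h12
  have s2 := hAB.refine h12.symm
  rcases h _ _ s1 with t | t
  · left; exact aux B1 (hmax _ ⟨t, _, s1⟩)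
  · right; exact aux B2 (hmax _ ⟨tA.sup hAB (Submodule.map_subtype_le B _) t, _, s2⟩)

end QF
end St6

set_option linter.unusedSectionVars false
set_option linter.unusedVariables false
namespace St6
open Module Submodule

variable {k : Type u} [Field k] {V : Type u} [AddCommGroup V] [Module k V] [FiniteDimensional k V]

/-- graded families of idempotent-like endomorphisms on the window `[0,n)` -/
structure Fam (T : V →ₗ[k] V) (U : Submodule k V) (n : ℕ) (e : ℤ → V →ₗ[k] V) : Prop where
  supp : ∀ i, (i < 0 ∨ (n : ℤ) ≤ i) → e i = 0
  comm : ∀ i, 0 ≤ i → i + 1 < (n : ℤ) → ∀ v, T (e i v) = e (i+1) (T v)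
  U : ∀ i, ∀ u ∈ U, e i u ∈ U
  idem : ∀ i v, e i (e i v) = e i v

def SubF (q e : ℤ → V →ₗ[k] V) : Prop := ∀ i v, e i (q i v) = q i v ∧ q i (e i v) = q i v

structure IndF (T : V →ₗ[k] V) (U : Submodule k V) (n : ℕ) (e : ℤ → V →ₗ[k] V) : Prop where
  fam : Fam T U n e
  ne : ∃ i, e i ≠ 0
  ind : ∀ q, Fam T U n q → SubF q e → (∀ i, q i = 0) ∨ (∀ i, q i = e i)

noncomputable def fF (U : Submodule k V) (n : ℕ) (e : ℤ → V →ₗ[k] V) : ℤ :=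
  ∑ i ∈ Finset.Ico (0 : ℤ) n, (d (LinearMap.range (e i)) - 2 * d (U.map (e i)))

section
variable (T : V →ₗ[k] V) (U : Submodule k V) (n : ℕ)

noncomputable def sg (i : ℤ) : (Fin n → V) →ₗ[k] V :=
  ∑ i' : Fin n, (T ^ (i - ((i' : ℕ) : ℤ)).toNat) ∘ₗ LinearMap.proj i'

theorem sg_apply (i : ℤ) (w : Fin n → V) :
    sg T n i w = ∑ i' : Fin n, (T ^ (i - ((i' : ℕ) : ℤ)).toNat) (w i') := by
  simp [sg, LinearMap.sum_apply]

def Lw (V : Type u) [AddCommGroup V] [Module k V] (n : ℕ) (i : ℤ) : Submodule k (Fin n → V) where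
  carrier := {w | ∀ i' : Fin n, i < ((i' : ℕ) : ℤ) → w i' = 0}
  add_mem' := by
    intro a b ha hb i' h
    rw [Pi.add_apply, ha i' h, hb i' h, add_zero]
  zero_mem' := fun _ _ => rfl
  smul_mem' := by
    intro c a ha i' h
    rw [Pi.smul_apply, ha i' h, smul_zero]

/-- the elements of `Lw i` whose image lies in `P`, for `i < n` -/
def Mw (P : Submodule k V) (i : ℤ) : Submodule k (Fin n → V) where
  carrier := {w | w ∈ Lw (k := k) V n i ∧ (i < (n : ℤ) → sg T n i w ∈ P)}
  add_mem' := by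
    intro a b ha hb
    exact ⟨add_mem ha.1 hb.1, fun h => by rw [map_add]; exact add_mem (ha.2 h) (hb.2 h)⟩
  zero_mem' := ⟨zero_mem _, fun h => by rw [map_zero]; exact zero_mem _⟩
  smul_mem' := by
    intro c a ha
    exact ⟨Submodule.smul_mem _ c ha.1, fun h => by rw [map_smul]; exact Submodule.smul_mem _ c (ha.2 h)⟩

theorem Lw_mono {i j : ℤ} (h : i ≤ j) : Lw (k := k) V n i ≤ Lw V n j := fun w hw i' h' => hw i' (by omega)

theorem sg_add (i : ℤ) (c : ℕ) {w : Fin n → V} (hw : w ∈ Lw (k := k) V n i) :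
    sg T n (i + c) w = (T ^ c) (sg T n i w) := by
  rw [sg_apply, sg_apply, map_sum]
  apply Finset.sum_congr rfl
  intro i' _
  by_cases h : i < ((i' : ℕ) : ℤ)
  · rw [hw i' h]; simp
  · rw [show (i + c - ((i' : ℕ) : ℤ)).toNat = c + (i - ((i' : ℕ) : ℤ)).toNat by omega, pow_add,
      Module.End.mul_apply]

theorem sg_succ (i : ℤ) {w : Fin n → V} (hw : w ∈ Lw (k := k) V n i) :
    sg T n (i + 1) w = T (sg T n i w) := by
  have := sg_add T n i 1 hw
  simpa using this

theorem Lw_bot {i : ℤ} (h : i < 0) : Lw (k := k) V n i = ⊥ := by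
  rw [eq_bot_iff]
  intro w hw
  rw [Submodule.mem_bot]
  funext i'
  exact hw i' (by omega)

theorem Mw_le (P : Submodule k V) (i : ℤ) : Mw T n P i ≤ Lw V n i := fun w hw => hw.1

theorem Mw_bot (P : Submodule k V) {i : ℤ} (h : i < 0) : Mw T n P i = ⊥ := by
  rw [eq_bot_iff, ← Lw_bot (k := k) (V := V) n h]; exact Mw_le T n P i

theorem Lw_top {i : ℤ} (h : (n : ℤ) ≤ i) : Lw (k := k) V n i = ⊤ := by
  rw [eq_top_iff]
  intro w _ i' h'
  have := i'.2
  omega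

theorem Mw_top (P : Submodule k V) {i : ℤ} (h : (n : ℤ) ≤ i) : Mw T n P i = ⊤ := by
  rw [eq_top_iff]
  intro w _
  refine ⟨?_, fun h' => by omega⟩
  rw [Lw_top n h]; trivial

theorem Mw_mono (P : Submodule k V) (hP : ∀ x ∈ P, T x ∈ P) (i : ℤ) : Mw T n P i ≤ Mw T n P (i+1) := by
  intro w hw
  refine ⟨Lw_mono n (by omega) hw.1, fun h => ?_⟩
  rw [sg_succ T n i hw.1]
  exact hP _ (hw.2 (by omega))

noncomputable def QD (hT : T ^ 6 = 0) (hU : ∀ x ∈ U, T x ∈ U) : QF k (Fin n → V) where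
  F i := ![Mw T n ⊥ i, Mw T n U (i-2), Lw V n (i-4)]
  mono i j := by
    fin_cases j
    · exact Mw_mono T n ⊥ (fun x hx => by rw [(Submodule.mem_bot k).1 hx, map_zero]; exact zero_mem _) i
    · have := Mw_mono T n U hU (i-2)
      rwa [show i - 2 + 1 = i + 1 - 2 by ring] at this
    · exact Lw_mono n (by omega)
  sh i j := by
    fin_cases j
    · change Mw T n ⊥ i ≤ Mw T n U (i+2-2)
      rw [show i + 2 - 2 = i by ring]
      exact fun w hw => ⟨hw.1, fun h => (bot_le : (⊥ : Submodule k V) ≤ U) (hw.2 h)⟩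
    · change Mw T n U (i-2) ≤ Lw V n (i+2-4)
      rw [show i + 2 - 4 = i - 2 by ring]
      exact Mw_le T n U _
    · change Lw V n (i-4) ≤ Mw T n ⊥ (i+2)
      intro w hw
      refine ⟨Lw_mono n (by omega) hw, fun h => ?_⟩
      have := sg_add T n (i-4) 6 hw
      rw [hT, show i - 4 + ((6:ℕ):ℤ) = i + 2 by push_cast; ring] at this
      rw [this]; simp
  bot := ⟨-1, fun j => by
    fin_cases j
    · exact Mw_bot T n ⊥ (by norm_num)
    · exact Mw_bot T n U (by norm_num)
    · exact Lw_bot n (by norm_num)⟩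
  top := ⟨n+4, fun j => by
    fin_cases j
    · exact Mw_top T n ⊥ (by omega)
    · exact Mw_top T n U (by omega)
    · exact Lw_top n (by omega)⟩

def sgl (V : Type u) [AddCommGroup V] [Module k V] (n : ℕ) (i : ℤ) : V →ₗ[k] (Fin n → V) :=
  LinearMap.pi fun i' => if ((i' : ℕ) : ℤ) = i then LinearMap.id else 0

theorem sgl_ne {i : ℤ} {i' : Fin n} (h : ((i' : ℕ) : ℤ) ≠ i) (v : V) : sgl (k := k) V n i v i' = 0 := by
  simp [sgl, h]

theorem sgl_eq {i : ℤ} {i' : Fin n} (h : ((i' : ℕ) : ℤ) = i) (v : V) : sgl (k := k) V n i v i' = v := by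
  simp [sgl, h]

theorem sgl_mem (i : ℤ) (v : V) : sgl (k := k) V n i v ∈ Lw (k := k) V n i :=
  fun i' h => sgl_ne n (by omega) v

theorem sg_sgl {i : ℤ} (h0 : 0 ≤ i) (h1 : i < n) (v : V) : sg T n i (sgl (k := k) V n i v) = v := by
  rw [sg_apply, Finset.sum_eq_single (⟨i.toNat, by omega⟩ : Fin n)]
  · rw [sgl_eq n (by simp; omega)]
    have : (i - ((i.toNat : ℕ) : ℤ)).toNat = 0 := by omega
    change (T ^ (i - ((i.toNat : ℕ) : ℤ)).toNat) v = v
    rw [this]; simp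
  · intro b _ hb
    rw [sgl_ne, map_zero]
    intro h
    apply hb
    apply Fin.ext
    simp; omega
  · simp

def EF (e : ℤ → V →ₗ[k] V) : Submodule k (Fin n → V) where
  carrier := {w | ∀ i' : Fin n, e ((i' : ℕ) : ℤ) (w i') = w i'}
  add_mem' := by
    intro a b ha hb i'
    rw [Pi.add_apply, map_add, ha i', hb i']
  zero_mem' := fun _ => by simp
  smul_mem' := by
    intro c a ha i'
    rw [Pi.smul_apply, map_smul, ha i']

end

namespace Fam
variable {T : V →ₗ[k] V} {U : Submodule k V} {n : ℕ} {e : ℤ → V →ₗ[k] V}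

theorem pow (he : Fam T U n e) (i : ℤ) (h0 : 0 ≤ i) (c : ℕ) (h1 : i + c < n) (v : V) : (T ^ c) (e i v) = e (i + c) ((T ^ c) v) := by
  induction c with
  | zero => simp
  | succ c ih =>
    rw [pow_succ', Module.End.mul_apply, ih (by push_cast at h1; omega), he.comm _ (by omega) (by push_cast at h1; omega),
      Module.End.mul_apply]
    push_cast; rw [add_assoc]

theorem sg_fix (he : Fam T U n e) {i : ℤ} (h1 : i < n) {w : Fin n → V} (hL : w ∈ Lw (k := k) V n i)
    (hE : w ∈ EF n e) : e i (sg T n i w) = sg T n i w := by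
  rw [sg_apply, map_sum]
  apply Finset.sum_congr rfl
  intro i' _
  by_cases h : i < ((i' : ℕ) : ℤ)
  · rw [hL i' h]; simp
  · have := he.pow ((i' : ℕ) : ℤ) (by omega) (i - ((i' : ℕ) : ℤ)).toNat (by omega) (w i')
    rw [hE i', show ((i' : ℕ) : ℤ) + ((i - ((i' : ℕ) : ℤ)).toNat : ℕ) = i by omega] at this
    exact this.symm

theorem sgl_E (he : Fam T U n e) (i : ℤ) {v : V} (hv : e i v = v) : sgl (k := k) V n i v ∈ EF n e := by
  intro i'
  by_cases h : ((i' : ℕ) : ℤ) = i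
  · rw [sgl_eq n h, h, hv]
  · rw [sgl_ne n h, map_zero]

theorem map_M (he : Fam T U n e) {i : ℤ} (h0 : 0 ≤ i) (h1 : i < n) {P : Submodule k V} (hP : ∀ u ∈ P, e i u ∈ P) :
    (Mw T n P i ⊓ EF n e).map (sg T n i) = P.map (e i) := by
  apply le_antisymm
  · rintro _ ⟨w, ⟨hw, hE⟩, rfl⟩
    exact ⟨_, hw.2 h1, he.sg_fix h1 hw.1 hE⟩
  · rintro _ ⟨u, hu, rfl⟩
    refine ⟨sgl V n i (e i u), ⟨⟨sgl_mem n i _, fun _ => ?_⟩, he.sgl_E i (he.idem i u)⟩, sg_sgl T n h0 h1 _⟩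
    rw [sg_sgl T n h0 h1]; exact hP u hu

theorem d_M (he : Fam T U n e) {i : ℤ} (h0 : 0 ≤ i) (h1 : i < n) {P : Submodule k V} (hP : ∀ u ∈ P, e i u ∈ P) :
    d (P.map (e i)) = d (Mw T n P i ⊓ EF n e) - d (Mw T n ⊥ i ⊓ EF n e) := by
  rw [← he.map_M h0 h1 hP, d_map]
  congr 2
  ext w
  constructor
  · rintro ⟨⟨h, h'⟩, h''⟩
    exact ⟨⟨h.1, fun _ => h''⟩, h'⟩
  · rintro ⟨h, h'⟩
    have h0 : sg T n i w = 0 := h.2 h1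
    exact ⟨⟨⟨h.1, fun _ => by rw [h0]; exact zero_mem _⟩, h'⟩, h0⟩

theorem Mw_topP (he : Fam T U n e) (i : ℤ) : Mw T n (⊤ : Submodule k V) i = Lw V n i :=
  le_antisymm (Mw_le T n _ i) fun w hw => ⟨hw, fun _ => trivial⟩

theorem f_eq (he : Fam T U n e) (hT : T ^ 6 = 0) (hU : ∀ x ∈ U, T x ∈ U) : ((QD T U n hT hU).sub (EF n e)).f = fF U n e := by
  have hb : ∀ (P : Submodule k V) (i : ℤ), i < 0 → d (Mw T n P i ⊓ EF n e) = 0 := fun P i h => by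
    rw [Mw_bot T n P h, bot_inf_eq, d_bot]
  rw [QF.f_reg (a := -5) (b := n+4) (by omega)]
  · have key : ∀ i : ℤ, d (((QD T U n hT hU).sub (EF n e)).F i 0) + d (((QD T U n hT hU).sub (EF n e)).F (i+4) 2)
        - 2 * d (((QD T U n hT hU).sub (EF n e)).F (i+2) 1) =
        d (Mw T n ⊥ i ⊓ EF n e) + d (Mw T n ⊤ i ⊓ EF n e) - 2 * d (Mw T n U i ⊓ EF n e) := by
      intro i
      rw [he.Mw_topP]
      change d ((Mw T n ⊥ i).comap (EF n e).subtype) + d ((Lw V n (i+4-4)).comap (EF n e).subtype)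
        - 2 * d ((Mw T n U (i+2-2)).comap (EF n e).subtype) = _
      rw [d_comap_subtype, d_comap_subtype, d_comap_subtype, show i + 4 - 4 = i by ring, show i + 2 - 2 = i by ring]
    simp only [key]
    rw [fF]
    rw [← Finset.sum_subset (s₁ := Finset.Ico (0:ℤ) n) (s₂ := Finset.Ico (-5:ℤ) (n+4))]
    · apply Finset.sum_congr rfl
      intro i hi
      rw [Finset.mem_Ico] at hi
      rw [LinearMap.range_eq_map, he.d_M hi.1 hi.2 (P := ⊤) (fun _ _ => trivial), he.d_M hi.1 hi.2 (P := U) (he.U i)]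
      ring
    · intro i hi
      rw [Finset.mem_Ico] at *; omega
    · intro i _ hi
      rw [Finset.mem_Ico] at hi
      by_cases h : i < 0
      · rw [hb _ i h, hb _ i h, hb _ i h]; simp
      · have : (n:ℤ) ≤ i := by omega
        rw [Mw_top T n _ this, Mw_top T n _ this, Mw_top T n _ this]; ring
  · intro j
    have : (QD T U n hT hU).F (-5+4) j = ⊥ := by
      fin_cases j
      · exact Mw_bot T n ⊥ (by norm_num)
      · exact Mw_bot T n U (by norm_num)
      · exact Lw_bot n (by norm_num)
    change ((QD T U n hT hU).F (-5+4) j).comap _ = ⊥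
    rw [this, Submodule.comap_bot, Submodule.ker_subtype]
  · intro j
    have : (QD T U n hT hU).F (n+4) j = ⊤ := by
      fin_cases j
      · exact Mw_top T n ⊥ (by omega)
      · exact Mw_top T n U (by omega)
      · exact Lw_top n (by omega)
    change ((QD T U n hT hU).F (n+4) j).comap _ = ⊤
    rw [this, Submodule.comap_top]

end Fam

section
variable {T : V →ₗ[k] V} {U : Submodule k V} {n : ℕ} {e : ℤ → V →ₗ[k] V}

def PE (n : ℕ) (e : ℤ → V →ₗ[k] V) : (Fin n → V) →ₗ[k] (Fin n → V) :=
  LinearMap.pi fun i' => e ((i' : ℕ) : ℤ) ∘ₗ LinearMap.proj i'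

theorem PE_apply (w : Fin n → V) (i' : Fin n) : PE n e w i' = e ((i' : ℕ) : ℤ) (w i') := by simp [PE]

theorem key_q (he : Fam T U n e) {P : (Fin n → V) →ₗ[k] (Fin n → V)}
    (hM : ∀ i, ∀ w ∈ Mw T n ⊥ i, w ∈ EF n e → P w ∈ Mw T n ⊥ i)
    {i : ℤ} (h0 : 0 ≤ i) (h1 : i < n) {w : Fin n → V} (hw : w ∈ Lw (k := k) V n i) (hE : w ∈ EF n e) :
    sg T n i (P w) = sg T n i (P (sgl (k := k) V n i (e i (sg T n i w)))) := by
  rw [he.sg_fix h1 hw hE]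
  have h := hM i (w - sgl (k := k) V n i (sg T n i w)) ⟨sub_mem hw (sgl_mem n i _), fun _ => by
    rw [map_sub, sg_sgl T n h0 h1, sub_self]; exact zero_mem _⟩ (sub_mem hE (he.sgl_E i (he.sg_fix h1 hw hE)))
  have h2 : sg T n i (P (w - sgl (k := k) V n i (sg T n i w))) = 0 := h.2 h1
  rw [map_sub, map_sub, sub_eq_zero] at h2
  exact h2

theorem fam_q (he : Fam T U n e) {P : (Fin n → V) →ₗ[k] (Fin n → V)} (hPE : ∀ w, P w ∈ EF n e)
    (hPP : ∀ w, P (P w) = P w)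
    (hM : ∀ i, ∀ w ∈ Mw T n ⊥ i, w ∈ EF n e → P w ∈ Mw T n ⊥ i)
    (hM' : ∀ i, ∀ w ∈ Mw T n U i, w ∈ EF n e → P w ∈ Mw T n U i)
    (hL : ∀ i, ∀ w ∈ Lw (k := k) V n i, w ∈ EF n e → P w ∈ Lw (k := k) V n i) :
    Fam T U n (fun i => sg T n i ∘ₗ P ∘ₗ sgl V n i ∘ₗ e i) ∧
    SubF (fun i => sg T n i ∘ₗ P ∘ₗ sgl V n i ∘ₗ e i) e := by
  have hz : ∀ i, (i < 0 ∨ (n : ℤ) ≤ i) → sg T n i ∘ₗ P ∘ₗ sgl V n i ∘ₗ e i = 0 := fun i hi => by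
    rw [he.supp i hi]; simp
  have hin : ∀ i v, sgl V n i (e i v) ∈ EF n e := fun i v => he.sgl_E i (he.idem i v)
  refine ⟨⟨hz, ?_, ?_, ?_⟩, ?_⟩
  · intro i h0 h1 v
    simp only [LinearMap.comp_apply]
    have hl : sgl V n i (e i v) ∈ Lw (k := k) V n i := sgl_mem n i _
    rw [← sg_succ T n i (hL i _ hl (hin i v)), key_q he hM (by omega) h1 (Lw_mono n (by omega) hl) (hin i v),
      sg_succ T n i hl, sg_sgl T n h0 (by omega), he.comm i h0 h1, he.idem]
  · intro i u hu
    by_cases hi : i < 0 ∨ (n : ℤ) ≤ i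
    · rw [hz i hi]; simp
    push Not at hi
    simp only [LinearMap.comp_apply]
    refine (hM' i (sgl V n i (e i u)) ⟨sgl_mem n i _, fun _ => ?_⟩ (hin i u)).2 hi.2
    rw [sg_sgl T n hi.1 hi.2]; exact he.U i u hu
  · intro i v
    by_cases hi : i < 0 ∨ (n : ℤ) ≤ i
    · rw [hz i hi]; simp
    push Not at hi
    simp only [LinearMap.comp_apply]
    rw [← key_q he hM hi.1 hi.2 (hL i _ (sgl_mem n i _) (hin i v)) (hPE _), hPP]
  · intro i v
    by_cases hi : i < 0 ∨ (n : ℤ) ≤ i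
    · simp [he.supp i hi]
    push Not at hi
    simp only [LinearMap.comp_apply]
    exact ⟨he.sg_fix hi.2 (hL i _ (sgl_mem n i _) (hin i v)) (hPE _), by rw [he.idem]⟩

theorem proj_mem {W : Type u} [AddCommGroup W] [Module k W] {A B F : Submodule k W} (h : IsCompl A B)
    (hF : F ≤ (F ⊓ A) ⊔ (F ⊓ B)) {x : W} (hx : x ∈ F) : A.projection B h x ∈ F := by
  obtain ⟨a, ha, b, hb, rfl⟩ := Submodule.mem_sup.1 (hF hx)
  rw [map_add, projection_apply_of_mem_left h ha.2, (projection_apply_eq_zero_iff h).2 hb.2, add_zero]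
  exact ha.1

theorem boundF (hT : T ^ 6 = 0) (hU : ∀ x ∈ U, T x ∈ U) (hI : IndF T U n e) : |fF U n e| ≤ 6 := by
  have he := hI.fam
  rw [← he.f_eq hT hU]
  apply QF.bound'
  intro A B hAB
  set p := A.projection B hAB.1 with hp
  have hPEm : ∀ w, PE n e w ∈ EF n e := fun w i' => by rw [PE_apply, he.idem]
  have hPEi : ∀ w ∈ EF n e, PE n e w = w := fun w hw => by funext i'; rw [PE_apply]; exact hw i'
  let P : (Fin n → V) →ₗ[k] (Fin n → V) :=
    (EF n e).subtype ∘ₗ p ∘ₗ (PE n e).codRestrict (EF n e) hPEm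
  have hP : ∀ w (hw : w ∈ EF n e), P w = (p ⟨w, hw⟩ : EF n e) := by
    intro w hw
    change ((p _ : EF n e) : Fin n → V) = _
    congr 2
    apply Subtype.ext
    exact hPEi w hw
  have hPE : ∀ w, P w ∈ EF n e := fun w => (p _ : EF n e).2
  have hPP : ∀ w, P (P w) = P w := by
    intro w
    rw [hP _ (hPE w)]
    change ((p (p _) : EF n e) : Fin n → V) = ((p _ : EF n e) : Fin n → V)
    rw [hp, projection_apply_of_mem_left hAB.1 (projection_apply_mem hAB.1 _)]
  have hgen : ∀ i j w, w ∈ (QD T U n hT hU).F i j → w ∈ EF n e → P w ∈ (QD T U n hT hU).F i j := by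
    intro i j w hw hE
    rw [hP w hE]
    exact proj_mem hAB.1 (hAB.2 i j) (x := ⟨w, hE⟩) hw
  have hM : ∀ i, ∀ w ∈ Mw T n ⊥ i, w ∈ EF n e → P w ∈ Mw T n ⊥ i := fun i w hw hE => hgen i 0 w hw hE
  have hM' : ∀ i, ∀ w ∈ Mw T n U i, w ∈ EF n e → P w ∈ Mw T n U i := fun i w hw hE => by
    have h := hgen (i+2) 1 w
    change w ∈ Mw T n U (i+2-2) → w ∈ EF n e → P w ∈ Mw T n U (i+2-2) at h
    rw [show i + 2 - 2 = i by ring] at h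
    exact h hw hE
  have hL : ∀ i, ∀ w ∈ Lw (k := k) V n i, w ∈ EF n e → P w ∈ Lw (k := k) V n i := fun i w hw hE => by
    have h := hgen (i+4) 2 w
    change w ∈ Lw (k := k) V n (i+4-4) → w ∈ EF n e → P w ∈ Lw (k := k) V n (i+4-4) at h
    rw [show i + 4 - 4 = i by ring] at h
    exact h hw hE
  obtain ⟨f1, f2⟩ := fam_q he hPE hPP hM hM' hL
  have fin : ∀ (i : ℤ) (w : EF n e), w ∈ ((QD T U n hT hU).sub (EF n e)).F (i+4) 2 →
      (0 ≤ i → i < n → sg T n i (w : Fin n → V) = 0) → w ∈ ((QD T U n hT hU).sub (EF n e)).F i 0 := by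
    intro i w hw h
    change (w : Fin n → V) ∈ Lw (k := k) V n (i+4-4) at hw
    change (w : Fin n → V) ∈ Mw T n ⊥ i
    rw [show i + 4 - 4 = i by ring] at hw
    refine ⟨hw, fun h1 => ?_⟩
    rw [Submodule.mem_bot]
    by_cases h0 : 0 ≤ i
    · exact h h0 h1
    · rw [Lw_bot n (by omega), Submodule.mem_bot] at hw
      rw [hw, map_zero]
  have hLw : ∀ (i : ℤ) (w : EF n e), w ∈ ((QD T U n hT hU).sub (EF n e)).F (i+4) 2 → (w : Fin n → V) ∈ Lw (k := k) V n i := by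
    intro i w hw
    change (w : Fin n → V) ∈ Lw (k := k) V n (i+4-4) at hw
    rwa [show i + 4 - 4 = i by ring] at hw
  rcases hI.ind _ f1 f2 with hq | hq
  · left
    rintro i w ⟨hw, hA⟩
    apply fin i w hw
    intro h0 h1
    have h2 := key_q he hM h0 h1 (hLw i w hw) w.2
    rw [hP _ w.2, show (⟨w, w.2⟩ : EF n e) = w from rfl, hp, projection_apply_of_mem_left hAB.1 hA] at h2
    rw [h2]
    have := LinearMap.congr_fun (hq i) (sg T n i (w : Fin n → V))
    simpa using this
  · right
    rintro i w ⟨hw, hB⟩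
    apply fin i w hw
    intro h0 h1
    have h2 := key_q he hM h0 h1 (hLw i w hw) w.2
    rw [hP _ w.2, show (⟨w, w.2⟩ : EF n e) = w from rfl, hp, (projection_apply_eq_zero_iff hAB.1).2 hB] at h2
    have := LinearMap.congr_fun (hq i) (sg T n i (w : Fin n → V))
    simp only [LinearMap.comp_apply] at this
    rw [← h2, he.sg_fix h1 (hLw i w hw) w.2] at this
    rw [← this]; simp

end
end St6

set_option linter.unusedSectionVars false
set_option linter.unusedVariables false
namespace St6
open Module Submodule

variable {k : Type u} [Field k] {V : Type u} [AddCommGroup V] [Module k V] [FiniteDimensional k V]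
variable {T : V →ₗ[k] V} {U : Submodule k V} {n : ℕ} {e : ℤ → V →ₗ[k] V}

theorem d_split {a q : V →ₗ[k] V} (haa : ∀ v, a (a v) = a v) (hqq : ∀ v, q (q v) = q v)
    (h1 : ∀ v, a (q v) = q v) (h2 : ∀ v, q (a v) = q v)
    {p : Submodule k V} (hp : ∀ v ∈ p, q v ∈ p) (hp' : ∀ v ∈ p, a v ∈ p) :
    d (p.map a) = d (p.map q) + d (p.map (a - q)) := by
  have e1 : p.map a = p.map q ⊔ p.map (a - q) := by
    apply le_antisymm
    · rintro _ ⟨v, hv, rfl⟩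
      rw [show a v = q v + (a - q) v by simp]
      exact add_mem_sup ⟨v, hv, rfl⟩ ⟨v, hv, rfl⟩
    · apply sup_le
      · rintro _ ⟨v, hv, rfl⟩
        exact ⟨q v, hp v hv, h1 v⟩
      · rintro _ ⟨v, hv, rfl⟩
        refine ⟨(a - q) v, sub_mem (hp' v hv) (hp v hv), ?_⟩
        simp [haa, h1]
  have e2 : p.map q ⊓ p.map (a - q) = ⊥ := by
    rw [eq_bot_iff]
    rintro _ ⟨⟨x, hx, rfl⟩, ⟨y, hy, hxy⟩⟩
    have : q (q x) = q ((a - q) y) := by rw [hxy]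
    rw [LinearMap.sub_apply, map_sub, h2, hqq, hqq, sub_self] at this
    rw [this]; exact zero_mem _
  have := d_sup_inf (p.map q) (p.map (a - q))
  rw [e2, d_bot, ← e1] at this
  linarith

theorem Fam.sub {q : ℤ → V →ₗ[k] V} (he : Fam T U n e) (hq : Fam T U n q) (hs : SubF q e) :
    Fam T U n (fun i => e i - q i) where
  supp i hi := by rw [he.supp i hi, hq.supp i hi, sub_self]
  comm i h0 h1 v := by simp [he.comm i h0 h1, hq.comm i h0 h1]
  U i u hu := sub_mem (he.U i u hu) (hq.U i u hu)
  idem i v := by simp [he.idem, hq.idem, (hs i _).1, (hs i _).2]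

noncomputable def tot (n : ℕ) (e : ℤ → V →ₗ[k] V) : ℤ := ∑ i ∈ Finset.Ico (0 : ℤ) n, d (LinearMap.range (e i))

theorem tot_pos (he : Fam T U n e) (h : ∃ i, e i ≠ 0) : 0 < tot n e := by
  obtain ⟨i, hi⟩ := h
  apply Finset.sum_pos' (fun i _ => d_nonneg _)
  refine ⟨i, ?_, d_pos (fun h => hi (LinearMap.range_eq_bot.1 h))⟩
  rw [Finset.mem_Ico]
  by_contra hc
  exact hi (he.supp i (by omega))

theorem tot_nonneg : 0 ≤ tot n e := Finset.sum_nonneg fun i _ => d_nonneg _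

theorem A1 (hT : T ^ 6 = 0) (hU : ∀ x ∈ U, T x ∈ U)
    (hno : ∀ e, IndF T U n e → e 0 ≠ 0 ∨ e ((n : ℤ) - 1) ≠ 0) (N : ℕ) : ∀ e, Fam T U n e → tot n e ≤ N →
    |fF U n e| ≤ 6 * (d (LinearMap.range (e 0)) + d (LinearMap.range (e ((n : ℤ) - 1)))) := by
  induction N with
  | zero =>
    intro e he h
    have hz : ∀ i, e i = 0 := by
      by_contra hc
      push Not at hc
      have := tot_pos he hc
      push_cast at h
      omega
    have : fF U n e = 0 := by
      unfold fF
      apply Finset.sum_eq_zero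
      intro i _
      rw [hz i, Submodule.map_zero, LinearMap.range_zero]; simp
    rw [this, abs_zero]
    have := d_nonneg (LinearMap.range (e 0))
    have := d_nonneg (LinearMap.range (e ((n : ℤ) - 1)))
    omega
  | succ N ih =>
    intro e he h
    have n0 := d_nonneg (LinearMap.range (e 0))
    have n1 := d_nonneg (LinearMap.range (e ((n : ℤ) - 1)))
    by_cases hz : ∃ i, e i ≠ 0
    swap
    · apply ih e he
      have : tot n e = 0 := by
        unfold tot
        apply Finset.sum_eq_zero
        intro i _
        push Not at hz
        rw [hz i, LinearMap.range_zero]; simp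
      rw [this]; positivity
    by_cases hi : IndF T U n e
    · have hb := boundF hT hU hi
      have hpos : ∀ i, e i ≠ 0 → 0 < d (LinearMap.range (e i)) := fun i hi =>
        d_pos (fun h => hi (LinearMap.range_eq_bot.1 h))
      rcases hno e hi with h | h
      · have := hpos _ h; omega
      · have := hpos _ h; omega
    · have : ∃ q, Fam T U n q ∧ SubF q e ∧ (∃ i, q i ≠ 0) ∧ ∃ i, q i ≠ e i := by
        by_contra hc
        apply hi
        refine ⟨he, hz, fun q hq hs => ?_⟩
        by_contra hc'
        push Not at hc'
        exact hc ⟨q, hq, hs, hc'.1, hc'.2⟩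
      obtain ⟨q, hq, hs, hq0, i, hqe⟩ := this
      have hr := he.sub hq hs
      have t1 := tot_pos hq hq0
      have t2 := tot_pos hr ⟨i, fun h => hqe (sub_eq_zero.1 h).symm⟩
      have dr : ∀ i, d (LinearMap.range (e i)) = d (LinearMap.range (q i)) + d (LinearMap.range (e i - q i)) := by
        intro i
        have := d_split (he.idem i) (hq.idem i) (fun v => (hs i v).1) (fun v => (hs i v).2) (p := ⊤)
          (fun _ _ => trivial) (fun _ _ => trivial)
        simpa only [← LinearMap.range_eq_map] using this
      have dU : ∀ i, d (U.map (e i)) = d (U.map (q i)) + d (U.map (e i - q i)) := fun i =>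
        d_split (he.idem i) (hq.idem i) (fun v => (hs i v).1) (fun v => (hs i v).2) (hq.U i) (he.U i)
      have t3 : tot n e = tot n q + tot n (fun i => e i - q i) := by
        unfold tot
        rw [← Finset.sum_add_distrib]
        exact Finset.sum_congr rfl fun i _ => dr i
      have t4 : fF U n e = fF U n q + fF U n (fun i => e i - q i) := by
        unfold fF
        rw [← Finset.sum_add_distrib]
        refine Finset.sum_congr rfl fun i _ => ?_
        rw [dr, dU]; ring
      push_cast at h
      have i1 := ih q hq (by omega)
      have i2 := ih _ hr (by omega)
      rw [t4, dr 0, dr ((n : ℤ) - 1)]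
      refine (abs_add_le _ _).trans ?_
      linarith

theorem exists_interior (hT : T ^ 6 = 0) (hU : ∀ x ∈ U, T x ∈ U) (h : (finrank k V : ℤ) - 2 * d U ≠ 0)
    (hn : 12 * (finrank k V : ℤ) < n) : ∃ e, IndF T U n e ∧ e 0 = 0 ∧ e ((n : ℤ) - 1) = 0 := by
  by_contra hc
  push Not at hc
  have hno : ∀ e, IndF T U n e → e 0 ≠ 0 ∨ e ((n : ℤ) - 1) ≠ 0 := by
    intro e he
    by_contra h
    push Not at h
    exact hc e he h.1 h.2
  let e1 : ℤ → V →ₗ[k] V := fun i => if 0 ≤ i ∧ i < (n : ℤ) then LinearMap.id else 0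
  have e1i : ∀ i, 0 ≤ i → i < (n : ℤ) → e1 i = LinearMap.id := fun i h0 h1 => if_pos ⟨h0, h1⟩
  have e1o : ∀ i, (i < 0 ∨ (n : ℤ) ≤ i) → e1 i = 0 := fun i hi => if_neg (by omega)
  have hf : Fam T U n e1 := by
    refine ⟨e1o, ?_, ?_, ?_⟩
    · intro i h0 h1 v
      rw [e1i i h0 (by omega), e1i (i+1) (by omega) h1]; rfl
    · intro i u hu
      by_cases hi : i < 0 ∨ (n : ℤ) ≤ i
      · rw [e1o i hi]; exact zero_mem _
      · push Not at hi
        rw [e1i i hi.1 hi.2]; exact hu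
    · intro i v
      by_cases hi : i < 0 ∨ (n : ℤ) ≤ i
      · rw [e1o i hi]; rfl
      · push Not at hi
        rw [e1i i hi.1 hi.2]; rfl
  have hb := A1 hT hU hno (tot n e1).toNat e1 hf (by rw [Int.toNat_of_nonneg tot_nonneg])
  have hd : (0:ℤ) ≤ finrank k V := by positivity
  rw [e1i 0 le_rfl (by omega), e1i ((n:ℤ)-1) (by omega) (by omega), LinearMap.range_id, d_top] at hb
  have hF : fF U n e1 = n * ((finrank k V : ℤ) - 2 * d U) := by
    unfold fF
    rw [Finset.sum_congr rfl (g := fun _ => (finrank k V : ℤ) - 2 * d U)]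
    · simp [mul_sub]
    · intro i hi
      rw [Finset.mem_Ico] at hi
      rw [e1i i hi.1 hi.2, LinearMap.range_id, d_top, Submodule.map_id]
  rw [hF, abs_mul, Nat.abs_cast] at hb
  have := Int.one_le_abs h
  nlinarith

/-- degree `c` families of maps -/
structure Hm (T : V →ₗ[k] V) (U : Submodule k V) (e : ℤ → V →ₗ[k] V) (c : ℤ) (Θ : ℤ → V →ₗ[k] V) : Prop where
  left : ∀ j v, e (j + c) (Θ j v) = Θ j v
  right : ∀ j v, Θ j (e j v) = Θ j v
  comm : ∀ j v, T (Θ j v) = Θ (j + 1) (T v)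
  U : ∀ j, ∀ u ∈ U, Θ j u ∈ U

def HH (T : V →ₗ[k] V) (U : Submodule k V) (e : ℤ → V →ₗ[k] V) (i l : ℤ) (θ : V →ₗ[k] V) : Prop :=
  ∃ Θ, Hm T U e (i - l) Θ ∧ Θ l = θ

theorem Hm.comp {a b : ℤ} {Θ Ψ : ℤ → V →ₗ[k] V} (h1 : Hm T U e a Θ) (h2 : Hm T U e b Ψ) :
    Hm T U e (a + b) (fun j => Θ (j + b) ∘ₗ Ψ j) where
  left j v := by
    have := h1.left (j + b) (Ψ j v)
    rw [show j + b + a = j + (a + b) by ring] at this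
    exact this
  right j v := by simp [h2.right]
  comm j v := by
    simp only [LinearMap.comp_apply]
    rw [h1.comm, h2.comm, show j + b + 1 = j + 1 + b by ring]
  U j u hu := h1.U _ _ (h2.U _ _ hu)

theorem HH.mul {i l j : ℤ} {x y : V →ₗ[k] V} (hx : HH T U e i l x) (hy : HH T U e l j y) : HH T U e i j (x * y) := by
  obtain ⟨Θ, h1, rfl⟩ := hx
  obtain ⟨Ψ, h2, rfl⟩ := hy
  refine ⟨_, by have := h1.comp h2; rwa [show i - l + (l - j) = i - j by ring] at this, ?_⟩
  rw [show j + (l - j) = l by ring]; rfl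

theorem HH.add {i l : ℤ} {x y : V →ₗ[k] V} (hx : HH T U e i l x) (hy : HH T U e i l y) : HH T U e i l (x + y) := by
  obtain ⟨Θ, h1, rfl⟩ := hx
  obtain ⟨Ψ, h2, rfl⟩ := hy
  exact ⟨fun j => Θ j + Ψ j, ⟨fun j v => by simp [h1.left, h2.left], fun j v => by simp [h1.right, h2.right],
    fun j v => by simp [h1.comm, h2.comm], fun j u hu => add_mem (h1.U j u hu) (h2.U j u hu)⟩, rfl⟩

theorem HH.neg {i l : ℤ} {x : V →ₗ[k] V} (hx : HH T U e i l x) : HH T U e i l (-x) := by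
  obtain ⟨Θ, h1, rfl⟩ := hx
  exact ⟨fun j => - Θ j, ⟨fun j v => by simp [h1.left], fun j v => by simp [h1.right],
    fun j v => by simp [h1.comm], fun j u hu => neg_mem (h1.U j u hu)⟩, rfl⟩

theorem HH.zero (i l : ℤ) : HH T U e i l 0 :=
  ⟨fun _ => 0, ⟨fun j v => by simp, fun j v => by simp, fun j v => by simp, fun j u hu => zero_mem _⟩, rfl⟩

theorem fitting_mem {N : V →ₗ[k] V} {p : Submodule k V} (hp : ∀ v ∈ p, N v ∈ p) {v : V} (hv : v ∈ p) :
    ∃ v' ∈ p, (N ^ finrank k V) v = (N ^ finrank k V) ((N ^ finrank k V) v') := by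
  set K := finrank k V
  have hpK : ∀ m, ∀ v ∈ p, (N ^ m) v ∈ p := by
    intro m
    induction m with
    | zero => intro v hv; simpa using hv
    | succ m ih => intro v hv; rw [pow_succ', Module.End.mul_apply]; exact hp _ (ih v hv)
  have hk : LinearMap.ker (N ^ (K + K)) = LinearMap.ker (N ^ K) :=
    Module.End.ker_pow_eq_ker_pow_finrank_of_le (by omega)
  have h : p.map (N ^ (K + K)) = p.map (N ^ K) := by
    apply eq_of_le_of_d
    · rintro _ ⟨x, hx, rfl⟩
      exact ⟨(N ^ K) x, hpK K x hx, by rw [pow_add, Module.End.mul_apply]⟩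
    · rw [d_map, d_map, hk]
  have hm : (N ^ K) v ∈ p.map (N ^ (K + K)) := by rw [h]; exact ⟨v, hv, rfl⟩
  obtain ⟨v', hv', h'⟩ := hm
  exact ⟨v', hv', by rw [← h', pow_add, Module.End.mul_apply]⟩

theorem fitting_compl (N : V →ₗ[k] V) :
    IsCompl (LinearMap.range (N ^ finrank k V)) (LinearMap.ker (N ^ finrank k V)) := by
  set K := finrank k V with hK
  have hk : LinearMap.ker (N ^ (K + K)) = LinearMap.ker (N ^ K) :=
    Module.End.ker_pow_eq_ker_pow_finrank_of_le (by omega)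
  constructor
  · rw [disjoint_iff, eq_bot_iff]
    rintro _ ⟨⟨x, rfl⟩, hx⟩
    have h1 : x ∈ LinearMap.ker (N ^ (K + K)) := by
      rw [LinearMap.mem_ker, pow_add, Module.End.mul_apply]; exact hx
    rw [hk] at h1
    rw [Submodule.mem_bot]; exact h1
  · rw [codisjoint_iff, eq_top_iff]
    intro v _
    obtain ⟨v', -, h⟩ := fitting_mem (N := N) (p := ⊤) (fun _ _ => trivial) (v := v) trivial
    rw [show v = (N ^ K) v' + (v - (N ^ K) v') by abel]
    refine add_mem_sup (show (N ^ K) v' ∈ LinearMap.range (N ^ K) from ⟨v', rfl⟩) ?_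
    rw [LinearMap.mem_ker, map_sub, h, sub_self]

theorem fitting_eq (N : V →ₗ[k] V) {v v' : V} (h : (N ^ finrank k V) v = (N ^ finrank k V) ((N ^ finrank k V) v')) :
    (LinearMap.range (N ^ finrank k V)).projection _ (fitting_compl N) v = (N ^ finrank k V) v' := by
  have hc := fitting_compl N
  have : v = (N ^ finrank k V) v' + (v - (N ^ finrank k V) v') := by abel
  rw [this, map_add, projection_apply_of_mem_left hc ⟨v', rfl⟩, (projection_apply_eq_zero_iff hc).2, add_zero]
  rw [LinearMap.mem_ker, map_sub, h, sub_self]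

theorem fitting_ex (N : V →ₗ[k] V) (v : V) : ∃ v', (N ^ finrank k V) v = (N ^ finrank k V) ((N ^ finrank k V) v') := by
  obtain ⟨v', -, h⟩ := fitting_mem (N := N) (p := ⊤) (fun _ _ => trivial) (v := v) trivial
  exact ⟨v', h⟩

theorem nilp (hI : IndF T U n e) {a b : ℤ} {Θ Ψ : ℤ → V →ₗ[k] V} (h1 : Hm T U e a Θ) (h2 : Hm T U e b Ψ)
    (hab : a + b = 0) (hb : b ≠ 0) (j : ℤ) : (Θ (j + b) ∘ₗ Ψ j) ^ finrank k V = 0 := by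
  have h := h1.comp h2
  rw [hab] at h
  set N : ℤ → V →ₗ[k] V := fun j => Θ (j + b) ∘ₗ Ψ j with hN
  change N j ^ finrank k V = 0
  by_cases hV : finrank k V = 0
  · have := finrank_zero_iff.1 hV
    exact Subsingleton.elim _ _
  set K := finrank k V with hK
  obtain ⟨K', hK'⟩ := Nat.exists_eq_succ_of_ne_zero hV
  have hTK : ∀ j m v, T ((N j ^ m) v) = (N (j+1) ^ m) (T v) := by
    intro j m
    induction m with
    | zero => intro v; simp
    | succ m ih => intro v; rw [pow_succ, Module.End.mul_apply, ih, h.comm, pow_succ, Module.End.mul_apply]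
  have heK : ∀ j v, e j ((N j ^ K) v) = (N j ^ K) v := by
    intro j v
    rw [hK', Nat.succ_eq_add_one, pow_succ', Module.End.mul_apply]
    have := h.left j ((N j ^ K') v)
    rwa [add_zero] at this
  have hKe : ∀ j v, (N j ^ K) (e j v) = (N j ^ K) v := by
    intro j v
    rw [hK', Nat.succ_eq_add_one, pow_succ, Module.End.mul_apply, Module.End.mul_apply]
    rw [h.right j v]
  let q : ℤ → V →ₗ[k] V := fun j => (LinearMap.range (N j ^ K)).projection _ (fitting_compl (N j))
  have hq : ∀ j v v', (N j ^ K) v = (N j ^ K) ((N j ^ K) v') → q j v = (N j ^ K) v' := fun j v v' h => fitting_eq (N j) h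
  have hex : ∀ j v, ∃ v', (N j ^ K) v = (N j ^ K) ((N j ^ K) v') := fun j v => fitting_ex (N j) v
  have hs : SubF q e := by
    intro j v
    obtain ⟨v', hv'⟩ := hex j v
    constructor
    · rw [hq j v v' hv', heK]
    · rw [hq j v v' hv', hq j (e j v) v' (by rw [hKe, hv'])]
  have hf : Fam T U n q := by
    refine ⟨?_, ?_, ?_, ?_⟩
    · intro i hi
      ext v
      rw [← (hs i v).2, hI.fam.supp i hi]; simp
    · intro i _ _ v
      obtain ⟨v', hv'⟩ := hex i v
      rw [hq i v v' hv', hTK, hq (i+1) (T v) (T v')]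
      rw [← hTK, ← hTK, ← hTK, hv']
    · intro i u hu
      obtain ⟨u', hu', huu⟩ := fitting_mem (h.U i) hu
      rw [hq i u u' huu]
      have : ∀ m, ∀ v ∈ U, (N i ^ m) v ∈ U := by
        intro m
        induction m with
        | zero => intro v hv; simpa using hv
        | succ m ih => intro v hv; rw [pow_succ', Module.End.mul_apply]; exact h.U _ _ (ih v hv)
      exact this K u' hu'
    · intro i v
      exact projection_apply_of_mem_left (fitting_compl (N i)) (projection_apply_mem (fitting_compl (N i)) _)
  rcases hI.ind q hf hs with h0 | h0
  · ext v
    have h3 : q j ((N j ^ K) v) = (N j ^ K) v := hq j _ v rfl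
    rw [h0 j] at h3
    rw [← h3]; rfl
  · exfalso
    have step : ∀ j, e j ≠ 0 → e (j + b) ≠ 0 := by
      intro j hj hz
      apply hj
      have hP : Ψ j = 0 := by
        ext v
        rw [← h2.left j v, hz]; simp
      have hNj : N j = 0 := by rw [hN]; simp [hP]
      rw [← h0 j]
      ext v
      obtain ⟨v', hv'⟩ := hex j v
      rw [hq j v v' hv', hNj, hK']; simp
    obtain ⟨i, hi⟩ := hI.ne
    have all : ∀ c : ℕ, e (i + c * b) ≠ 0 := by
      intro c
      induction c with
      | zero => simpa using hi
      | succ c ih =>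
        have := step _ ih
        rwa [show i + c * b + b = i + ((c + 1 : ℕ) : ℤ) * b by push_cast; ring] at this
    have hin : ∀ j, e j ≠ 0 → 0 ≤ j ∧ j < n := by
      intro j hj
      by_contra hc
      exact hj (hI.fam.supp j (by omega))
    have b0 := hin _ hi
    have b1 := hin _ (all (n + 1))
    push_cast at b1
    rcases lt_or_gt_of_ne hb with hb | hb
    · nlinarith
    · nlinarith

theorem HH.nilp (hI : IndF T U n e) {i l : ℤ} (hil : i ≠ l) {x y : V →ₗ[k] V} (hx : HH T U e i l x) (hy : HH T U e l i y) :
    (x * y) ^ finrank k V = 0 := by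
  obtain ⟨Θ, h1, rfl⟩ := hx
  obtain ⟨Ψ, h2, rfl⟩ := hy
  have := St6.nilp hI h1 h2 (by ring) (by omega) i
  rwa [show i + (l - i) = l by ring] at this

theorem elim (hI : IndF T U n e) (S : Finset ℤ) : ∀ (x : ℤ → ℤ → V →ₗ[k] V) (w : ℤ → V),
    (∀ i ∈ S, ∀ l ∈ S, i ≠ l → HH T U e i l (x i l)) → (∀ i ∈ S, w i + ∑ l ∈ S.erase i, x i l (w l) = 0) →
    ∀ i ∈ S, w i = 0 := by
  induction S using Finset.induction_on with
  | empty => intro x w _ _ i hi; simp at hi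
  | insert a S ha ih =>
    intro x w hx hw
    have hmem : ∀ i ∈ S, i ∈ insert a S := fun i hi => Finset.mem_insert_of_mem hi
    have hma : a ∈ insert a S := Finset.mem_insert_self a S
    have hne : ∀ i ∈ S, i ≠ a := fun i hi h => ha (h ▸ hi)
    have hG : ∀ i, ∃ G : V →ₗ[k] V, i ∈ S → G * (1 - x i a * x a i) = 1 ∧
        ∀ l z, HH T U e i l z → HH T U e i l (G * z) := by
      intro i
      by_cases hi : i ∈ S
      swap
      · exact ⟨0, fun h => absurd h hi⟩
      have h1 := hx i (hmem i hi) a hma (hne i hi)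
      have h2 := hx a hma i (hmem i hi) (hne i hi).symm
      have hn := HH.nilp hI (hne i hi) h1 h2
      refine ⟨∑ t ∈ Finset.range (finrank k V), (x i a * x a i) ^ t, fun _ => ⟨?_, ?_⟩⟩
      · rw [geom_sum_mul_neg, hn, sub_zero]
      · intro l z hz
        rw [Finset.sum_mul]
        have : ∀ t, HH T U e i l ((x i a * x a i) ^ t * z) := by
          intro t
          induction t with
          | zero => simpa using hz
          | succ t ih => rw [pow_succ', mul_assoc]; exact (h1.mul h2).mul ih
        induction finrank k V with
        | zero => simpa using HH.zero i l
        | succ m ih' => rw [Finset.sum_range_succ]; exact ih'.add (this m)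
    choose G hG using hG
    have wa := hw a hma
    rw [Finset.erase_insert ha] at wa
    have wS : ∀ i ∈ S, w i = 0 := by
      apply ih (fun i l => G i * (x i l - x i a * x a l)) w
      · intro i hi l hl hil
        apply (hG i hi).2
        rw [sub_eq_add_neg]
        exact (hx i (hmem i hi) l (hmem l hl) hil).add
          ((hx i (hmem i hi) a hma (hne i hi)).mul (hx a hma l (hmem l hl) (hne l hl).symm)).neg
      · intro i hi
        have wi := hw i (hmem i hi)
        rw [Finset.erase_insert_of_ne (hne i hi).symm, Finset.sum_insert (fun h => ha (Finset.mem_of_mem_erase h))] at wi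
        rw [← Finset.add_sum_erase S _ hi] at wa
        have key : (1 - x i a * x a i) (w i) + ∑ l ∈ S.erase i, (x i l - x i a * x a l) (w l) = 0 := by
          simp only [LinearMap.sub_apply, Module.End.mul_apply, Finset.sum_sub_distrib, Module.End.one_apply]
          rw [← map_sum]
          have h3 := congrArg (x i a) wa
          rw [map_add, map_add, map_zero] at h3
          rw [← sub_zero (0 : V)]
          nth_rewrite 1 [← wi]
          rw [← h3]
          abel
        have h4 := congrArg (G i) key
        rw [map_add, map_zero, map_sum, ← Module.End.mul_apply, (hG i hi).1] at h4
        exact h4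
    intro i hi
    rcases Finset.mem_insert.1 hi with rfl | hi
    · rw [Finset.sum_eq_zero (fun l hl => by rw [wS l hl, map_zero]), add_zero] at wa
      exact wa
    · exact wS i hi

end St6

set_option linter.unusedSectionVars false
set_option linter.unusedVariables false
namespace St6
open Module Submodule

variable {k : Type u} [Field k] {V : Type u} [AddCommGroup V] [Module k V] [FiniteDimensional k V]
variable {T : V →ₗ[k] V} {U : Submodule k V} {n : ℕ} {e : ℤ → V →ₗ[k] V}

theorem comm_all (hI : IndF T U n e) (h0 : e 0 = 0) (h1 : e ((n : ℤ) - 1) = 0) (i : ℤ) (v : V) :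
    T (e i v) = e (i+1) (T v) := by
  by_cases a : i < 0
  · rw [hI.fam.supp i (Or.inl a)]
    by_cases b : i + 1 < 0
    · rw [hI.fam.supp (i+1) (Or.inl b)]; simp
    · rw [show i + 1 = 0 by omega, h0]; simp
  · by_cases b : i + 1 < (n : ℤ)
    · exact hI.fam.comm i (by omega) b v
    · rw [hI.fam.supp (i+1) (Or.inr (by omega))]
      by_cases c : (n : ℤ) ≤ i
      · rw [hI.fam.supp i (Or.inr c)]; simp
      · rw [show i = (n : ℤ) - 1 by omega, h1]; simp

theorem inj_w (hI : IndF T U n e) (hc : ∀ i v, T (e i v) = e (i+1) (T v)) (w : ℤ → V) (hw : ∀ l, e l (w l) = w l)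
    (h : ∀ i ∈ Finset.Ico (0 : ℤ) n, e i (∑ l ∈ Finset.Ico (0 : ℤ) n, w l) = 0) :
    ∀ i ∈ Finset.Ico (0 : ℤ) n, w i = 0 := by
  apply elim hI _ (fun i l => e i ∘ₗ e l) w
  · intro i _ l _ _
    refine ⟨fun j => e (j + (i - l)) ∘ₗ e j, ⟨?_, ?_, ?_, ?_⟩, ?_⟩
    · intro j v; simp [hI.fam.idem]
    · intro j v; simp [hI.fam.idem]
    · intro j v
      simp only [LinearMap.comp_apply]
      rw [hc, hc, show j + (i - l) + 1 = j + 1 + (i - l) by ring]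
    · intro j u hu
      exact hI.fam.U _ _ (hI.fam.U _ _ hu)
    · change e (l + (i - l)) ∘ₗ e l = _
      rw [show l + (i - l) = i by ring]
  · intro i hi
    have := h i hi
    rw [← Finset.add_sum_erase _ _ hi, map_add, hw i, map_sum] at this
    rw [← this]
    congr 1
    apply Finset.sum_congr rfl
    intro l _
    rw [LinearMap.comp_apply, hw l]

/-- summation map on the product of the pieces -/
noncomputable def sP (n : ℕ) (e : ℤ → V →ₗ[k] V) (p : Submodule k V) :
    ((i : Finset.Ico (0 : ℤ) n) → p.map (e i)) →ₗ[k] V :=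
  ∑ i : Finset.Ico (0 : ℤ) n, (p.map (e i)).subtype ∘ₗ LinearMap.proj i

theorem sP_apply (p : Submodule k V) (w : (i : Finset.Ico (0 : ℤ) n) → p.map (e i)) :
    sP n e p w = ∑ i : Finset.Ico (0 : ℤ) n, (w i : V) := by
  simp [sP, LinearMap.sum_apply]

theorem sP_inj (hI : IndF T U n e) (hc : ∀ i v, T (e i v) = e (i+1) (T v)) (p : Submodule k V)
    (w : (i : Finset.Ico (0 : ℤ) n) → p.map (e i))
    (h : ∀ i ∈ Finset.Ico (0 : ℤ) n, e i (sP n e p w) = 0) : w = 0 := by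
  classical
  let w' : ℤ → V := fun i => if hi : i ∈ Finset.Ico (0 : ℤ) n then (w ⟨i, hi⟩ : V) else 0
  have e1 : ∀ i (hi : i ∈ Finset.Ico (0 : ℤ) n), w' i = w ⟨i, hi⟩ := fun i hi => dif_pos hi
  have hs : ∑ l ∈ Finset.Ico (0 : ℤ) n, w' l = sP n e p w := by
    rw [sP_apply, ← Finset.sum_coe_sort]
    apply Finset.sum_congr rfl
    intro i _
    exact e1 i i.2
  have h2 := inj_w hI hc w' (fun l => ?_) (fun i hi => by rw [hs]; exact h i hi)
  · funext i
    apply Subtype.ext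
    rw [← e1 i i.2, h2 i i.2]; rfl
  · by_cases hl : l ∈ Finset.Ico (0 : ℤ) n
    · rw [e1 l hl]
      obtain ⟨x, hx, hx'⟩ := (w ⟨l, hl⟩).2
      rw [← hx', hI.fam.idem]
    · have : w' l = 0 := dif_neg hl
      rw [this, map_zero]

theorem sP_surj (hI : IndF T U n e) (hc : ∀ i v, T (e i v) = e (i+1) (T v)) {p : Submodule k V}
    (hp : ∀ i, ∀ v ∈ p, e i v ∈ p) {v : V} (hv : v ∈ p) :
    ∃ w : (i : Finset.Ico (0 : ℤ) n) → p.map (e i), ∀ i, e i (v - sP n e p w) = 0 := by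
  have hsp : ∀ w, sP n e p w ∈ p := by
    intro w
    rw [sP_apply]
    apply sum_mem
    intro i _
    obtain ⟨x, hx, hx'⟩ := (w i).2
    rw [← hx']; exact hp _ x hx
  let g : ((i : Finset.Ico (0 : ℤ) n) → p.map (e i)) →ₗ[k] ((i : Finset.Ico (0 : ℤ) n) → p.map (e i)) :=
    LinearMap.pi fun i => (e i ∘ₗ sP n e p).codRestrict (p.map (e i)) (fun w => ⟨_, hsp w, rfl⟩)
  have hg : ∀ w (i : Finset.Ico (0 : ℤ) n), ((g w i : p.map (e i)) : V) = e i (sP n e p w) := fun w i => rfl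
  have gi : Function.Injective g := by
    rw [injective_iff_map_eq_zero]
    intro w hw
    apply sP_inj hI hc p w
    intro i hi
    have := hg w ⟨i, hi⟩
    rw [hw] at this
    exact this.symm
  obtain ⟨w, hw⟩ := (LinearMap.injective_iff_surjective.1 gi) (fun i => ⟨e i v, v, hv, rfl⟩)
  refine ⟨w, fun i => ?_⟩
  by_cases hi : i ∈ Finset.Ico (0 : ℤ) n
  · have := hg w ⟨i, hi⟩
    rw [hw] at this
    rw [map_sub, sub_eq_zero]; exact this
  · rw [Finset.mem_Ico] at hi
    rw [hI.fam.supp i (by omega)]; rfl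

theorem sP_dim (hI : IndF T U n e) (hc : ∀ i v, T (e i v) = e (i+1) (T v)) (hz : ∀ v, (∀ i, e i v = 0) → v = 0)
    {p : Submodule k V} (hp : ∀ i, ∀ v ∈ p, e i v ∈ p) :
    d p = ∑ i ∈ Finset.Ico (0 : ℤ) n, d (p.map (e i)) := by
  have hinj : Function.Injective (sP n e p) := by
    rw [injective_iff_map_eq_zero]
    intro w hw
    apply sP_inj hI hc p w
    intro i _
    rw [hw, map_zero]
  have hr : LinearMap.range (sP n e p) = p := by
    apply le_antisymm
    · rintro _ ⟨w, rfl⟩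
      rw [sP_apply]
      apply sum_mem
      intro i _
      obtain ⟨x, hx, hx'⟩ := (w i).2
      rw [← hx']; exact hp _ x hx
    · intro v hv
      obtain ⟨w, hw⟩ := sP_surj hI hc hp hv
      exact ⟨w, (sub_eq_zero.1 (hz _ hw)).symm⟩
  have h1 := LinearMap.finrank_range_of_inj hinj
  rw [hr, Module.finrank_pi_fintype] at h1
  unfold d
  rw [h1, Nat.cast_sum]
  exact Finset.sum_coe_sort (Finset.Ico (0 : ℤ) n) (fun i => (finrank k (p.map (e i)) : ℤ))

theorem main (hT : T ^ 6 = 0) (hU : ∀ x ∈ U, T x ∈ U)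
    (hY : ¬∃ V₁ V₂ : Submodule k V, V₁ ≠ ⊥ ∧ V₂ ≠ ⊥ ∧ IsCompl V₁ V₂ ∧
          (∀ x ∈ V₁, T x ∈ V₁) ∧ (∀ x ∈ V₂, T x ∈ V₂) ∧ U = U ⊓ V₁ ⊔ U ⊓ V₂) :
    |(finrank k V : ℤ) - 2 * d U| ≤ 6 := by
  by_cases hf : (finrank k V : ℤ) - 2 * d U = 0
  · rw [hf]; norm_num
  obtain ⟨e, hI, h0, h1⟩ := exists_interior (n := 12 * finrank k V + 1) hT hU hf (by push_cast; omega)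
  set n := 12 * finrank k V + 1
  have hc := comm_all hI h0 h1
  have hz : ∀ v, (∀ i, e i v = 0) → v = 0 := by
    let C : Submodule k V := ⨅ i, LinearMap.ker (e i)
    have memC : ∀ v, v ∈ C ↔ ∀ i, e i v = 0 := fun v => by simp [C, Submodule.mem_iInf]
    let W : Submodule k V := LinearMap.range (sP n e ⊤)
    have memW : ∀ i v, e i v ∈ W := by
      classical
      intro i v
      by_cases hi : i ∈ Finset.Ico (0 : ℤ) n
      · refine ⟨Pi.single ⟨i, hi⟩ ⟨e i v, v, trivial, rfl⟩, ?_⟩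
        rw [sP_apply, Finset.sum_eq_single (⟨i, hi⟩ : Finset.Ico (0 : ℤ) n)]
        · simp
        · intro b _ hb
          rw [Pi.single_eq_of_ne hb]; rfl
        · simp
      · rw [Finset.mem_Ico] at hi
        rw [hI.fam.supp i (by omega)]; exact zero_mem _
    by_contra hcon
    push Not at hcon
    obtain ⟨v, hv, hv0⟩ := hcon
    apply hY
    have hW' : ∀ (p : Submodule k V) w, sP n e p w ∈ W := by
      intro p w
      rw [sP_apply]
      apply sum_mem
      intro i _
      obtain ⟨x, hx, hx'⟩ := (w i).2
      rw [← hx']; exact memW _ x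
    refine ⟨W, C, ?_, ?_, ⟨?_, ?_⟩, ?_, ?_, ?_⟩
    · intro hW
      obtain ⟨i, hi⟩ := hI.ne
      apply hi
      ext v
      have := memW i v
      rw [hW, Submodule.mem_bot] at this
      rw [this]; rfl
    · intro hC
      have := (memC v).2 hv
      rw [hC, Submodule.mem_bot] at this
      exact hv0 this
    · rw [disjoint_iff, eq_bot_iff]
      rintro _ ⟨⟨w, rfl⟩, hx⟩
      have hx' := (memC _).1 hx
      have := sP_inj hI hc ⊤ w (fun i _ => hx' i)
      rw [this, map_zero]; exact zero_mem _
    · rw [codisjoint_iff, eq_top_iff]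
      intro v _
      obtain ⟨w, hw⟩ := sP_surj hI hc (p := ⊤) (fun _ _ _ => trivial) (v := v) trivial
      rw [show v = sP n e ⊤ w + (v - sP n e ⊤ w) by abel]
      exact add_mem_sup (hW' _ w) ((memC _).2 hw)
    · rintro _ ⟨w, rfl⟩
      rw [sP_apply, map_sum]
      apply sum_mem
      intro i _
      obtain ⟨x, hx, hx'⟩ := (w i).2
      rw [← hx', hc]; exact memW _ _
    · intro x hx
      rw [memC] at hx ⊢
      intro i
      have := hc (i-1) x
      rw [hx, map_zero, show i - 1 + 1 = i by ring] at this
      exact this.symm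
    · apply le_antisymm
      · intro v hv
        obtain ⟨w, hw⟩ := sP_surj hI hc (p := U) hI.fam.U hv
        have hm : sP n e U w ∈ U := by
          rw [sP_apply]
          apply sum_mem
          intro i _
          obtain ⟨x, hx, hx'⟩ := (w i).2
          rw [← hx']; exact hI.fam.U _ x hx
        rw [show v = sP n e U w + (v - sP n e U w) by abel]
        exact add_mem_sup ⟨hm, hW' _ w⟩ ⟨sub_mem hv hm, (memC _).2 hw⟩
      · exact sup_le inf_le_left inf_le_left
  have hb := boundF hT hU hI
  have d1 := sP_dim hI hc hz (p := ⊤) (fun _ _ _ => trivial)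
  have d2 := sP_dim hI hc hz (p := U) hI.fam.U
  have : fF U n e = (finrank k V : ℤ) - 2 * d U := by
    rw [← d_top, d1, d2]
    unfold fF
    rw [Finset.mul_sum, ← Finset.sum_sub_distrib]
    exact Finset.sum_congr rfl fun i _ => by rw [LinearMap.range_eq_map]
  rwa [this] at hb

theorem stack {X : Type u} [AddCommGroup X] [Module k X] [FiniteDimensional k X] {W' W U : Submodule k V} {UX : Submodule k X}
    (hle : W' ≤ W) (q : W →ₗ[k] X) (hq : Function.Surjective q) (hk : ∀ x : W, q x = 0 ↔ (x : V) ∈ W')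
    (hU : Submodule.map q (Submodule.comap W.subtype U) = UX) :
    d W = d W' + finrank k X ∧ d (U ⊓ W) = d (U ⊓ W') + d UX := by
  have hker : ∀ P : Submodule k V, d (P.comap W.subtype ⊓ LinearMap.ker q) = d (P ⊓ W') := by
    intro P
    rw [← d_map_subtype]
    congr 1
    ext v
    constructor
    · rintro ⟨x, ⟨h1, h2⟩, rfl⟩
      exact ⟨h1, (hk x).1 h2⟩
    · rintro ⟨h1, h2⟩
      exact ⟨⟨v, hle h2⟩, ⟨h1, (hk _).2 h2⟩, rfl⟩
  have gen : ∀ P : Submodule k V, d (Submodule.map q (P.comap W.subtype)) = d (P ⊓ W) - d (P ⊓ W') := by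
    intro P
    rw [d_map, hker, d_comap_subtype]
  have g1 := gen ⊤
  have g2 := gen U
  rw [hU] at g2
  rw [Submodule.comap_top, Submodule.map_top, LinearMap.range_eq_top.2 hq, d_top, top_inf_eq, top_inf_eq] at g1
  exact ⟨by linarith, by linarith⟩

theorem stack_all {X : Type u} [AddCommGroup X] [Module k X] [FiniteDimensional k X] {U : Submodule k V} {UX : Submodule k X}
    {m : ℕ} (W : Fin (m+1) → Submodule k V) (hW0 : W 0 = ⊥) (hWl : W (Fin.last m) = ⊤) (hm : Monotone W)
    (h : ∀ i : Fin m, ∃ q : W i.succ →ₗ[k] X, Function.Surjective q ∧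
      (∀ x : W i.succ, q x = 0 ↔ (x : V) ∈ W i.castSucc) ∧
      Submodule.map q (Submodule.comap (W i.succ).subtype U) = UX) :
    (finrank k V : ℤ) = m * finrank k X ∧ d U = m * d UX := by
  have : ∀ i : Fin (m+1), d (W i) = (i : ℕ) * finrank k X ∧ d (U ⊓ W i) = (i : ℕ) * d UX := by
    intro i
    induction i using Fin.induction with
    | zero => rw [hW0, inf_bot_eq]; simp
    | succ i ih =>
      obtain ⟨q, h1, h2, h3⟩ := h i
      obtain ⟨a, b⟩ := stack (hm (Fin.castSucc_le_succ i)) q h1 h2 h3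
      rw [a, b, ih.1, ih.2]
      simp only [Fin.val_castSucc, Fin.val_succ]
      push_cast
      constructor <;> ring
  have h2 := this (Fin.last m)
  rw [hWl, inf_top_eq, d_top, Fin.val_last] at h2
  exact h2

theorem fin_arith {m : ℕ} {v u x y : ℤ} (hv : v = m * x) (hu : u = m * y) (h : |v - 2 * u| ≤ 6) (hne : x ≠ 2 * y) : m ≤ 6 := by
  have e : v - 2 * u = m * (x - 2 * y) := by rw [hv, hu]; ring
  rw [e, abs_mul, Nat.abs_cast] at h
  have := Int.one_le_abs (sub_ne_zero.2 hne)
  have : (m : ℤ) ≤ 6 := by nlinarith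
  omega

end St6

/-- (0.1.7, second part) If `X` is an indecomposable object of `S_k(6)` whose dimension pair
`(v,u)` satisfies `v ≠ 2u`, and `X` is `m`-stackable for some `m ≥ 1`, then `m ≤ 6`. -/
theorem stmt6 (k : Type u) [Field k] (X : SObj k 6) (hX : X.Indec)
    (h : X.dimPair.1 ≠ 2 * X.dimPair.2)
    (m : ℕ) (hm : 1 ≤ m) (hs : X.Stackable m) :
    m ≤ 6 := by
  obtain ⟨Y, hY, W, hW0, hWl, hm', hW, hq⟩ := hs
  have hst := St6.stack_all (U := Y.U) (UX := X.U) W hW0 hWl hm' (fun i => by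
    obtain ⟨q, h1, h2, -, h4⟩ := hq i
    exact ⟨q, h1, h2, h4⟩)
  refine St6.fin_arith hst.1 hst.2 (St6.main Y.pow_eq_zero Y.maps_U hY.2) ?_
  intro hc
  apply h
  change (Module.finrank k X.carrier : ℤ) = 2 * (Module.finrank k X.U : ℤ) at hc
  change Module.finrank k X.carrier = 2 * Module.finrank k X.U
  exact_mod_cast hc
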